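/- Let B be the open unit ball in ℝⁿ and let F = F(A,p,u,x) be a C² real-valued function on Symₙ(ℝ) × ℝⁿ × ℝ × B such that for each fixed p ∈ ℝⁿ the map (A,u,x) ↦ F(A⁻¹,p,u,x) is locally convex on Sym⁺ₙ(ℝ) × ℝ × B. Let u ∈ C³(B) be a convex solution of F(D²u, Du, u, x) = 0 on B satisfying the uniform ellipticity condition Λ⁻¹|ξ|² ≤ F^{ij}(D²u,Du,u,x) ξᵢ ξⱼ ≤ Λ|ξ|² for all ξ ∈ ℝⁿ and all x ∈ B, for some constant Λ > 0. Let 0 ≤ λ₁(x) ≤ ⋯ ≤ λₙ(x) denote the eigenvalues of D²u(x) in increasing order. Then there exist positive constants C₀ and q, depending only on n, Λ, ‖u‖_{C³(B)} and ‖F‖_{C²}, such that for each ℓ = 1, …, n, ‖λ_ℓ‖_{L^q(B_{1/2})} ≤ C₀ · inf_{B_{1/2}} λ_ℓ, where B_{1/2} is the concentric ball of radius 1/2. -/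

import Mathlib

open Metric MeasureTheory

/-- The `i`-th partial derivative (0-based, junk value `0` if `i ≥ n`). -/
noncomputable def pd {n : ℕ} (f : EuclideanSpace ℝ (Fin n) → ℝ)
    (x : EuclideanSpace ℝ (Fin n)) (i : ℕ) : ℝ :=
  if h : i < n then fderiv ℝ f x (EuclideanSpace.single ⟨i, h⟩ 1) else 0

/-- The Hessian matrix of second partial derivatives. -/
noncomputable def hessM {n : ℕ} (u : EuclideanSpace ℝ (Fin n) → ℝ)
    (x : EuclideanSpace ℝ (Fin n)) : Matrix (Fin n) (Fin n) ℝ :=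
  Matrix.of fun i j => pd (fun y => pd u y (j : ℕ)) x (i : ℕ)

/-- The derivative `F^{ij}` of `F` in the matrix entry `A_{ij}`, evaluated at
`(D²u(x), Du(x), u(x), x)`.  The matrix argument of `F` is encoded as an element of
`Fin n → Fin n → ℝ`. -/
noncomputable def Fmat {n : ℕ}
    (F : (Fin n → Fin n → ℝ) × (Fin n → ℝ) × ℝ × EuclideanSpace ℝ (Fin n) → ℝ)
    (u : EuclideanSpace ℝ (Fin n) → ℝ) (x : EuclideanSpace ℝ (Fin n)) (i j : Fin n) : ℝ :=
  fderiv ℝ (fun A => F (A, fun l => pd u x l, u x, x)) (fun a b => hessM u x a b)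
    (fun a b => if a = i ∧ b = j then (1 : ℝ) else 0)

section LinearAlgebra

open Matrix

variable {n : ℕ}

/-- Two-sided bounds for the quadratic form of a matrix. -/
def EllipticBound (L : ℝ) (S : Matrix (Fin n) (Fin n) ℝ) : Prop :=
  ∀ ξ : Fin n → ℝ, L⁻¹ * (ξ ⬝ᵥ ξ) ≤ ξ ⬝ᵥ S *ᵥ ξ ∧ ξ ⬝ᵥ S *ᵥ ξ ≤ L * (ξ ⬝ᵥ ξ)

/-- The squared Frobenius norm. -/
def frobSq (V : Matrix (Fin n) (Fin n) ℝ) : ℝ := ∑ i, ∑ j, V i j ^ 2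

theorem exists_orthogonal_diagonalization {A : Matrix (Fin n) (Fin n) ℝ} (hA : A.IsSymm) :
    ∃ (U : Matrix (Fin n) (Fin n) ℝ) (d : Fin n → ℝ),
      Uᵀ * U = 1 ∧ U * Uᵀ = 1 ∧ A = U * diagonal d * Uᵀ := by
  have hA' : A.IsHermitian := by
    rw [IsHermitian, conjTranspose_eq_transpose_of_trivial]; exact hA
  refine ⟨hA'.eigenvectorUnitary, hA'.eigenvalues, ?_, ?_, ?_⟩
  · have := Unitary.coe_star_mul_self hA'.eigenvectorUnitary
    simpa [star_eq_conjTranspose] using this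
  · have := Unitary.coe_mul_star_self hA'.eigenvectorUnitary
    simpa [star_eq_conjTranspose] using this
  · have := hA'.spectral_theorem
    rw [Unitary.conjStarAlgAut_apply] at this
    simpa [star_eq_conjTranspose, Function.comp_def] using this

theorem posDef_isSymm {B : Matrix (Fin n) (Fin n) ℝ} (h : B.PosDef) : B.IsSymm := by
  have := h.isHermitian
  rwa [IsHermitian, conjTranspose_eq_transpose_of_trivial] at this

theorem diag_entry_pos_of_posDef {U A : Matrix (Fin n) (Fin n) ℝ} {d : Fin n → ℝ}
    (hU : Uᵀ * U = 1) (hA : A = U * diagonal d * Uᵀ) (hpos : A.PosDef) (i : Fin n) :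
    0 < d i := by
  have h1 : diagonal d = Uᵀ * A * U := by
    rw [hA]
    calc diagonal d = 1 * diagonal d * 1 := by simp
      _ = (Uᵀ * U) * diagonal d * (Uᵀ * U) := by rw [hU]
      _ = _ := by simp only [Matrix.mul_assoc]
  have hinj : Function.Injective U.mulVec := by
    intro v w hvw
    have := congrArg (fun z => Uᵀ *ᵥ z) hvw
    simpa [mulVec_mulVec, hU] using this
  have h2 : (diagonal d).PosDef := by
    rw [h1, ← conjTranspose_eq_transpose_of_trivial]
    exact hpos.conjTranspose_mul_mul_same hinj
  exact posDef_diagonal_iff.1 h2 i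

theorem isSymm_conj {A : Matrix (Fin n) (Fin n) ℝ} (hA : A.IsSymm)
    (R : Matrix (Fin n) (Fin n) ℝ) : (R * A * Rᵀ).IsSymm := by
  rw [IsSymm, transpose_mul, transpose_mul, transpose_transpose, hA.eq, Matrix.mul_assoc]

theorem exists_simultaneous_diagonalization {S A : Matrix (Fin n) (Fin n) ℝ}
    (hS : S.PosDef) (hA : A.IsSymm) :
    ∃ (R Q : Matrix (Fin n) (Fin n) ℝ) (d : Fin n → ℝ), R * Q = 1 ∧ Q * R = 1 ∧
      Rᵀ * R = S ∧ R * A * Rᵀ = diagonal d ∧ (A.PosDef → ∀ i, 0 < d i) := by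
  obtain ⟨U, s, hU, hU', hSU⟩ := exists_orthogonal_diagonalization (posDef_isSymm hS)
  have hs := diag_entry_pos_of_posDef hU hSU hS
  set R₀ : Matrix (Fin n) (Fin n) ℝ := diagonal (fun i => Real.sqrt (s i)) * Uᵀ with hR₀
  set Q₀ : Matrix (Fin n) (Fin n) ℝ := U * diagonal (fun i => (Real.sqrt (s i))⁻¹) with hQ₀
  have hd1 : diagonal (fun i => Real.sqrt (s i)) * diagonal (fun i => (Real.sqrt (s i))⁻¹)
      = 1 := by
    rw [diagonal_mul_diagonal, ← diagonal_one]
    congr 1; ext i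
    exact mul_inv_cancel₀ (Real.sqrt_pos.2 (hs i)).ne'
  have hd2 : diagonal (fun i => Real.sqrt (s i)) * diagonal (fun i => Real.sqrt (s i))
      = diagonal s := by
    rw [diagonal_mul_diagonal]
    congr 1; ext i
    exact Real.mul_self_sqrt (hs i).le
  have hRQ : R₀ * Q₀ = 1 := by
    rw [hR₀, hQ₀, Matrix.mul_assoc, ← Matrix.mul_assoc Uᵀ, hU, Matrix.one_mul, hd1]
  have hRR : R₀ᵀ * R₀ = S := by
    rw [hR₀, hSU, transpose_mul, transpose_transpose, diagonal_transpose, Matrix.mul_assoc,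
      ← Matrix.mul_assoc (diagonal _), hd2, ← Matrix.mul_assoc]
  have hQR : Q₀ * R₀ = 1 := mul_eq_one_comm.1 hRQ
  have hinj : Function.Injective R₀.vecMul := by
    intro v w hvw
    have := congrArg (fun z => z ᵥ* Q₀) hvw
    simpa [vecMul_vecMul, hRQ] using this
  have hB : (R₀ * A * R₀ᵀ).IsSymm := isSymm_conj hA R₀
  obtain ⟨W, d, hW, hW', hBW⟩ := exists_orthogonal_diagonalization hB
  refine ⟨Wᵀ * R₀, Q₀ * W, d, ?_, ?_, ?_, ?_, fun hpos => diag_entry_pos_of_posDef hW hBW ?_⟩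
  · rw [Matrix.mul_assoc, ← Matrix.mul_assoc R₀, hRQ, Matrix.one_mul, hW]
  · rw [Matrix.mul_assoc, ← Matrix.mul_assoc W, hW', Matrix.one_mul, hQR]
  · rw [transpose_mul, transpose_transpose, Matrix.mul_assoc, ← Matrix.mul_assoc W, hW',
      Matrix.one_mul, hRR]
  · rw [transpose_mul, transpose_transpose]
    calc Wᵀ * R₀ * A * (R₀ᵀ * W) = Wᵀ * (R₀ * A * R₀ᵀ) * W := by simp only [Matrix.mul_assoc]
      _ = (Wᵀ * W) * diagonal d * (Wᵀ * W) := by rw [hBW]; simp only [Matrix.mul_assoc]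
      _ = diagonal d := by rw [hW]; simp
  · rw [← conjTranspose_eq_transpose_of_trivial]
    exact hpos.mul_mul_conjTranspose_same hinj

theorem frobSq_transpose (V : Matrix (Fin n) (Fin n) ℝ) : frobSq Vᵀ = frobSq V := by
  simp only [frobSq, transpose_apply]; exact Finset.sum_comm

theorem frobSq_nonneg (V : Matrix (Fin n) (Fin n) ℝ) : 0 ≤ frobSq V :=
  Finset.sum_nonneg fun _ _ => Finset.sum_nonneg fun _ _ => sq_nonneg _

theorem frobSq_eq_sum_dotProduct (V : Matrix (Fin n) (Fin n) ℝ) :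
    frobSq V = ∑ j, (fun i => V i j) ⬝ᵥ (fun i => V i j) := by
  rw [frobSq, Finset.sum_comm]
  simp only [dotProduct, sq]

theorem dotProduct_mulVec_self {R : Matrix (Fin n) (Fin n) ℝ} (v : Fin n → ℝ) :
    (R *ᵥ v) ⬝ᵥ (R *ᵥ v) = v ⬝ᵥ (Rᵀ * R) *ᵥ v := by
  rw [← mulVec_mulVec, dotProduct_mulVec v, vecMul_transpose]

theorem EllipticBound.frobSq_mul {L : ℝ} {R S : Matrix (Fin n) (Fin n) ℝ} (hS : EllipticBound L S)
    (hR : Rᵀ * R = S) (V : Matrix (Fin n) (Fin n) ℝ) :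
    L⁻¹ * frobSq V ≤ frobSq (R * V) ∧ frobSq (R * V) ≤ L * frobSq V := by
  have h : frobSq (R * V) = ∑ j, (fun i => V i j) ⬝ᵥ S *ᵥ (fun i => V i j) := by
    rw [frobSq_eq_sum_dotProduct, ← hR]
    exact Finset.sum_congr rfl fun j _ => (dotProduct_mulVec_self (R := R) _)
  rw [h, frobSq_eq_sum_dotProduct, Finset.mul_sum, Finset.mul_sum]
  exact ⟨Finset.sum_le_sum fun j _ => (hS _).1, Finset.sum_le_sum fun j _ => (hS _).2⟩

theorem EllipticBound.frobSq_conj {L : ℝ} (hL : 0 < L) {R S : Matrix (Fin n) (Fin n) ℝ}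
    (hS : EllipticBound L S) (hR : Rᵀ * R = S) (V : Matrix (Fin n) (Fin n) ℝ) :
    (L ^ 2)⁻¹ * frobSq V ≤ frobSq (R * V * Rᵀ) ∧ frobSq (R * V * Rᵀ) ≤ L ^ 2 * frobSq V := by
  have h1 := hS.frobSq_mul hR (V * Rᵀ)
  have h2 := hS.frobSq_mul hR Vᵀ
  have h3 : frobSq (R * Vᵀ) = frobSq (V * Rᵀ) := by
    rw [← frobSq_transpose, transpose_mul, transpose_transpose]
  rw [h3, frobSq_transpose] at h2
  rw [Matrix.mul_assoc]
  have hL' : 0 < L⁻¹ := inv_pos.2 hL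
  constructor
  · calc (L ^ 2)⁻¹ * frobSq V = L⁻¹ * (L⁻¹ * frobSq V) := by rw [sq, mul_inv, mul_assoc]
      _ ≤ L⁻¹ * frobSq (V * Rᵀ) := by gcongr; exact h2.1
      _ ≤ _ := h1.1
  · calc frobSq (R * (V * Rᵀ)) ≤ L * frobSq (V * Rᵀ) := h1.2
      _ ≤ L * (L * frobSq V) := by gcongr; exact h2.2
      _ = _ := by ring

theorem EllipticBound.mul_transpose_le {L : ℝ} {R S : Matrix (Fin n) (Fin n) ℝ}
    (hS : EllipticBound L S) (hR : Rᵀ * R = S) (w : Fin n → ℝ) :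
    w ⬝ᵥ (R * Rᵀ) *ᵥ w ≤ L * (w ⬝ᵥ w) := by
  set z := Rᵀ *ᵥ w with hz
  have h1 : w ⬝ᵥ (R * Rᵀ) *ᵥ w = z ⬝ᵥ z := by
    rw [hz, dotProduct_mulVec_self, transpose_transpose]
  have h2 : z ⬝ᵥ z = w ⬝ᵥ (R *ᵥ z) := by rw [← h1, ← mulVec_mulVec]
  have h3 : (R *ᵥ z) ⬝ᵥ (R *ᵥ z) ≤ L * (z ⬝ᵥ z) := by
    rw [dotProduct_mulVec_self, hR]; exact (hS z).2
  have h4 : (w ⬝ᵥ (R *ᵥ z)) ^ 2 ≤ (w ⬝ᵥ w) * ((R *ᵥ z) ⬝ᵥ (R *ᵥ z)) := by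
    have := Finset.sum_mul_sq_le_sq_mul_sq Finset.univ w (R *ᵥ z)
    simpa [dotProduct, sq] using this
  have hw : 0 ≤ w ⬝ᵥ w := by
    simp only [dotProduct]; exact Finset.sum_nonneg fun i _ => mul_self_nonneg _
  have hzz : 0 ≤ z ⬝ᵥ z := by
    simp only [dotProduct]; exact Finset.sum_nonneg fun i _ => mul_self_nonneg _
  rw [h1]
  rw [← h2] at h4
  rcases hzz.eq_or_lt with h | h
  · rw [← h]
    have h5 := hS w
    have : w ⬝ᵥ S *ᵥ w ≤ L * (w ⬝ᵥ w) := h5.2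
    have h6 : 0 ≤ w ⬝ᵥ S *ᵥ w := by
      rw [← hR, ← dotProduct_mulVec_self]
      simp only [dotProduct]; exact Finset.sum_nonneg fun i _ => mul_self_nonneg _
    linarith
  · have : (z ⬝ᵥ z) * (z ⬝ᵥ z) ≤ (L * (w ⬝ᵥ w)) * (z ⬝ᵥ z) := by
      calc _ = (z ⬝ᵥ z) ^ 2 := by ring
        _ ≤ _ := h4
        _ ≤ (w ⬝ᵥ w) * (L * (z ⬝ᵥ z)) := by gcongr
        _ = _ := by ring
    exact le_of_mul_le_mul_right this h

/-- For positive definite `P`, `v · P⁻¹ v ≥ 2 v · w - w · P w`. -/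
theorem two_mul_dotProduct_sub_le {P Pi : Matrix (Fin n) (Fin n) ℝ} (hP : P.PosDef)
    (hPi : P * Pi = 1) (v w : Fin n → ℝ) :
    2 * (v ⬝ᵥ w) - w ⬝ᵥ P *ᵥ w ≤ v ⬝ᵥ Pi *ᵥ v := by
  have hsymm : Pᵀ = P := posDef_isSymm hP
  have h := hP.posSemidef.dotProduct_mulVec_nonneg (Pi *ᵥ v - w)
  have h1 : P *ᵥ (Pi *ᵥ v) = v := by rw [mulVec_mulVec, hPi, one_mulVec]
  have h2 : (Pi *ᵥ v) ⬝ᵥ P *ᵥ w = v ⬝ᵥ w := by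
    rw [dotProduct_mulVec, ← mulVec_transpose, hsymm, h1]
  rw [star_trivial, mulVec_sub, h1, sub_dotProduct, dotProduct_sub, dotProduct_sub, h2,
    dotProduct_comm (Pi *ᵥ v) v, dotProduct_comm w v] at h
  linarith

theorem trace_mul_diagonal_mul (V : Matrix (Fin n) (Fin n) ℝ) (hV : V.IsSymm)
    (e : Fin n → ℝ) :
    (V * diagonal e * V).trace = ∑ a, ∑ k, V a k ^ 2 * e k := by
  simp only [trace, diag_apply]
  refine Finset.sum_congr rfl fun a _ => ?_
  rw [Matrix.mul_apply]
  refine Finset.sum_congr rfl fun k _ => ?_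
  rw [mul_diagonal, hV.apply a k]; ring

theorem comparison_scalar {a b t : ℝ} (ha : 0 < a) (hb : 0 < b) (ht : 0 < t) :
    (a / (a + t) * (b / (b + t))) ^ 2 * (a⁻¹ + b⁻¹)
      + t⁻¹ * (1 - a / (a + t) * (b / (b + t))) ^ 2 ≤ (a + t)⁻¹ + (b + t)⁻¹ := by
  set p := a / (a + t) with hp
  set q := b / (b + t) with hq
  have hat : a + t ≠ 0 := (add_pos ha ht).ne'
  have hbt : b + t ≠ 0 := (add_pos hb ht).ne'
  have h1 : (a + t)⁻¹ = t⁻¹ * (1 - p) := by rw [hp]; field_simp; ring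
  have h2 : (b + t)⁻¹ = t⁻¹ * (1 - q) := by rw [hq]; field_simp; ring
  have h3 : p ^ 2 * a⁻¹ = t⁻¹ * (p * (1 - p)) := by rw [hp]; field_simp; ring
  have h4 : q ^ 2 * b⁻¹ = t⁻¹ * (q * (1 - q)) := by rw [hq]; field_simp; ring
  have hp0 : 0 < p := div_pos ha (add_pos ha ht)
  have hq0 : 0 < q := div_pos hb (add_pos hb ht)
  have hp1 : 0 ≤ 1 - p := by rw [sub_nonneg, hp, div_le_one (add_pos ha ht)]; linarith
  have hq1 : 0 ≤ 1 - q := by rw [sub_nonneg, hq, div_le_one (add_pos hb ht)]; linarith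
  have h5 : (p * q) ^ 2 * (a⁻¹ + b⁻¹)
      = t⁻¹ * (q ^ 2 * (p * (1 - p)) + p ^ 2 * (q * (1 - q))) := by
    calc _ = q ^ 2 * (p ^ 2 * a⁻¹) + p ^ 2 * (q ^ 2 * b⁻¹) := by ring
      _ = _ := by rw [h3, h4]; ring
  rw [h5, h1, h2, ← mul_add, ← mul_add]
  refine mul_le_mul_of_nonneg_left ?_ (inv_pos.2 ht).le
  have : 0 ≤ (1 + p * q) * ((1 - p) * (1 - q)) := by positivity
  nlinarith

theorem exists_comparison_matrix {L τ : ℝ} (hL : 0 < L) (hτ : 0 < τ)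
    {S A V : Matrix (Fin n) (Fin n) ℝ} (hSs : S.IsSymm) (hS : EllipticBound L S)
    (hA : A.PosDef) (hV : V.IsSymm) :
    ∃ X : Matrix (Fin n) (Fin n) ℝ, X.IsSymm ∧
      (S * X * A⁻¹ * X).trace + (2 * L ^ 3 * τ)⁻¹ * frobSq (V - X)
        ≤ (S * V * (A + τ • (1 : Matrix (Fin n) (Fin n) ℝ))⁻¹ * V).trace ∧
      frobSq (V - X) ≤ L ^ 4 * frobSq V := by
  have hSpos : S.PosDef := by
    refine PosDef.of_dotProduct_mulVec_pos ?_ fun x hx => ?_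
    · rw [IsHermitian, conjTranspose_eq_transpose_of_trivial]; exact hSs
    · rw [star_trivial]
      refine lt_of_lt_of_le (mul_pos (inv_pos.2 hL) ?_) (hS x).1
      simpa using dotProduct_star_self_pos_iff.2 hx
  obtain ⟨R, Q, d, hRQ, hQR, hRS, hRA, hd⟩ := exists_simultaneous_diagonalization hSpos (posDef_isSymm hA)
  replace hd := hd hA
  have hQR' : Rᵀ * Qᵀ = 1 := by rw [← transpose_mul, hQR, transpose_one]
  have hRQ' : Qᵀ * Rᵀ = 1 := by rw [← transpose_mul, hRQ, transpose_one]
  set t := L * τ with ht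
  have htpos : 0 < t := mul_pos hL hτ
  set W := R * V * Rᵀ with hW
  have hWs : W.IsSymm := isSymm_conj hV R
  set θ : Fin n → ℝ := fun i => d i / (d i + t) with hθ
  set Y : Matrix (Fin n) (Fin n) ℝ := of fun a k => θ a * θ k * W a k with hY
  have hYs : Y.IsSymm := by
    ext a k
    rw [transpose_apply, hY, of_apply, of_apply, hWs.apply]; ring
  set X := Q * Y * Qᵀ with hX
  have hXs : X.IsSymm := by
    have := isSymm_conj hYs Q
    exact this
  have hXY : R * X * Rᵀ = Y := by
    calc R * X * Rᵀ = (R * Q) * Y * (Qᵀ * Rᵀ) := by rw [hX]; simp only [Matrix.mul_assoc]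
      _ = Y := by rw [hRQ, hRQ']; simp
  have hAinv : A⁻¹ = Rᵀ * diagonal (fun i => (d i)⁻¹) * R := by
    refine inv_eq_right_inv ?_
    have hA2 : A = Q * diagonal d * Qᵀ := by
      calc A = (Q * R) * A * (Rᵀ * Qᵀ) := by rw [hQR, hQR']; simp
        _ = Q * (R * A * Rᵀ) * Qᵀ := by simp only [Matrix.mul_assoc]
        _ = _ := by rw [hRA]
    calc A * (Rᵀ * diagonal (fun i => (d i)⁻¹) * R)
        = Q * diagonal d * (Qᵀ * Rᵀ) * diagonal (fun i => (d i)⁻¹) * R := by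
          rw [hA2]; simp only [Matrix.mul_assoc]
      _ = Q * (diagonal d * diagonal (fun i => (d i)⁻¹)) * R := by
          rw [hRQ']; simp only [Matrix.mul_assoc, Matrix.one_mul]
      _ = 1 := by
          rw [diagonal_mul_diagonal]
          have : (fun i => d i * (d i)⁻¹) = fun _ => 1 := by
            ext i; exact mul_inv_cancel₀ (hd i).ne'
          rw [this, diagonal_one, Matrix.mul_one, hQR]
  have htr : ∀ M Z : Matrix (Fin n) (Fin n) ℝ, (S * Z * M * Z).trace
      = ((R * Z * Rᵀ) * (Qᵀ * M * Q) * (R * Z * Rᵀ)).trace := by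
    intro M Z
    calc (S * Z * M * Z).trace = (Rᵀ * (R * Z * M * Z)).trace := by
          rw [← hRS]; simp only [Matrix.mul_assoc]
      _ = (R * Z * M * Z * Rᵀ).trace := by rw [trace_mul_comm]
      _ = (R * Z * (Rᵀ * Qᵀ) * M * (Q * R) * Z * Rᵀ).trace := by rw [hQR, hQR']; simp
      _ = _ := by simp only [Matrix.mul_assoc]
  have hT1 : (S * X * A⁻¹ * X).trace = ∑ a, ∑ k, Y a k ^ 2 * (d k)⁻¹ := by
    rw [htr, hXY, hAinv, ← trace_mul_diagonal_mul Y hYs]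
    have : Qᵀ * (Rᵀ * diagonal (fun i => (d i)⁻¹) * R) * Q = diagonal (fun i => (d i)⁻¹) := by
      calc _ = (Qᵀ * Rᵀ) * diagonal (fun i => (d i)⁻¹) * (R * Q) := by
            simp only [Matrix.mul_assoc]
        _ = _ := by rw [hRQ, hRQ']; simp
    rw [this]
  have hAτ : (A + τ • (1 : Matrix (Fin n) (Fin n) ℝ)).PosDef :=
    hA.add (PosDef.one.smul hτ)
  set P := R * (A + τ • (1 : Matrix (Fin n) (Fin n) ℝ)) * Rᵀ with hP
  have hPpos : P.PosDef := by
    rw [hP, ← conjTranspose_eq_transpose_of_trivial]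
    refine hAτ.mul_mul_conjTranspose_same fun v w hvw => ?_
    have := congrArg (fun z => z ᵥ* Q) hvw
    simpa [vecMul_vecMul, hRQ] using this
  set Pi := Qᵀ * (A + τ • (1 : Matrix (Fin n) (Fin n) ℝ))⁻¹ * Q with hPi
  have hPPi : P * Pi = 1 := by
    have hu := hAτ.isUnit
    calc P * Pi = R * (A + τ • (1 : Matrix (Fin n) (Fin n) ℝ)) * (Rᵀ * Qᵀ)
          * (A + τ • (1 : Matrix (Fin n) (Fin n) ℝ))⁻¹ * Q := by
          rw [hP, hPi]; simp only [Matrix.mul_assoc]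
      _ = R * ((A + τ • (1 : Matrix (Fin n) (Fin n) ℝ))
          * (A + τ • (1 : Matrix (Fin n) (Fin n) ℝ))⁻¹) * Q := by
          rw [hQR', Matrix.mul_one]; simp only [Matrix.mul_assoc]
      _ = 1 := by
          rw [mul_nonsing_inv _ ((isUnit_iff_isUnit_det _).1 hu), Matrix.mul_one, hRQ]
  have hT2 : ∑ a, ∑ k, W a k ^ 2 * (d k + t)⁻¹
      ≤ (S * V * (A + τ • (1 : Matrix (Fin n) (Fin n) ℝ))⁻¹ * V).trace := by
    rw [htr, ← hW, ← hPi]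
    have : (W * Pi * W).trace = ∑ a, (W a) ⬝ᵥ Pi *ᵥ (W a) := by
      simp only [trace, diag_apply]
      refine Finset.sum_congr rfl fun a _ => ?_
      rw [mul_mul_apply, hWs.eq]
    rw [this]
    refine Finset.sum_le_sum fun a _ => ?_
    refine le_trans ?_ (two_mul_dotProduct_sub_le hPpos hPPi (W a)
      (fun k => W a k * (d k + t)⁻¹))
    have hPle : ∀ w : Fin n → ℝ, w ⬝ᵥ P *ᵥ w ≤ ∑ k, (d k + t) * w k ^ 2 := by
      intro w
      have h1 : P = diagonal d + τ • (R * Rᵀ) := by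
        rw [hP, Matrix.mul_add, Matrix.add_mul, hRA, Matrix.mul_smul, Matrix.mul_one,
          Matrix.smul_mul]
      rw [h1, add_mulVec, smul_mulVec, dotProduct_add, dotProduct_smul, smul_eq_mul]
      have h2 := mul_le_mul_of_nonneg_left (hS.mul_transpose_le hRS w) hτ.le
      have h3 : ∑ k, (d k + t) * w k ^ 2 = w ⬝ᵥ diagonal d *ᵥ w + τ * (L * (w ⬝ᵥ w)) := by
        simp only [dotProduct, mulVec_diagonal, Finset.mul_sum, ← Finset.sum_add_distrib]
        refine Finset.sum_congr rfl fun k _ => ?_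
        rw [ht]; ring
      rw [h3]; linarith
    have h4 := hPle (fun k => W a k * (d k + t)⁻¹)
    have h5 : ∑ k, (d k + t) * (W a k * (d k + t)⁻¹) ^ 2 = ∑ k, W a k ^ 2 * (d k + t)⁻¹ := by
      refine Finset.sum_congr rfl fun k _ => ?_
      have : d k + t ≠ 0 := (add_pos (hd k) htpos).ne'
      field_simp
    have h6 : (W a) ⬝ᵥ (fun k => W a k * (d k + t)⁻¹) = ∑ k, W a k ^ 2 * (d k + t)⁻¹ := by
      simp only [dotProduct]
      exact Finset.sum_congr rfl fun k _ => by ring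
    rw [h6]; rw [h5] at h4; linarith
  have hconj : R * (V - X) * Rᵀ = W - Y := by
    rw [Matrix.mul_sub, Matrix.sub_mul, hXY]
  have hF := hS.frobSq_conj hL hRS (V - X)
  rw [hconj] at hF
  have hθ1 : ∀ i, 0 ≤ θ i ∧ θ i ≤ 1 := fun i =>
    ⟨div_nonneg (hd i).le (add_pos (hd i) htpos).le,
      (div_le_one (add_pos (hd i) htpos)).2 (by linarith)⟩
  have hsl : ∑ a, ∑ k, Y a k ^ 2 * (d k)⁻¹ + (2 * t)⁻¹ * frobSq (W - Y)
      ≤ ∑ a, ∑ k, W a k ^ 2 * (d k + t)⁻¹ := by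
    have sym : ∀ (Z : Matrix (Fin n) (Fin n) ℝ) (e : Fin n → ℝ), Z.IsSymm →
        ∑ a, ∑ k, Z a k ^ 2 * e k = ∑ a, ∑ k, Z a k ^ 2 * ((e a + e k) / 2) := by
      intro Z e hZ
      have h : ∑ a, ∑ k, Z a k ^ 2 * e k = ∑ a, ∑ k, Z a k ^ 2 * e a := by
        rw [Finset.sum_comm]
        exact Finset.sum_congr rfl fun a _ => Finset.sum_congr rfl fun k _ => by
          rw [hZ.apply]
      have h2 : ∑ a, ∑ k, Z a k ^ 2 * ((e a + e k) / 2)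
          = (∑ a, ∑ k, Z a k ^ 2 * e a + ∑ a, ∑ k, Z a k ^ 2 * e k) / 2 := by
        simp only [← Finset.sum_add_distrib, Finset.sum_div]
        exact Finset.sum_congr rfl fun a _ => Finset.sum_congr rfl fun k _ => by ring
      rw [h2, ← h]; ring
    rw [sym Y _ hYs, sym W (fun k => (d k + t)⁻¹) hWs, frobSq, Finset.mul_sum,
      ← Finset.sum_add_distrib]
    refine Finset.sum_le_sum fun a _ => ?_
    rw [Finset.mul_sum, ← Finset.sum_add_distrib]
    refine Finset.sum_le_sum fun k _ => ?_
    have := mul_le_mul_of_nonneg_left (comparison_scalar (hd a) (hd k) htpos)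
      (div_nonneg (sq_nonneg (W a k)) zero_le_two)
    rw [Matrix.sub_apply, hY, of_apply]
    calc _ = W a k ^ 2 / 2 * ((d a / (d a + t) * (d k / (d k + t))) ^ 2 * ((d a)⁻¹ + (d k)⁻¹)
        + t⁻¹ * (1 - d a / (d a + t) * (d k / (d k + t))) ^ 2) := by
          simp only [hθ, mul_inv]; ring
      _ ≤ _ := this
      _ = _ := by ring
  refine ⟨X, hXs, ?_, ?_⟩
  · rw [hT1]
    refine le_trans (le_trans ?_ hsl) hT2
    have h7 : (2 * L ^ 3 * τ)⁻¹ * frobSq (V - X) = (2 * t)⁻¹ * ((L ^ 2)⁻¹ * frobSq (V - X)) := by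
      rw [ht]; field_simp
    rw [h7]
    have := mul_le_mul_of_nonneg_left hF.1 (inv_nonneg.2 (by positivity : 0 ≤ 2 * t))
    linarith
  · have h8 : frobSq (W - Y) ≤ frobSq W := by
      refine Finset.sum_le_sum fun a _ => Finset.sum_le_sum fun k _ => ?_
      have h9 : (W - Y) a k = (1 - θ a * θ k) * W a k := by
        rw [Matrix.sub_apply, hY, of_apply]; ring
      rw [h9, mul_pow]
      have h10 : 0 ≤ θ a * θ k := mul_nonneg (hθ1 a).1 (hθ1 k).1
      have h11 : θ a * θ k ≤ 1 := mul_le_one₀ (hθ1 a).2 (hθ1 k).1 (hθ1 k).2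
      have : (1 - θ a * θ k) ^ 2 ≤ 1 := by nlinarith
      nlinarith [sq_nonneg (W a k)]
    have h12 := (hS.frobSq_conj hL hRS V).2
    have h13 : frobSq (V - X) ≤ L ^ 2 * frobSq (W - Y) := by
      have := hF.1
      rwa [inv_mul_le_iff₀ (by positivity)] at this
    calc frobSq (V - X) ≤ L ^ 2 * frobSq (W - Y) := h13
      _ ≤ L ^ 2 * (L ^ 2 * frobSq V) := by gcongr; exact h8.trans h12
      _ = _ := by ring

end LinearAlgebra

section Structure

open Matrix

variable {n : ℕ}

/-- The space of arguments `(A, p, u, x)` of `F`. -/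
abbrev Jet (n : ℕ) : Type :=
  (Fin n → Fin n → ℝ) × (Fin n → ℝ) × ℝ × EuclideanSpace ℝ (Fin n)

/-- The domain on which `F` is regular. -/
def jetDomain (n : ℕ) : Set (Jet n) :=
  {z | z.2.2.2 ∈ ball (0 : EuclideanSpace ℝ (Fin n)) 1}

/-- Local convexity of `(A, u, x) ↦ F(A⁻¹, p, u, x)` for each `p`. -/
def InverseConvex (F : Jet n → ℝ) : Prop :=
  ∀ p : Fin n → ℝ,
    ∀ z ∈ {w : (Fin n → Fin n → ℝ) × ℝ × EuclideanSpace ℝ (Fin n) |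
        (Matrix.of w.1).PosDef ∧ w.2.2 ∈ ball (0 : EuclideanSpace ℝ (Fin n)) 1},
      ∃ t, IsOpen t ∧ z ∈ t ∧
        ConvexOn ℝ
          ({w : (Fin n → Fin n → ℝ) × ℝ × EuclideanSpace ℝ (Fin n) |
              (Matrix.of w.1).PosDef ∧
                w.2.2 ∈ ball (0 : EuclideanSpace ℝ (Fin n)) 1} ∩ t)
          (fun w => F (fun i j => (Matrix.of w.1)⁻¹ i j, p, w.2.1, w.2.2))

theorem isOpen_jetDomain : IsOpen (jetDomain n) :=
  isOpen_ball.preimage (by fun_prop)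

/-- The second derivative of a function that is convex near `0` is nonnegative at `0`. -/
theorem second_deriv_nonneg_of_convexOn {k k' : ℝ → ℝ} {c ε : ℝ} (hε : 0 < ε)
    (hk : ConvexOn ℝ (Set.Ioo (-ε) ε) k)
    (hk' : ∀ t ∈ Set.Ioo (-ε) ε, HasDerivAt k (k' t) t) (hc : HasDerivAt k' c 0) :
    0 ≤ c := by
  have hmono : MonotoneOn k' (Set.Ioo (-ε) ε) := by
    have h := hk.monotoneOn_deriv fun t ht => (hk' t ht).differentiableAt
    exact h.congr fun t ht => (hk' t ht).deriv
  have h0 : (0 : ℝ) ∈ Set.Ioo (-ε) ε := ⟨by linarith, hε⟩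
  have h1 := hc.tendsto_slope_zero_right
  refine ge_of_tendsto h1 ?_
  filter_upwards [Ioo_mem_nhdsGT hε] with t ht
  rw [zero_add, smul_eq_mul]
  refine mul_nonneg (inv_pos.2 ht.1).le (sub_nonneg.2 (hmono h0 ⟨by linarith [ht.1], ht.2⟩ ht.1.le))

theorem exists_congruence_diagonalization {A X : Matrix (Fin n) (Fin n) ℝ} (hA : A.PosDef)
    (hX : X.IsSymm) :
    ∃ (Q R : Matrix (Fin n) (Fin n) ℝ) (d : Fin n → ℝ), R * Q = 1 ∧ Q * R = 1 ∧
      A = Q * Qᵀ ∧ X = Q * diagonal d * Qᵀ := by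
  obtain ⟨R, Q, d, hRQ, hQR, hRS, hRX, -⟩ := exists_simultaneous_diagonalization hA.inv hX
  have hQR' : Rᵀ * Qᵀ = 1 := by rw [← transpose_mul, hQR, transpose_one]
  refine ⟨Q, R, d, hRQ, hQR, ?_, ?_⟩
  · have h := (isUnit_iff_isUnit_det _).1 hA.isUnit
    rw [← nonsing_inv_nonsing_inv A h, ← hRS]
    refine inv_eq_right_inv ?_
    calc Rᵀ * R * (Q * Qᵀ) = Rᵀ * (R * Q) * Qᵀ := by simp only [Matrix.mul_assoc]
      _ = 1 := by rw [hRQ, Matrix.mul_one, hQR']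
  · calc X = (Q * R) * X * (Rᵀ * Qᵀ) := by rw [hQR, hQR']; simp
      _ = Q * (R * X * Rᵀ) * Qᵀ := by simp only [Matrix.mul_assoc]
      _ = _ := by rw [hRX]

theorem mul_diagonal_mul_transpose_apply (Q : Matrix (Fin n) (Fin n) ℝ) (e : Fin n → ℝ)
    (a b : Fin n) : (Q * diagonal e * Qᵀ) a b = ∑ i, Q a i * Q b i * e i := by
  rw [Matrix.mul_apply]
  refine Finset.sum_congr rfl fun i _ => ?_
  rw [mul_diagonal, transpose_apply]; ring

theorem hasDerivAt_mul_diagonal_mul_transpose (Q : Matrix (Fin n) (Fin n) ℝ)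
    {e : ℝ → Fin n → ℝ} {e' : Fin n → ℝ} {t : ℝ} (he : ∀ i, HasDerivAt (fun s => e s i) (e' i) t) :
    HasDerivAt (fun s => (fun a b => (Q * diagonal (e s) * Qᵀ) a b : Fin n → Fin n → ℝ))
      (fun a b => (Q * diagonal e' * Qᵀ) a b) t := by
  refine hasDerivAt_pi.2 fun a => hasDerivAt_pi.2 fun b => ?_
  simp only [mul_diagonal_mul_transpose_apply]
  exact HasDerivAt.fun_sum fun i _ => (he i).const_mul _

/-- The second-order consequence of inverse convexity. -/
theorem InverseConvex.second_order {F : Jet n → ℝ} (hF : ContDiffOn ℝ 2 F (jetDomain n))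
    (hconv : InverseConvex F) {A : Matrix (Fin n) (Fin n) ℝ} {p : Fin n → ℝ} {s : ℝ}
    {x : EuclideanSpace ℝ (Fin n)} (hA : A.PosDef) (hx : x ∈ ball 0 1)
    {X : Matrix (Fin n) (Fin n) ℝ} (hX : X.IsSymm) (s' : ℝ) (Z : EuclideanSpace ℝ (Fin n)) :
    0 ≤ fderiv ℝ (fderiv ℝ F) ((fun i j => A i j, p, s, x) : Jet n)
        ((fun i j => X i j, 0, s', Z) : Jet n) ((fun i j => X i j, 0, s', Z) : Jet n)
      + 2 * fderiv ℝ F ((fun i j => A i j, p, s, x) : Jet n)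
        ((fun i j => (X * A⁻¹ * X) i j, 0, 0, 0) : Jet n) := by
  obtain ⟨Q, R, d, hRQ, hQR, hAQ, hXQ⟩ := exists_congruence_diagonalization hA hX
  have hRQ' : Qᵀ * Rᵀ = 1 := by rw [← transpose_mul, hRQ, transpose_one]
  have hQR' : Rᵀ * Qᵀ = 1 := by rw [← transpose_mul, hQR, transpose_one]
  have hAinv : A⁻¹ = Rᵀ * R := by
    refine inv_eq_right_inv ?_
    calc A * (Rᵀ * R) = Q * (Qᵀ * Rᵀ) * R := by rw [hAQ]; simp only [Matrix.mul_assoc]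
      _ = 1 := by rw [hRQ', Matrix.mul_one, hQR]
  have hXX : X * A⁻¹ * X = Q * diagonal (fun i => d i ^ 2) * Qᵀ := by
    calc X * A⁻¹ * X = Q * diagonal d * (Qᵀ * Rᵀ) * (R * Q) * diagonal d * Qᵀ := by
          rw [hXQ, hAinv]; simp only [Matrix.mul_assoc]
      _ = Q * (diagonal d * diagonal d) * Qᵀ := by
          rw [hRQ, hRQ']; simp only [Matrix.mul_assoc, Matrix.one_mul]
      _ = _ := by rw [diagonal_mul_diagonal]; simp only [sq]
  -- the affine curve of inverse matrices and the curve of matrices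
  let B : ℝ → Matrix (Fin n) (Fin n) ℝ := fun t => Rᵀ * diagonal (fun i => 1 - t * d i) * R
  let γ : ℝ → Jet n := fun t =>
    (fun a b => (Q * diagonal (fun i => (1 - t * d i)⁻¹) * Qᵀ) a b, p, s + t * s', x + t • Z)
  let γ' : ℝ → Jet n := fun t =>
    (fun a b => (Q * diagonal (fun i => d i * ((1 - t * d i) ^ 2)⁻¹) * Qᵀ) a b, 0, s', Z)
  let aff : ℝ → (Fin n → Fin n → ℝ) × ℝ × EuclideanSpace ℝ (Fin n) := fun t =>
    (fun a b => B t a b, s + t * s', x + t • Z)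
  have hγ0 : γ 0 = (fun i j => A i j, p, s, x) := by
    simp [γ, hAQ]
  have hγ'0 : γ' 0 = (fun i j => X i j, 0, s', Z) := by
    simp [γ', hXQ]
  have hpos : ∀ᶠ t : ℝ in nhds 0, ∀ i, 0 < 1 - t * d i := by
    rw [Filter.eventually_all]
    intro i
    have : Filter.Tendsto (fun t : ℝ => 1 - t * d i) (nhds 0) (nhds (1 - 0 * d i)) :=
      (by fun_prop : Continuous fun t : ℝ => 1 - t * d i).tendsto 0
    exact this.eventually_const_lt (by simp)
  have hballx : ∀ᶠ t : ℝ in nhds 0, x + t • Z ∈ ball (0 : EuclideanSpace ℝ (Fin n)) 1 := by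
    have : Filter.Tendsto (fun t : ℝ => x + t • Z) (nhds 0) (nhds (x + (0 : ℝ) • Z)) :=
      (by fun_prop : Continuous fun t : ℝ => x + t • Z).tendsto 0
    exact this.eventually_mem (isOpen_ball.mem_nhds (by simpa using hx))
  have hB0 : B 0 = A⁻¹ := by simp [B, hAinv]
  obtain ⟨T, hTo, hzT, hTc⟩ := hconv p (fun a b => A⁻¹ a b, s, x) ⟨hA.inv, hx⟩
  have haffc : Continuous aff := by
    refine Continuous.prodMk (continuous_pi fun a => continuous_pi fun b => ?_) (by fun_prop)
    have : ∀ t, B t a b = ∑ i, Rᵀ a i * Rᵀ b i * (1 - t * d i) := fun t => by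
      rw [← mul_diagonal_mul_transpose_apply, transpose_transpose]
    simp only [this]
    fun_prop
  have hT : ∀ᶠ t : ℝ in nhds 0, aff t ∈ T := by
    refine haffc.continuousAt.eventually_mem (hTo.mem_nhds ?_)
    have : aff 0 = (fun a b => A⁻¹ a b, s, x) := by simp [aff, hB0]
    rwa [this]
  obtain ⟨ε, hε, hall⟩ := Metric.eventually_nhds_iff_ball.1 (hpos.and (hballx.and hT))
  rw [Real.ball_eq_Ioo, zero_sub, zero_add] at hall
  have hBpos : ∀ t ∈ Set.Ioo (-ε) ε, (B t).PosDef := by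
    intro t ht
    have h1 : (diagonal (fun i => 1 - t * d i)).PosDef := posDef_diagonal_iff.2 (hall t ht).1
    have h2 := h1.conjTranspose_mul_mul_same (B := R) (fun v w hvw => by
      have := congrArg (fun z => Q *ᵥ z) hvw
      simpa [mulVec_mulVec, hQR] using this)
    rwa [conjTranspose_eq_transpose_of_trivial] at h2
  have hBinv : ∀ t ∈ Set.Ioo (-ε) ε,
      (B t)⁻¹ = Q * diagonal (fun i => (1 - t * d i)⁻¹) * Qᵀ := by
    intro t ht
    refine inv_eq_right_inv ?_
    calc B t * (Q * diagonal (fun i => (1 - t * d i)⁻¹) * Qᵀ)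
        = Rᵀ * diagonal (fun i => 1 - t * d i) * (R * Q) * diagonal (fun i => (1 - t * d i)⁻¹)
          * Qᵀ := by simp only [B, Matrix.mul_assoc]
      _ = Rᵀ * (diagonal (fun i => 1 - t * d i) * diagonal (fun i => (1 - t * d i)⁻¹)) * Qᵀ := by
          rw [hRQ]; simp only [Matrix.mul_assoc, Matrix.one_mul]
      _ = 1 := by
          rw [diagonal_mul_diagonal]
          have : (fun i => (1 - t * d i) * (1 - t * d i)⁻¹) = fun _ => 1 := by
            ext i; exact mul_inv_cancel₀ ((hall t ht).1 i).ne'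
          rw [this, diagonal_one, Matrix.mul_one, hQR']
  have hγdom : ∀ t ∈ Set.Ioo (-ε) ε, γ t ∈ jetDomain n := fun t ht => (hall t ht).2.1
  have haffcomb : ∀ a b t₁ t₂ : ℝ, a + b = 1 →
      aff (a * t₁ + b * t₂) = a • aff t₁ + b • aff t₂ := by
    intro a b t₁ t₂ hab
    have hBl : B (a * t₁ + b * t₂) = a • B t₁ + b • B t₂ := by
      have hdiag : (diagonal fun i => 1 - (a * t₁ + b * t₂) * d i)
          = a • (diagonal fun i => 1 - t₁ * d i) + b • diagonal fun i => 1 - t₂ * d i := by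
        rw [← diagonal_smul, ← diagonal_smul, diagonal_add]
        congr 1; ext i
        simp only [Pi.smul_apply, smul_eq_mul]
        linear_combination (-1 : ℝ) * hab
      simp only [B]
      rw [hdiag, Matrix.mul_add, Matrix.add_mul, Matrix.mul_smul, Matrix.mul_smul,
        Matrix.smul_mul, Matrix.smul_mul]
    refine Prod.ext ?_ (Prod.ext ?_ ?_)
    · ext i j
      simp [aff, hBl]
    · simp only [aff, Prod.snd_add, Prod.fst_add, Prod.smul_snd, Prod.smul_fst, smul_eq_mul]
      linear_combination (-s) * hab
    · simp only [aff, Prod.snd_add, Prod.smul_snd, smul_add]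
      have : x = a • x + b • x := by rw [← add_smul, hab, one_smul]
      conv_lhs => rw [this]
      simp only [add_smul, mul_smul]
      abel
  have hkconv : ConvexOn ℝ (Set.Ioo (-ε) ε) (fun t => F (γ t)) := by
    refine ⟨convex_Ioo _ _, fun t₁ h₁ t₂ h₂ a b ha hb hab => ?_⟩
    have h12 : a • t₁ + b • t₂ ∈ Set.Ioo (-ε) ε := convex_Ioo _ _ h₁ h₂ ha hb hab
    have hmem : ∀ t ∈ Set.Ioo (-ε) ε, aff t ∈
        ({w : (Fin n → Fin n → ℝ) × ℝ × EuclideanSpace ℝ (Fin n) |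
              (Matrix.of w.1).PosDef ∧
                w.2.2 ∈ ball (0 : EuclideanSpace ℝ (Fin n)) 1} ∩ T) := fun t ht =>
      ⟨⟨hBpos t ht, (hall t ht).2.1⟩, (hall t ht).2.2⟩
    have hval : ∀ t ∈ Set.Ioo (-ε) ε,
        F (fun i j => (Matrix.of (aff t).1)⁻¹ i j, p, (aff t).2.1, (aff t).2.2) = F (γ t) := by
      intro t ht
      have : (Matrix.of (aff t).1) = B t := rfl
      rw [this, hBinv t ht]
    have := hTc.2 (hmem t₁ h₁) (hmem t₂ h₂) ha hb hab
    have e := haffcomb a b t₁ t₂ hab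
    rw [← e] at this
    simp only [smul_eq_mul] at this h12 ⊢
    rwa [hval t₁ h₁, hval t₂ h₂, hval _ h12] at this
  have hγd : ∀ t ∈ Set.Ioo (-ε) ε, HasDerivAt γ (γ' t) t := by
    intro t ht
    refine HasDerivAt.prodMk (hasDerivAt_mul_diagonal_mul_transpose Q fun i => ?_)
      ((hasDerivAt_const t p).prodMk (HasDerivAt.prodMk ?_ ?_))
    · have h := (((hasDerivAt_id' t).mul_const (d i)).const_sub 1).fun_inv ((hall t ht).1 i).ne'
      exact h.congr_deriv (by rw [div_eq_mul_inv, one_mul, neg_neg])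
    · simpa using ((hasDerivAt_id t).mul_const s').const_add s
    · simpa using ((hasDerivAt_id t).smul_const Z).const_add x
  have h0 : (0 : ℝ) ∈ Set.Ioo (-ε) ε := ⟨by linarith, hε⟩
  have hγ'd : HasDerivAt γ'
      ((fun a b => (Q * diagonal (fun i => 2 * d i ^ 2) * Qᵀ : Matrix _ _ ℝ) a b, 0, 0, 0) : Jet n) 0 := by
    refine HasDerivAt.prodMk (hasDerivAt_mul_diagonal_mul_transpose Q fun i => ?_)
      ((hasDerivAt_const _ _).prodMk ((hasDerivAt_const _ _).prodMk (hasDerivAt_const _ _)))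
    have h := (((((hasDerivAt_id' (0 : ℝ)).mul_const (d i)).const_sub 1).fun_pow 2).fun_inv
      (by simp)).const_mul (d i)
    exact h.congr_deriv (by simp; ring)
  have hFd : ∀ t ∈ Set.Ioo (-ε) ε, HasFDerivAt F (fderiv ℝ F (γ t)) (γ t) := fun t ht =>
    ((hF.contDiffAt (isOpen_jetDomain.mem_nhds (hγdom t ht))).differentiableAt
      (by norm_num)).hasFDerivAt
  have hFd2 : HasFDerivAt (fderiv ℝ F) (fderiv ℝ (fderiv ℝ F) (γ 0)) (γ 0) :=
    (((hF.contDiffAt (isOpen_jetDomain.mem_nhds (hγdom 0 h0))).fderiv_right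
      (m := 1) (by norm_num)).differentiableAt (by norm_num)).hasFDerivAt
  have hk' : ∀ t ∈ Set.Ioo (-ε) ε, HasDerivAt (fun t => F (γ t)) (fderiv ℝ F (γ t) (γ' t)) t :=
    fun t ht => (hFd t ht).comp_hasDerivAt t (hγd t ht)
  have hk'' := (hFd2.comp_hasDerivAt (0 : ℝ) (hγd 0 h0)).clm_apply hγ'd
  have := second_deriv_nonneg_of_convexOn hε hkconv hk' hk''
  rw [hγ'0, Function.comp_apply, hγ0] at this
  have h2 : ((fun a b => (Q * diagonal (fun i => 2 * d i ^ 2) * Qᵀ : Matrix _ _ ℝ) a b, 0, 0, 0) : Jet n)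
      = (2 : ℝ) • ((fun i j => (X * A⁻¹ * X) i j, 0, 0, 0) : Jet n) := by
    refine Prod.ext ?_ (by simp)
    ext a b
    rw [hXX, Prod.smul_fst, Pi.smul_apply, Pi.smul_apply, smul_eq_mul]
    simp only [mul_diagonal_mul_transpose_apply, Finset.mul_sum]
    exact Finset.sum_congr rfl fun i _ => by ring
  rwa [h2, map_smul, smul_eq_mul] at this

end Structure

section LowerBound

open Matrix

variable {n : ℕ}

/-- The matrix `E_{ab}` as a function. -/
def unitEntry (a b : Fin n) : Fin n → Fin n → ℝ :=
  fun i j => if i = a ∧ j = b then (1 : ℝ) else 0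

/-- The symmetrized derivative of `F` in the matrix variable. -/
noncomputable def symbol (F : Jet n → ℝ) (z : Jet n) : Matrix (Fin n) (Fin n) ℝ :=
  of fun a b => (fderiv ℝ F z (unitEntry a b, 0, 0, 0) + fderiv ℝ F z (unitEntry b a, 0, 0, 0)) / 2

theorem isSymm_symbol (F : Jet n → ℝ) (z : Jet n) : (symbol F z).IsSymm := by
  ext a b
  rw [transpose_apply, symbol, of_apply, of_apply, add_comm]

theorem eq_sum_unitEntry (Y : Fin n → Fin n → ℝ) :
    Y = ∑ a, ∑ b, Y a b • unitEntry a b := by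
  ext i j
  simp only [Finset.sum_apply, Pi.smul_apply, unitEntry, smul_eq_mul, mul_ite, mul_one, mul_zero]
  rw [Finset.sum_eq_single i, Finset.sum_eq_single j] <;> simp +contextual [eq_comm]

theorem fderiv_matrix_eq_sum (G : Jet n →L[ℝ] ℝ) (Y : Fin n → Fin n → ℝ) :
    G (Y, 0, 0, 0) = ∑ a, ∑ b, G (unitEntry a b, 0, 0, 0) * Y a b := by
  let G' : (Fin n → Fin n → ℝ) →L[ℝ] ℝ := G.comp (ContinuousLinearMap.inl ℝ _ _)
  have h : ∀ Z, G' Z = G (Z, 0, 0, 0) := fun Z => rfl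
  have h2 := congrArg G' (eq_sum_unitEntry Y)
  simp only [map_sum, map_smul, smul_eq_mul] at h2
  simp only [h] at h2
  rw [h2]
  exact Finset.sum_congr rfl fun a _ => Finset.sum_congr rfl fun b _ => mul_comm _ _

theorem fderiv_symm_eq_sum (F : Jet n → ℝ) (z : Jet n) {Y : Matrix (Fin n) (Fin n) ℝ}
    (hY : Y.IsSymm) :
    fderiv ℝ F z ((fun i j => Y i j, 0, 0, 0) : Jet n) = ∑ a, ∑ b, symbol F z a b * Y a b := by
  set G := fderiv ℝ F z with hG
  have h : ∑ a, ∑ b, symbol F z a b * Y a b = (∑ a, ∑ b, G (unitEntry a b, 0, 0, 0) * Y a b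
      + ∑ a, ∑ b, G (unitEntry b a, 0, 0, 0) * Y a b) / 2 := by
    simp only [← Finset.sum_add_distrib, Finset.sum_div, symbol, of_apply, ← hG]
    exact Finset.sum_congr rfl fun a _ => Finset.sum_congr rfl fun b _ => by ring
  have h2 : ∑ a, ∑ b, G (unitEntry b a, 0, 0, 0) * Y a b
      = ∑ a, ∑ b, G (unitEntry a b, 0, 0, 0) * Y a b := by
    rw [Finset.sum_comm]
    exact Finset.sum_congr rfl fun a _ => Finset.sum_congr rfl fun b _ => by rw [hY.apply]
  rw [h, h2, fderiv_matrix_eq_sum]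
  ring

theorem trace_symm_mul (S : Matrix (Fin n) (Fin n) ℝ) {Y : Matrix (Fin n) (Fin n) ℝ}
    (hY : Y.IsSymm) : (S * Y).trace = ∑ a, ∑ b, S a b * Y a b := by
  simp only [trace, diag_apply, Matrix.mul_apply]
  exact Finset.sum_congr rfl fun a _ => Finset.sum_congr rfl fun b _ => by rw [hY.apply]

theorem fderiv_symm_eq_trace (F : Jet n → ℝ) (z : Jet n) {Y : Matrix (Fin n) (Fin n) ℝ}
    (hY : Y.IsSymm) :
    fderiv ℝ F z ((fun i j => Y i j, 0, 0, 0) : Jet n) = (symbol F z * Y).trace := by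
  rw [fderiv_symm_eq_sum F z hY, trace_symm_mul _ hY]

theorem norm_sq_le_frobSq (V : Matrix (Fin n) (Fin n) ℝ) :
    ‖(fun i j => V i j : Fin n → Fin n → ℝ)‖ ≤ Real.sqrt (frobSq V) := by
  refine (pi_norm_le_iff_of_nonneg (Real.sqrt_nonneg _)).2 fun i =>
    (pi_norm_le_iff_of_nonneg (Real.sqrt_nonneg _)).2 fun j => ?_
  refine Real.le_sqrt_of_sq_le ?_
  rw [Real.norm_eq_abs, sq_abs]
  calc V i j ^ 2 ≤ ∑ j, V i j ^ 2 :=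
        Finset.single_le_sum (f := fun j => V i j ^ 2) (fun _ _ => sq_nonneg _) (Finset.mem_univ j)
    _ ≤ frobSq V := Finset.single_le_sum (f := fun i => ∑ j, V i j ^ 2)
        (fun _ _ => Finset.sum_nonneg fun _ _ => sq_nonneg _) (Finset.mem_univ i)

theorem frobSq_le_norm_sq (V : Matrix (Fin n) (Fin n) ℝ) :
    frobSq V ≤ (n * ‖(fun i j => V i j : Fin n → Fin n → ℝ)‖) ^ 2 := by
  have h : ∀ i j, V i j ^ 2 ≤ ‖(fun i j => V i j : Fin n → Fin n → ℝ)‖ ^ 2 := by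
    intro i j
    rw [← sq_abs, ← Real.norm_eq_abs]
    gcongr
    exact (norm_le_pi_norm (fun j => V i j) j).trans
      (norm_le_pi_norm (fun i j => V i j : Fin n → Fin n → ℝ) i)
  calc frobSq V ≤ ∑ _i : Fin n, ∑ _j : Fin n, ‖(fun i j => V i j : Fin n → Fin n → ℝ)‖ ^ 2 :=
        Finset.sum_le_sum fun i _ => Finset.sum_le_sum fun j _ => h i j
    _ = _ := by simp; ring

theorem isSymm_mul_mul {V M : Matrix (Fin n) (Fin n) ℝ} (hV : V.IsSymm) (hM : M.IsSymm) :
    (V * M * V).IsSymm := by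
  have := isSymm_conj hM V
  rwa [hV.eq] at this

theorem isSymm_inv {M : Matrix (Fin n) (Fin n) ℝ} (hM : M.IsSymm) : M⁻¹.IsSymm := by
  rw [IsSymm, transpose_nonsing_inv, hM.eq]

theorem abs_bilin_le {E : Type*} [NormedAddCommGroup E] [NormedSpace ℝ E]
    {D : E →L[ℝ] E →L[ℝ] ℝ} {K : ℝ} (hD : ‖D‖ ≤ K) (v w : E) :
    |D v w| ≤ K * ‖v‖ * ‖w‖ := by
  calc |D v w| = ‖D v w‖ := rfl
    _ ≤ ‖D‖ * ‖v‖ * ‖w‖ := D.le_opNorm₂ v w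
    _ ≤ _ := by gcongr

theorem lower_bound_posDef {F : Jet n → ℝ} (hF : ContDiffOn ℝ 2 F (jetDomain n))
    (hconv : InverseConvex F) {L K τ : ℝ} (hL : 0 < L) (hK : 0 ≤ K) (hτ : 0 < τ)
    {A : Matrix (Fin n) (Fin n) ℝ} {p : Fin n → ℝ} {s : ℝ}
    {x : EuclideanSpace ℝ (Fin n)} (hA : A.PosDef) (hx : x ∈ ball 0 1)
    (hell : EllipticBound L (symbol F (fun i j => A i j, p, s, x)))
    (hD : ‖fderiv ℝ (fderiv ℝ F) ((fun i j => A i j, p, s, x) : Jet n)‖ ≤ K)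
    {V : Matrix (Fin n) (Fin n) ℝ} (hV : V.IsSymm) (s' : ℝ) (Z : EuclideanSpace ℝ (Fin n)) :
    -((K * (2 + L ^ 2 * n)) ^ 2 * L ^ 3 / 4 * τ
        * ‖((fun i j => V i j, 0, s', Z) : Jet n)‖ ^ 2) ≤
      fderiv ℝ (fderiv ℝ F) ((fun i j => A i j, p, s, x) : Jet n)
        ((fun i j => V i j, 0, s', Z) : Jet n) ((fun i j => V i j, 0, s', Z) : Jet n)
      + 2 * fderiv ℝ F ((fun i j => A i j, p, s, x) : Jet n)
        ((fun i j => (V * (A + τ • (1 : Matrix (Fin n) (Fin n) ℝ))⁻¹ * V) i j, 0, 0, 0)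
          : Jet n) := by
  obtain ⟨X, hX, h1, h2⟩ := exists_comparison_matrix hL hτ (isSymm_symbol F _) hell hA hV
  have h3 := hconv.second_order hF hA hx hX s' Z (p := p) (s := s)
  have hAs := posDef_isSymm hA
  have hAτ : (A + τ • (1 : Matrix (Fin n) (Fin n) ℝ)).IsSymm :=
    hAs.add (isSymm_one.smul τ)
  rw [fderiv_symm_eq_trace F _ (isSymm_mul_mul hX (isSymm_inv hAs))] at h3
  rw [fderiv_symm_eq_trace F _ (isSymm_mul_mul hV (isSymm_inv hAτ))]
  set z₀ : Jet n := (fun i j => A i j, p, s, x)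
  set D := fderiv ℝ (fderiv ℝ F) z₀
  set W : Jet n := (fun i j => V i j, 0, s', Z)
  set WX : Jet n := (fun i j => X i j, 0, s', Z)
  set WY : Jet n := (fun i j => (V - X) i j, 0, 0, 0)
  have hW : WX = W - WY := by
    refine Prod.ext ?_ (by simp [WX, W, WY])
    ext i j; simp [WX, W, WY]
  set y := Real.sqrt (frobSq (V - X)) with hy
  have hy0 : 0 ≤ y := Real.sqrt_nonneg _
  have hysq : y ^ 2 = frobSq (V - X) := Real.sq_sqrt (frobSq_nonneg _)
  have hWY : ‖WY‖ ≤ y := by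
    have : ‖WY‖ = ‖(fun i j => (V - X) i j : Fin n → Fin n → ℝ)‖ := by
      simp [WY, Prod.norm_def]
    rw [this]; exact norm_sq_le_frobSq (V - X)
  have hVW : ‖(fun i j => V i j : Fin n → Fin n → ℝ)‖ ≤ ‖W‖ := norm_fst_le W
  have hyW : y ≤ L ^ 2 * n * ‖W‖ := by
    rw [hy]
    refine Real.sqrt_le_iff.2 ⟨by positivity, ?_⟩
    calc frobSq (V - X) ≤ L ^ 4 * frobSq V := h2
      _ ≤ L ^ 4 * (n * ‖W‖) ^ 2 := by
          gcongr
          exact (frobSq_le_norm_sq V).trans (by gcongr)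
      _ = _ := by ring
  have b1 := (abs_le.1 (abs_bilin_le hD W WY)).1
  have b2 := (abs_le.1 (abs_bilin_le hD WY W)).1
  have b3 := (abs_le.1 (abs_bilin_le hD WY WY)).2
  have hexp : D WX WX = D W W - D W WY - D WY W + D WY WY := by
    rw [hW]; simp only [map_sub, _root_.sub_apply]; ring
  have hw0 : 0 ≤ ‖W‖ := norm_nonneg _
  have e1 : K * ‖W‖ * ‖WY‖ ≤ K * ‖W‖ * y := by gcongr
  have e2 : K * ‖WY‖ * ‖W‖ ≤ K * ‖W‖ * y := by
    calc _ = K * ‖W‖ * ‖WY‖ := by ring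
      _ ≤ _ := e1
  have e3 : K * ‖WY‖ * ‖WY‖ ≤ K * (L ^ 2 * n * ‖W‖) * y := by
    gcongr; exact hWY.trans hyW
  rw [← Matrix.mul_assoc, ← Matrix.mul_assoc] at h3 ⊢
  rw [← hysq] at h1
  set T1 := (symbol F z₀ * X * A⁻¹ * X).trace
  set T2 := (symbol F z₀ * V * (A + τ • (1 : Matrix (Fin n) (Fin n) ℝ))⁻¹ * V).trace
  have hmain : -(K * (2 + L ^ 2 * n) * ‖W‖ * y) + 2 * ((2 * L ^ 3 * τ)⁻¹ * y ^ 2)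
      ≤ D W W + 2 * T2 := by nlinarith
  refine le_trans ?_ hmain
  have hLτ : 0 < L ^ 3 * τ := by positivity
  have : 2 * ((2 * L ^ 3 * τ)⁻¹ * y ^ 2) = (L ^ 3 * τ)⁻¹ * y ^ 2 := by
    rw [mul_assoc 2, mul_inv]; ring
  rw [this]
  set c := K * (2 + L ^ 2 * n) * ‖W‖
  have hsq : 0 ≤ (L ^ 3 * τ)⁻¹ * (y - L ^ 3 * τ * c / 2) ^ 2 := by positivity
  have hid : (L ^ 3 * τ)⁻¹ * (y - L ^ 3 * τ * c / 2) ^ 2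
      = (L ^ 3 * τ)⁻¹ * y ^ 2 - c * y + c ^ 2 * (L ^ 3 * τ) / 4 := by
    field_simp; ring
  have hc : (K * (2 + L ^ 2 * n)) ^ 2 * L ^ 3 / 4 * τ * ‖W‖ ^ 2 = c ^ 2 * (L ^ 3 * τ) / 4 := by
    simp only [c]; ring
  rw [hc]; linarith

theorem EllipticBound.of_close {L ε : ℝ} {S S' : Matrix (Fin n) (Fin n) ℝ}
    (hS : EllipticBound L S) (hε : ∀ a b, |S' a b - S a b| ≤ ε) (hε1 : ε * n ≤ (2 * L)⁻¹)
    (hε2 : ε * n ≤ L) : EllipticBound (2 * L) S' := by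
  intro ξ
  have hq : ξ ⬝ᵥ S' *ᵥ ξ = ξ ⬝ᵥ S *ᵥ ξ + ξ ⬝ᵥ (S' - S) *ᵥ ξ := by
    rw [sub_mulVec, dotProduct_sub]; ring
  have hsum : ξ ⬝ᵥ ξ = ∑ i, |ξ i| ^ 2 := by simp [dotProduct, sq]
  have hb : |ξ ⬝ᵥ (S' - S) *ᵥ ξ| ≤ ε * n * (ξ ⬝ᵥ ξ) := by
    rcases isEmpty_or_nonempty (Fin n) with h | ⟨⟨i₀⟩⟩
    · simp [dotProduct]
    have hε0 : 0 ≤ ε := (abs_nonneg _).trans (hε i₀ i₀)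
    calc |ξ ⬝ᵥ (S' - S) *ᵥ ξ| = |∑ a, ∑ b, ξ a * ((S' a b - S a b) * ξ b)| := by
          simp only [dotProduct, mulVec, Finset.mul_sum, Matrix.sub_apply]
      _ ≤ ∑ a, ∑ b, |ξ a * ((S' a b - S a b) * ξ b)| :=
          (Finset.abs_sum_le_sum_abs _ _).trans
            (Finset.sum_le_sum fun a _ => Finset.abs_sum_le_sum_abs _ _)
      _ ≤ ∑ a, ∑ b, ε * (|ξ a| * |ξ b|) := by
          refine Finset.sum_le_sum fun a _ => Finset.sum_le_sum fun b _ => ?_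
          rw [abs_mul, abs_mul]
          calc |ξ a| * (|S' a b - S a b| * |ξ b|) ≤ |ξ a| * (ε * |ξ b|) := by
                gcongr; exact hε a b
            _ = _ := by ring
      _ = ε * (∑ a, |ξ a|) ^ 2 := by
          rw [sq, Finset.sum_mul_sum, Finset.mul_sum]
          exact Finset.sum_congr rfl fun a _ => by rw [Finset.mul_sum]
      _ ≤ ε * (n * ∑ a, |ξ a| ^ 2) := by
          gcongr
          have := sq_sum_le_card_mul_sum_sq (s := Finset.univ) (f := fun a => |ξ a|)
          simpa using this
      _ = _ := by rw [hsum]; ring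
  have hq0 : 0 ≤ ξ ⬝ᵥ ξ := by rw [hsum]; positivity
  have hb' := abs_le.1 hb
  have := hS ξ
  rw [hq]
  have i1 := mul_le_mul_of_nonneg_right hε1 hq0
  have i2 := mul_le_mul_of_nonneg_right hε2 hq0
  have i3 : (2 * L)⁻¹ = L⁻¹ / 2 := by rw [mul_inv]; ring
  constructor
  · rw [i3] at i1 ⊢; linarith
  · linarith

/-- The main algebraic consequence of the structure condition: a lower bound for the second
variation that degenerates gracefully as `A` becomes singular. -/
theorem lower_bound_posSemidef {F : Jet n → ℝ} (hF : ContDiffOn ℝ 2 F (jetDomain n))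
    (hconv : InverseConvex F) {L K τ : ℝ} (hL : 0 < L) (hK : 0 ≤ K) (hτ : 0 < τ)
    (hD : ∀ z ∈ jetDomain n, ‖fderiv ℝ (fderiv ℝ F) z‖ ≤ K)
    {A : Matrix (Fin n) (Fin n) ℝ} {p : Fin n → ℝ} {s : ℝ}
    {x : EuclideanSpace ℝ (Fin n)} (hA : A.PosSemidef) (hx : x ∈ ball 0 1)
    (hell : EllipticBound L (symbol F (fun i j => A i j, p, s, x)))
    {V : Matrix (Fin n) (Fin n) ℝ} (hV : V.IsSymm) (s' : ℝ) (Z : EuclideanSpace ℝ (Fin n)) :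
    -((K * (2 + (2 * L) ^ 2 * n)) ^ 2 * (2 * L) ^ 3 / 4 * τ
        * ‖((fun i j => V i j, 0, s', Z) : Jet n)‖ ^ 2) ≤
      fderiv ℝ (fderiv ℝ F) ((fun i j => A i j, p, s, x) : Jet n)
        ((fun i j => V i j, 0, s', Z) : Jet n) ((fun i j => V i j, 0, s', Z) : Jet n)
      + 2 * fderiv ℝ F ((fun i j => A i j, p, s, x) : Jet n)
        ((fun i j => (V * (A + τ • (1 : Matrix (Fin n) (Fin n) ℝ))⁻¹ * V) i j, 0, 0, 0)
          : Jet n) := by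
  let z : ℝ → Jet n := fun σ =>
    (fun i j => (A + σ • (1 : Matrix (Fin n) (Fin n) ℝ)) i j, p, s, x)
  have hz0 : z 0 = (fun i j => A i j, p, s, x) := by simp [z]
  have hzc : Continuous z := by
    refine Continuous.prodMk (continuous_pi fun a => continuous_pi fun b => ?_) (by fun_prop)
    simp only [Matrix.add_apply, Matrix.smul_apply, smul_eq_mul]
    fun_prop
  have hdom : ∀ σ, z σ ∈ jetDomain n := fun σ => hx
  have hc1 : ContinuousAt (fderiv ℝ F) (z 0) :=
    ((hF.contDiffAt (isOpen_jetDomain.mem_nhds (hdom 0))).fderiv_right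
      (m := 1) (by norm_num)).continuousAt
  have hc2 : ContinuousAt (fderiv ℝ (fderiv ℝ F)) (z 0) :=
    (((hF.contDiffAt (isOpen_jetDomain.mem_nhds (hdom 0))).fderiv_right
      (m := 1) (by norm_num)).fderiv_right (m := 0) (by norm_num)).continuousAt
  have hzt : Filter.Tendsto z (nhdsWithin 0 (Set.Ioi 0)) (nhds (z 0)) :=
    hzc.continuousAt.tendsto.mono_left nhdsWithin_le_nhds
  have t1 : Filter.Tendsto (fun σ => fderiv ℝ F (z σ)) (nhdsWithin 0 (Set.Ioi 0))
      (nhds (fderiv ℝ F (z 0))) := hc1.tendsto.comp hzt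
  have t2 : Filter.Tendsto (fun σ => fderiv ℝ (fderiv ℝ F) (z σ)) (nhdsWithin 0 (Set.Ioi 0))
      (nhds (fderiv ℝ (fderiv ℝ F) (z 0))) := hc2.tendsto.comp hzt
  have t1' : ∀ w : Jet n, Filter.Tendsto (fun σ => fderiv ℝ F (z σ) w)
      (nhdsWithin 0 (Set.Ioi 0)) (nhds (fderiv ℝ F (z 0) w)) := fun w =>
    ((ContinuousLinearMap.apply ℝ ℝ w).continuous.tendsto _).comp t1
  have t2' : ∀ w : Jet n, Filter.Tendsto (fun σ => fderiv ℝ (fderiv ℝ F) (z σ) w w)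
      (nhdsWithin 0 (Set.Ioi 0)) (nhds (fderiv ℝ (fderiv ℝ F) (z 0) w w)) := fun w =>
    ((ContinuousLinearMap.apply ℝ ℝ w).continuous.tendsto _).comp
      (((ContinuousLinearMap.apply ℝ (Jet n →L[ℝ] ℝ) w).continuous.tendsto _).comp t2)
  have hellσ : ∀ᶠ σ in nhdsWithin (0 : ℝ) (Set.Ioi 0), EllipticBound (2 * L) (symbol F (z σ)) := by
    set ε := min (2 * L)⁻¹ L / (n + 1) with hε
    have hm : 0 < min (2 * L)⁻¹ L := lt_min (by positivity) hL
    have hε0 : 0 < ε := by positivity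
    have hεn : ε * n ≤ min (2 * L)⁻¹ L := by
      rw [hε, div_mul_eq_mul_div, div_le_iff₀ (by positivity)]
      nlinarith
    have hS : ∀ a b, ∀ᶠ σ in nhdsWithin (0 : ℝ) (Set.Ioi 0),
        |symbol F (z σ) a b - symbol F (z 0) a b| ≤ ε := by
      intro a b
      have : Filter.Tendsto (fun σ => symbol F (z σ) a b) (nhdsWithin 0 (Set.Ioi 0))
          (nhds (symbol F (z 0) a b)) := by
        simp only [symbol, of_apply]
        exact ((t1' _).add (t1' _)).div_const 2
      filter_upwards [Metric.tendsto_nhds.1 this ε hε0] with σ hσ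
      exact hσ.le
    filter_upwards [Filter.eventually_all.2 fun a => Filter.eventually_all.2 fun b => hS a b]
      with σ hσ
    rw [← hz0] at hell
    exact hell.of_close hσ (hεn.trans (min_le_left _ _)) (hεn.trans (min_le_right _ _))
  have hlim := (t2' ((fun i j => V i j, 0, s', Z) : Jet n)).add ((t1' ((fun i j =>
    (V * (A + τ • (1 : Matrix (Fin n) (Fin n) ℝ))⁻¹ * V) i j, 0, 0, 0) : Jet n)).const_mul 2)
  rw [hz0] at hlim
  refine ge_of_tendsto hlim ?_
  filter_upwards [hellσ, Ioo_mem_nhdsGT hτ] with σ hσ hστ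
  have hApos : (A + σ • (1 : Matrix (Fin n) (Fin n) ℝ)).PosDef :=
    PosDef.posSemidef_add hA (PosDef.one.smul hστ.1)
  have := lower_bound_posDef hF hconv (by positivity : 0 < 2 * L) hK
    (sub_pos.2 hστ.2) hApos hx hσ (hD _ (hdom σ)) hV s' Z
  rw [add_assoc, ← add_smul, add_sub_cancel] at this
  refine le_trans (neg_le_neg ?_) this
  gcongr
  linarith [hστ.1]

end LowerBound

section Calculus

open Filter Topology

variable {n : ℕ}

/-- The partial derivative in the direction of the `i`-th basis vector. -/
noncomputable def dd (i : Fin n) (f : EuclideanSpace ℝ (Fin n) → ℝ)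
    (x : EuclideanSpace ℝ (Fin n)) : ℝ :=
  fderiv ℝ f x (EuclideanSpace.single i 1)

/-- `φ` is a `C¹` function whose support is a compact subset of the unit ball. -/
structure IsTest (φ : EuclideanSpace ℝ (Fin n) → ℝ) : Prop where
  contDiff : ContDiff ℝ 1 φ
  compact : HasCompactSupport φ
  subset : tsupport φ ⊆ ball 0 1

theorem differentiableAt_of_contDiffOn_ball {f : EuclideanSpace ℝ (Fin n) → ℝ}
    (hf : ContDiffOn ℝ 1 f (ball 0 1)) {x : EuclideanSpace ℝ (Fin n)} (hx : x ∈ ball 0 1) :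
    DifferentiableAt ℝ f x :=
  (hf.differentiableOn one_ne_zero).differentiableAt (isOpen_ball.mem_nhds hx)

theorem dd_mul {f g : EuclideanSpace ℝ (Fin n) → ℝ} {x : EuclideanSpace ℝ (Fin n)}
    (hf : DifferentiableAt ℝ f x) (hg : DifferentiableAt ℝ g x) (i : Fin n) :
    dd i (fun y => f y * g y) x = dd i f x * g x + f x * dd i g x := by
  simp only [dd]
  rw [fderiv_fun_mul hf hg]
  simp; ring

theorem dd_eq_zero_of_notMem_tsupport {f : EuclideanSpace ℝ (Fin n) → ℝ}
    {x : EuclideanSpace ℝ (Fin n)} (hx : x ∉ tsupport f) (i : Fin n) : dd i f x = 0 := by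
  have : fderiv ℝ f x = 0 := by
    have := (support_fderiv_subset ℝ (f := f)).trans subset_rfl
    by_contra h
    exact hx (this h)
  simp [dd, this]

theorem continuousOn_dd {f : EuclideanSpace ℝ (Fin n) → ℝ}
    (hf : ContDiffOn ℝ 1 f (ball 0 1)) (i : Fin n) : ContinuousOn (dd i f) (ball 0 1) :=
  (hf.continuousOn_fderiv_of_isOpen isOpen_ball le_rfl).clm_apply continuousOn_const

theorem IsTest.continuous_dd {φ : EuclideanSpace ℝ (Fin n) → ℝ} (hφ : IsTest φ) (i : Fin n) :
    Continuous (dd i φ) :=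
  (hφ.contDiff.continuous_fderiv one_ne_zero).clm_apply continuous_const

/-- A function continuous on the ball and vanishing off a compact subset is continuous with compact
support. -/
theorem continuous_of_continuousOn_ball {f : EuclideanSpace ℝ (Fin n) → ℝ}
    (hf : ContinuousOn f (ball 0 1)) (hs : tsupport f ⊆ ball 0 1) : Continuous f :=
  continuous_iff_continuousAt.2 fun x => by
    by_cases hx : x ∈ tsupport f
    · exact hf.continuousAt (isOpen_ball.mem_nhds (hs hx))
    · have : f =ᶠ[𝓝 x] fun _ => 0 := by
        filter_upwards [(isClosed_tsupport f).isOpen_compl.mem_nhds hx] with y hy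
        exact image_eq_zero_of_notMem_tsupport hy
      exact continuousAt_const.congr this.symm

theorem integrable_mul_of_continuousOn {ψ f : EuclideanSpace ℝ (Fin n) → ℝ}
    (hψ : ContinuousOn ψ (ball 0 1)) (hc : HasCompactSupport ψ) (hs : tsupport ψ ⊆ ball 0 1)
    (hf : ContinuousOn f (ball 0 1)) : Integrable (fun x => ψ x * f x) := by
  have h : tsupport (fun x => ψ x * f x) ⊆ tsupport ψ := tsupport_mul_subset_left
  exact (continuous_of_continuousOn_ball (hψ.mul hf) (h.trans hs)).integrable_of_hasCompactSupport
    hc.mul_right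

theorem IsTest.mul {φ f : EuclideanSpace ℝ (Fin n) → ℝ} (hφ : IsTest φ)
    (hf : ContDiffOn ℝ 1 f (ball 0 1)) : IsTest fun x => φ x * f x := by
  have h : tsupport (fun x => φ x * f x) ⊆ tsupport φ := tsupport_mul_subset_left
  refine ⟨contDiff_iff_contDiffAt.2 fun x => ?_, hφ.compact.mul_right, h.trans hφ.subset⟩
  by_cases hx : x ∈ tsupport φ
  · exact hφ.contDiff.contDiffAt.mul (hf.contDiffAt (isOpen_ball.mem_nhds (hφ.subset hx)))
  · have : (fun x => φ x * f x) =ᶠ[𝓝 x] fun _ => 0 := by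
      filter_upwards [(isClosed_tsupport φ).isOpen_compl.mem_nhds hx] with y hy
      rw [image_eq_zero_of_notMem_tsupport hy, zero_mul]
    exact contDiffAt_const.congr_of_eventuallyEq this

theorem IsTest.tsupport_dd {φ : EuclideanSpace ℝ (Fin n) → ℝ} (i : Fin n) :
    tsupport (dd i φ) ⊆ tsupport φ :=
  closure_minimal (fun x hx => by
    by_contra h
    exact hx (dd_eq_zero_of_notMem_tsupport h i)) (isClosed_tsupport φ)

theorem IsTest.compact_dd {φ : EuclideanSpace ℝ (Fin n) → ℝ} (hφ : IsTest φ) (i : Fin n) :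
    HasCompactSupport (dd i φ) :=
  hφ.compact.of_isClosed_subset (isClosed_tsupport _) (tsupport_dd i)

theorem IsTest.integrable_mul {φ f : EuclideanSpace ℝ (Fin n) → ℝ} (hφ : IsTest φ)
    (hf : ContinuousOn f (ball 0 1)) : Integrable (fun x => φ x * f x) :=
  integrable_mul_of_continuousOn hφ.contDiff.continuous.continuousOn hφ.compact hφ.subset hf

theorem IsTest.integrable_dd_mul {φ f : EuclideanSpace ℝ (Fin n) → ℝ} (hφ : IsTest φ)
    (hf : ContinuousOn f (ball 0 1)) (i : Fin n) : Integrable (fun x => dd i φ x * f x) :=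
  integrable_mul_of_continuousOn (hφ.continuous_dd i).continuousOn (hφ.compact_dd i)
    ((tsupport_dd i).trans hφ.subset) hf

theorem IsTest.integral_dd_mul {φ ψ : EuclideanSpace ℝ (Fin n) → ℝ} (hφ : IsTest φ)
    (hψ : ContDiff ℝ 1 ψ) (i : Fin n) : ∫ x, ψ x * dd i φ x = - ∫ x, dd i ψ x * φ x := by
  have hψ' : Continuous (dd i ψ) :=
    (hψ.continuous_fderiv one_ne_zero).clm_apply continuous_const
  refine integral_mul_fderiv_eq_neg_fderiv_mul_of_integrable
    (f := ψ) (g := φ) (v := EuclideanSpace.single i (1 : ℝ)) ?_ ?_ ?_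
    (fun x _ => hψ.differentiable one_ne_zero x) (fun x _ => hφ.contDiff.differentiable one_ne_zero x)
  · exact (hφ.integrable_mul hψ'.continuousOn).congr (ae_of_all _ fun x => mul_comm _ _)
  · exact (hφ.integrable_dd_mul hψ.continuous.continuousOn i).congr
      (ae_of_all _ fun x => mul_comm _ _)
  · exact (hφ.integrable_mul hψ.continuous.continuousOn).congr (ae_of_all _ fun x => mul_comm _ _)

theorem IsTest.integral_dd {φ : EuclideanSpace ℝ (Fin n) → ℝ} (hφ : IsTest φ) (i : Fin n) :
    ∫ x, dd i φ x = 0 := by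
  have := hφ.integral_dd_mul (ψ := fun _ => 1) contDiff_const i
  simpa [dd] using this

theorem tendsto_integral_difference_quotient {f g : EuclideanSpace ℝ (Fin n) → ℝ}
    (hf : ContDiff ℝ 1 f) (hfc : HasCompactSupport f) (hg : Integrable g)
    (v : EuclideanSpace ℝ (Fin n)) :
    Tendsto (fun t : ℝ => ∫ x, t⁻¹ * (f (x + t • v) - f x) * g x) (𝓝[>] 0)
      (𝓝 (∫ x, fderiv ℝ f x v * g x)) := by
  obtain ⟨C, hC⟩ := hf.lipschitzWith_of_hasCompactSupport hfc one_ne_zero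
  have := hC.integral_inv_smul_sub_mul_tendsto_integral_lineDeriv_mul hg v
  simp only [smul_eq_mul] at this
  have h : ∀ x, lineDeriv ℝ f x v = fderiv ℝ f x v := fun x =>
    (hf.differentiable one_ne_zero x).lineDeriv_eq_fderiv
  simpa only [h] using this

theorem exists_isTest_eq_one {k : Set (EuclideanSpace ℝ (Fin n))} (hk : IsCompact k)
    (hs : k ⊆ ball 0 1) : ∃ χ : EuclideanSpace ℝ (Fin n) → ℝ, IsTest χ ∧ ∀ x ∈ k, χ =ᶠ[𝓝 x] 1 := by
  obtain ⟨r, hr0, hr1, hr⟩ : ∃ r, 0 < r ∧ r < 1 ∧ k ⊆ ball (0 : EuclideanSpace ℝ (Fin n)) r := by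
    obtain ⟨r, hr, h⟩ := exists_lt_subset_ball hk.isClosed hs
    exact ⟨max r (1 / 2), by positivity, max_lt hr (by norm_num),
      h.trans (ball_subset_ball (le_max_left _ _))⟩
  let b : ContDiffBump (0 : EuclideanSpace ℝ (Fin n)) := ⟨r, (1 + r) / 2, hr0, by linarith⟩
  refine ⟨b, ⟨b.contDiff, b.hasCompactSupport, ?_⟩, fun x hx => ?_⟩
  · rw [b.tsupport_eq]
    exact closedBall_subset_ball (by show (1 + r) / 2 < 1; linarith)
  · exact b.eventuallyEq_one_of_mem_ball (hr hx)

/-- Symmetry of the weak second derivatives, tested against a `C¹` function. -/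
theorem IsTest.integral_dd_mul_dd_comm {φ v : EuclideanSpace ℝ (Fin n) → ℝ} (hφ : IsTest φ)
    (hv : ContDiffOn ℝ 1 v (ball 0 1)) (a i : Fin n) :
    ∫ x, dd a φ x * dd i v x = ∫ x, dd i φ x * dd a v x := by
  obtain ⟨χ, hχ, h1⟩ := exists_isTest_eq_one hφ.compact hφ.subset
  have hw := hχ.mul hv
  set w := fun x => χ x * v x with hw_def
  have hloc : ∀ i j x, dd j φ x * dd i v x = dd j φ x * dd i w x := by
    intro i j x
    by_cases hx : x ∈ tsupport φ
    · have : w =ᶠ[𝓝 x] v := by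
        filter_upwards [h1 x hx] with y hy
        simp [hw_def, hy]
      rw [dd, dd, dd, this.fderiv_eq]
    · rw [dd_eq_zero_of_notMem_tsupport hx]; simp
  simp only [hloc]
  clear_value w
  have l1 := tendsto_integral_difference_quotient hw.contDiff hw.compact
    ((hφ.continuous_dd a).integrable_of_hasCompactSupport (hφ.compact_dd a))
    (EuclideanSpace.single i 1)
  have l2 := tendsto_integral_difference_quotient hφ.contDiff hφ.compact
    ((hw.continuous_dd a).integrable_of_hasCompactSupport (hw.compact_dd a))
    (-EuclideanSpace.single i 1)
  have l3 : ∀ t : ℝ, ∫ x, t⁻¹ * (φ (x + t • -EuclideanSpace.single i 1) - φ x) * dd a w x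
      = - ∫ x, t⁻¹ * (w (x + t • EuclideanSpace.single i 1) - w x) * dd a φ x := by
    intro t
    set e : EuclideanSpace ℝ (Fin n) := t • EuclideanSpace.single i 1 with he
    have hsh : ContDiff ℝ 1 (fun x => w (x + e) - w x) :=
      (hw.contDiff.comp (contDiff_id.add contDiff_const)).sub hw.contDiff
    have hd : ∀ x, dd a (fun x => w (x + e) - w x) x = dd a w (x + e) - dd a w x := by
      intro x
      have hwd := hw.contDiff.differentiable one_ne_zero
      have h : DifferentiableAt ℝ (fun x => w (x + e)) x :=
        (hwd _).comp x (differentiableAt_id.add_const e)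
      rw [dd, fderiv_fun_sub h (hwd x), fderiv_comp_add_right]; rfl
    have h1 := hφ.integral_dd_mul hsh a
    simp only [hd] at h1
    have hwa := hw.continuous_dd a
    have i1 : Integrable (fun x => dd a w (x + e) * φ x) :=
      (hφ.integrable_mul (f := fun x => dd a w (x + e))
        (hwa.comp (continuous_add_const e)).continuousOn).congr (ae_of_all _ fun x => mul_comm _ _)
    have i2 : Integrable (fun x => dd a w x * φ x) :=
      (hφ.integrable_mul hwa.continuousOn).congr (ae_of_all _ fun x => mul_comm _ _)
    have h2 : ∫ x, dd a w (x + e) * φ x = ∫ x, dd a w x * φ (x - e) := by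
      rw [← integral_add_right_eq_self (fun x => dd a w x * φ (x - e)) e]
      simp
    have i3 : Integrable (fun x => dd a w x * φ (x - e)) := by
      have := i1.comp_sub_right e
      simpa using this
    have h3 : ∫ x, (dd a w (x + e) - dd a w x) * φ x
        = ∫ x, (φ (x - e) - φ x) * dd a w x := by
      simp only [sub_mul]
      rw [integral_sub i1 i2, h2, ← integral_sub i3 i2]
      exact integral_congr_ae (ae_of_all _ fun x => by ring)
    rw [h3] at h1
    simp only [smul_neg, ← sub_eq_add_neg, mul_assoc]
    rw [integral_const_mul, integral_const_mul, h1]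
    ring
  have l4 := tendsto_nhds_unique (l2.congr l3) l1.neg
  have e1 : ∀ x, dd a φ x * dd i w x = fderiv ℝ w x (EuclideanSpace.single i 1) * dd a φ x :=
    fun x => mul_comm _ _
  have e2 : ∀ x, fderiv ℝ φ x (-EuclideanSpace.single i 1) * dd a w x
      = -(dd i φ x * dd a w x) := fun x => by rw [map_neg, neg_mul]; rfl
  simp only [e2, integral_neg, neg_inj] at l4
  simp only [e1]
  exact l4.symm

end Calculus

section IntegralIdentity

variable {n : ℕ}

theorem integral_identity {φ : EuclideanSpace ℝ (Fin n) → ℝ} (hφ : IsTest φ)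
    {S A : Fin n → Fin n → EuclideanSpace ℝ (Fin n) → ℝ}
    {ζ g : Fin n → EuclideanSpace ℝ (Fin n) → ℝ}
    (hS : ∀ a b, ContDiffOn ℝ 1 (S a b) (ball 0 1)) (hA : ∀ a b, ContDiffOn ℝ 1 (A a b) (ball 0 1))
    (hζ : ∀ i, ContDiffOn ℝ 1 (ζ i) (ball 0 1)) (hg : ∀ i, ContDiffOn ℝ 1 (g i) (ball 0 1))
    (hcomm : ∀ x ∈ ball 0 1, ∀ k a b, dd k (A a b) x = dd a (A k b) x)
    (hsymm : ∀ x ∈ ball 0 1, ∀ k a b, dd k (A a b) x = dd k (A b a) x)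
    (heq : ∀ x ∈ ball 0 1, ∀ j, ∑ a, ∑ b, S a b x * dd j (A a b) x = -g j x) :
    ∫ x, ∑ a, ∑ b, ∑ i, ∑ j, dd a (fun x => φ x * (ζ i x * ζ j x) * S a b x) x * dd b (A i j) x =
      ∫ x, φ x * ∑ i, ∑ j, (ζ i x * ζ j x) *
        (∑ a, ∑ b, dd i (S a b) x * dd j (A a b) x + dd i (g j) x) := by
  have hΩ : ∀ i j, IsTest fun x => φ x * (ζ i x * ζ j x) := fun i j =>
    hφ.mul ((hζ i).mul (hζ j))
  have hΨ : ∀ a b i j, IsTest fun x => φ x * (ζ i x * ζ j x) * S a b x := fun a b i j =>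
    (hΩ i j).mul (hS a b)
  have hG : ∀ i j, IsTest fun x => φ x * (ζ i x * ζ j x) * g j x := fun i j =>
    (hΩ i j).mul (hg j)
  have hoff : ∀ {ψ f f' : EuclideanSpace ℝ (Fin n) → ℝ}, IsTest ψ → ∀ (a : Fin n) x,
      (x ∈ ball (0 : EuclideanSpace ℝ (Fin n)) 1 → f x = f' x) → dd a ψ x * f x = dd a ψ x * f' x := by
    intro ψ f f' hψ a x h
    by_cases hx : x ∈ tsupport ψ
    · rw [h (hψ.subset hx)]
    · rw [dd_eq_zero_of_notMem_tsupport hx, zero_mul, zero_mul]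
  have hswap : ∀ a b i j, ∫ x, dd a (fun x => φ x * (ζ i x * ζ j x) * S a b x) x * dd b (A i j) x
      = ∫ x, dd i (fun x => φ x * (ζ i x * ζ j x) * S a b x) x * dd j (A a b) x := by
    intro a b i j
    calc _ = ∫ x, dd a (fun x => φ x * (ζ i x * ζ j x) * S a b x) x * dd i (A b j) x :=
          integral_congr_ae (ae_of_all _ fun x => hoff (hΨ a b i j) a x fun hx => hcomm x hx b i j)
      _ = ∫ x, dd i (fun x => φ x * (ζ i x * ζ j x) * S a b x) x * dd a (A b j) x :=
          (hΨ a b i j).integral_dd_mul_dd_comm (hA b j) a i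
      _ = _ := integral_congr_ae (ae_of_all _ fun x => hoff (hΨ a b i j) i x fun hx => by
          rw [hsymm x hx, hcomm x hx])
  have hint : ∀ a b i j k l m, Integrable fun x =>
      dd k (fun x => φ x * (ζ i x * ζ j x) * S a b x) x * dd l (A m j) x := fun a b i j k l m =>
    (hΨ a b i j).integrable_dd_mul (continuousOn_dd (hA m j) l) k
  have hint' : ∀ a b i j, Integrable fun x =>
      dd i (fun x => φ x * (ζ i x * ζ j x) * S a b x) x * dd j (A a b) x := fun a b i j =>
    (hΨ a b i j).integrable_dd_mul (continuousOn_dd (hA a b) j) i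
  have hintG : ∀ i j, Integrable (dd i fun x => φ x * (ζ i x * ζ j x) * g j x) := fun i j =>
    ((hG i j).continuous_dd i).integrable_of_hasCompactSupport ((hG i j).compact_dd i)
  calc _ = ∑ a, ∑ b, ∑ i, ∑ j,
        ∫ x, dd i (fun x => φ x * (ζ i x * ζ j x) * S a b x) x * dd j (A a b) x := by
        simp only [← hswap]
        rw [integral_finsetSum _ fun a _ => integrable_finsetSum _ fun b _ =>
          integrable_finsetSum _ fun i _ => integrable_finsetSum _ fun j _ => hint ..]
        refine Finset.sum_congr rfl fun a _ => ?_
        rw [integral_finsetSum _ fun b _ =>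
          integrable_finsetSum _ fun i _ => integrable_finsetSum _ fun j _ => hint ..]
        refine Finset.sum_congr rfl fun b _ => ?_
        rw [integral_finsetSum _ fun i _ => integrable_finsetSum _ fun j _ => hint ..]
        refine Finset.sum_congr rfl fun i _ => ?_
        rw [integral_finsetSum _ fun j _ => hint ..]
    _ = ∑ i, ∑ j, ∑ a, ∑ b,
        ∫ x, dd i (fun x => φ x * (ζ i x * ζ j x) * S a b x) x * dd j (A a b) x := by
        rw [Finset.sum_congr rfl fun a _ => Finset.sum_comm, Finset.sum_comm]
        refine Finset.sum_congr rfl fun i _ => ?_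
        rw [Finset.sum_congr rfl fun a _ => Finset.sum_comm, Finset.sum_comm]
    _ = ∑ i, ∑ j, ∫ x, (∑ a, ∑ b,
        dd i (fun x => φ x * (ζ i x * ζ j x) * S a b x) x * dd j (A a b) x
        + dd i (fun x => φ x * (ζ i x * ζ j x) * g j x) x) := by
        refine Finset.sum_congr rfl fun i _ => Finset.sum_congr rfl fun j _ => ?_
        rw [integral_add (integrable_finsetSum _ fun a _ => integrable_finsetSum _ fun b _ =>
          hint' a b i j) (hintG i j), (hG i j).integral_dd, add_zero,
          integral_finsetSum _ fun a _ => integrable_finsetSum _ fun b _ => hint' a b i j]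
        refine Finset.sum_congr rfl fun a _ => ?_
        rw [integral_finsetSum _ fun b _ => hint' a b i j]
    _ = ∫ x, ∑ i, ∑ j, (∑ a, ∑ b,
        dd i (fun x => φ x * (ζ i x * ζ j x) * S a b x) x * dd j (A a b) x
        + dd i (fun x => φ x * (ζ i x * ζ j x) * g j x) x) := by
        have h : ∀ i j, Integrable fun x => (∑ a, ∑ b,
            dd i (fun x => φ x * (ζ i x * ζ j x) * S a b x) x * dd j (A a b) x
            + dd i (fun x => φ x * (ζ i x * ζ j x) * g j x) x) := fun i j =>
          (integrable_finsetSum _ fun a _ => integrable_finsetSum _ fun b _ =>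
            hint' a b i j).add (hintG i j)
        rw [integral_finsetSum _ fun i _ => integrable_finsetSum _ fun j _ => h i j]
        refine Finset.sum_congr rfl fun i _ => ?_
        rw [integral_finsetSum _ fun j _ => h i j]
    _ = _ := by
        refine integral_congr_ae (ae_of_all _ fun x => ?_)
        simp only [Finset.mul_sum]
        refine Finset.sum_congr rfl fun i _ => Finset.sum_congr rfl fun j _ => ?_
        by_cases hx : x ∈ tsupport φ
        · have hxB := hφ.subset hx
          have hd := (hΩ i j).contDiff.differentiable one_ne_zero x
          rw [dd_mul hd (differentiableAt_of_contDiffOn_ball (hg j) hxB)]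
          simp only [fun a b => dd_mul hd (differentiableAt_of_contDiffOn_ball (hS a b) hxB)]
          simp only [add_mul, Finset.sum_add_distrib, mul_assoc, ← Finset.mul_sum, heq x hxB]
          ring
        · have h0 : ∀ f : EuclideanSpace ℝ (Fin n) → ℝ,
              dd i (fun x => φ x * (ζ i x * ζ j x) * f x) x = 0 := fun f =>
            dd_eq_zero_of_notMem_tsupport (fun h => hx (by
              simp only [mul_assoc] at h
              exact tsupport_mul_subset_left h)) i
          simp only [h0, image_eq_zero_of_notMem_tsupport hx]
          simp

end IntegralIdentity

section Jets

variable {n : ℕ}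

theorem pd_eq_dd (f : EuclideanSpace ℝ (Fin n) → ℝ) (x : EuclideanSpace ℝ (Fin n)) (i : Fin n) :
    pd f x i = dd i f x := by
  simp [pd, dd]

theorem hessM_apply (u : EuclideanSpace ℝ (Fin n) → ℝ) (x : EuclideanSpace ℝ (Fin n))
    (i j : Fin n) : hessM u x i j = dd i (dd j u) x := by
  simp only [hessM, Matrix.of_apply, pd_eq_dd]

theorem contDiffOn_dd {m : ℕ} {f : EuclideanSpace ℝ (Fin n) → ℝ}
    (hf : ContDiffOn ℝ (m + 1) f (ball 0 1)) (i : Fin n) : ContDiffOn ℝ m (dd i f) (ball 0 1) :=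
  (hf.fderiv_of_isOpen isOpen_ball le_rfl).clm_apply contDiffOn_const

theorem norm_iteratedFDeriv_dd_le {m : ℕ} {f : EuclideanSpace ℝ (Fin n) → ℝ}
    {x : EuclideanSpace ℝ (Fin n)} (hx : x ∈ ball 0 1)
    (hf : ContDiffOn ℝ (m + 1) f (ball 0 1)) (i : Fin n) :
    ‖iteratedFDeriv ℝ m (dd i f) x‖ ≤ ‖iteratedFDeriv ℝ (m + 1) f x‖ := by
  have h1 : ContDiffAt ℝ m (fderiv ℝ f) x :=
    (hf.fderiv_of_isOpen isOpen_ball le_rfl).contDiffAt (isOpen_ball.mem_nhds hx)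
  have h2 := (ContinuousLinearMap.apply ℝ ℝ (EuclideanSpace.single i (1 : ℝ))
    ).norm_iteratedFDeriv_comp_left h1 le_rfl
  rw [norm_iteratedFDeriv_fderiv] at h2
  refine h2.trans (mul_le_of_le_one_left (norm_nonneg _) ?_)
  refine ContinuousLinearMap.opNorm_le_bound _ zero_le_one fun g => ?_
  have := g.le_opNorm (EuclideanSpace.single i (1 : ℝ))
  simpa using this

theorem dd_comm {f : EuclideanSpace ℝ (Fin n) → ℝ} (hf : ContDiffOn ℝ 2 f (ball 0 1))
    {x : EuclideanSpace ℝ (Fin n)} (hx : x ∈ ball 0 1) (i j : Fin n) :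
    dd i (dd j f) x = dd j (dd i f) x := by
  have hat := hf.contDiffAt (isOpen_ball.mem_nhds hx)
  have h2 : DifferentiableAt ℝ (fderiv ℝ f) x :=
    ((hf.fderiv_of_isOpen (m := 1) isOpen_ball (by norm_num)).contDiffAt
      (isOpen_ball.mem_nhds hx)).differentiableAt one_ne_zero
  have h : ∀ i j, dd i (dd j f) x
      = fderiv ℝ (fderiv ℝ f) x (EuclideanSpace.single i 1) (EuclideanSpace.single j 1) := by
    intro i j
    unfold dd
    rw [fderiv_clm_apply h2 (differentiableAt_const _)]
    simp
  rw [h, h]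
  exact (hat.isSymmSndFDerivAt (by simp)) _ _

/-- The argument `(D²u, Du, u, x)` of `F`. -/
noncomputable def jet (u : EuclideanSpace ℝ (Fin n) → ℝ) (x : EuclideanSpace ℝ (Fin n)) : Jet n :=
  (fun i j => hessM u x i j, fun l => pd u x l, u x, x)

/-- The derivative of the jet of `u` in the direction of the `k`-th basis vector. -/
noncomputable def jetDeriv (u : EuclideanSpace ℝ (Fin n) → ℝ) (k : Fin n)
    (x : EuclideanSpace ℝ (Fin n)) : Jet n :=
  (fun i j => dd k (fun y => hessM u y i j) x, fun l => hessM u x k l, dd k u x,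
    EuclideanSpace.single k 1)

theorem contDiffOn_hessM {u : EuclideanSpace ℝ (Fin n) → ℝ} (hu : ContDiffOn ℝ 3 u (ball 0 1))
    (i j : Fin n) : ContDiffOn ℝ 1 (fun x => hessM u x i j) (ball 0 1) := by
  simp only [hessM_apply]
  exact contDiffOn_dd (m := 1) (contDiffOn_dd (m := 2) hu j) i

theorem isSymm_hessM {u : EuclideanSpace ℝ (Fin n) → ℝ} (hu : ContDiffOn ℝ 3 u (ball 0 1))
    {x : EuclideanSpace ℝ (Fin n)} (hx : x ∈ ball 0 1) : (hessM u x).IsSymm := by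
  ext i j
  rw [Matrix.transpose_apply, hessM_apply, hessM_apply, dd_comm (hu.of_le (by norm_num)) hx]

theorem Filter.EventuallyEq.dd_eq {f g : EuclideanSpace ℝ (Fin n) → ℝ}
    {x : EuclideanSpace ℝ (Fin n)} (h : f =ᶠ[nhds x] g) (k : Fin n) : dd k f x = dd k g x := by
  rw [dd, dd, h.fderiv_eq]

theorem dd_hessM_symm {u : EuclideanSpace ℝ (Fin n) → ℝ} (hu : ContDiffOn ℝ 3 u (ball 0 1))
    {x : EuclideanSpace ℝ (Fin n)} (hx : x ∈ ball 0 1) (k i j : Fin n) :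
    dd k (fun y => hessM u y i j) x = dd k (fun y => hessM u y j i) x := by
  refine Filter.EventuallyEq.dd_eq ?_ k
  filter_upwards [isOpen_ball.mem_nhds hx] with y hy
  exact (isSymm_hessM hu hy).apply j i

theorem dd_hessM_comm {u : EuclideanSpace ℝ (Fin n) → ℝ} (hu : ContDiffOn ℝ 3 u (ball 0 1))
    {x : EuclideanSpace ℝ (Fin n)} (hx : x ∈ ball 0 1) (k i j : Fin n) :
    dd k (fun y => hessM u y i j) x = dd i (fun y => hessM u y k j) x := by
  simp only [hessM_apply]
  exact dd_comm (contDiffOn_dd (m := 2) hu j) hx k i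

theorem contDiffOn_jet {u : EuclideanSpace ℝ (Fin n) → ℝ} (hu : ContDiffOn ℝ 3 u (ball 0 1)) :
    ContDiffOn ℝ 1 (jet u) (ball 0 1) := by
  refine ContDiffOn.prodMk ?_ (ContDiffOn.prodMk ?_ (ContDiffOn.prodMk ?_ contDiffOn_id))
  · exact contDiffOn_pi.2 fun i => contDiffOn_pi.2 fun j => contDiffOn_hessM hu i j
  · refine contDiffOn_pi.2 fun l => ?_
    simp only [pd_eq_dd]
    exact (contDiffOn_dd (m := 2) hu l).of_le (by norm_num)
  · exact hu.of_le (by norm_num)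

theorem fderiv_jet_single {u : EuclideanSpace ℝ (Fin n) → ℝ} (hu : ContDiffOn ℝ 3 u (ball 0 1))
    {x : EuclideanSpace ℝ (Fin n)} (hx : x ∈ ball 0 1) (k : Fin n) :
    fderiv ℝ (jet u) x (EuclideanSpace.single k 1) = jetDeriv u k x := by
  have d1 : ∀ i j, HasFDerivAt (fun y => hessM u y i j)
      (fderiv ℝ (fun y => hessM u y i j) x) x := fun i j =>
    (differentiableAt_of_contDiffOn_ball (contDiffOn_hessM hu i j) hx).hasFDerivAt
  have d2 : ∀ l : Fin n, HasFDerivAt (fun y => pd u y l) (fderiv ℝ (dd l u) x) x := by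
    intro l
    simp only [pd_eq_dd]
    exact (differentiableAt_of_contDiffOn_ball
      ((contDiffOn_dd (m := 2) hu l).of_le (by norm_num)) hx).hasFDerivAt
  have d3 : HasFDerivAt u (fderiv ℝ u x) x :=
    (differentiableAt_of_contDiffOn_ball (hu.of_le (by norm_num)) hx).hasFDerivAt
  have h : HasFDerivAt (jet u) _ x :=
    (hasFDerivAt_pi.2 fun i => hasFDerivAt_pi.2 fun j => d1 i j).prodMk
      ((hasFDerivAt_pi.2 d2).prodMk (d3.prodMk (hasFDerivAt_id x)))
  rw [h.fderiv]
  refine Prod.ext ?_ (Prod.ext ?_ rfl)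
  · ext i j; rfl
  · ext l
    simp only [jetDeriv, hessM_apply]
    rfl

theorem dd_comp_jet {u : EuclideanSpace ℝ (Fin n) → ℝ} (hu : ContDiffOn ℝ 3 u (ball 0 1))
    {x : EuclideanSpace ℝ (Fin n)} (hx : x ∈ ball 0 1) {G : Jet n → ℝ}
    (hG : DifferentiableAt ℝ G (jet u x)) (k : Fin n) :
    dd k (fun y => G (jet u y)) x = fderiv ℝ G (jet u x) (jetDeriv u k x) := by
  have hj := (contDiffOn_jet hu).differentiableOn one_ne_zero |>.differentiableAt
    (isOpen_ball.mem_nhds hx)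
  have : fderiv ℝ (fun y => G (jet u y)) x = _ := fderiv_comp x hG hj
  rw [dd, this, ContinuousLinearMap.comp_apply, fderiv_jet_single hu hx]

end Jets

section Linearized

open Matrix

variable {n : ℕ}

/-- The hypotheses on the equation and on the solution. -/
structure IsAdmissible (L K : ℝ) (F : Jet n → ℝ) (u : EuclideanSpace ℝ (Fin n) → ℝ) : Prop where
  contDiffOn_F : ContDiffOn ℝ 2 F (jetDomain n)
  norm_F_le : ∀ z ∈ jetDomain n, ∀ i ≤ 2, ‖iteratedFDeriv ℝ i F z‖ ≤ K
  inverseConvex : InverseConvex F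
  contDiffOn_u : ContDiffOn ℝ 3 u (ball 0 1)
  norm_u_le : ∀ x ∈ ball 0 1, ∀ i ≤ 3, ‖iteratedFDeriv ℝ i u x‖ ≤ K
  equation : ∀ x ∈ ball 0 1, F (jet u x) = 0
  elliptic : ∀ x ∈ ball 0 1, EllipticBound L (symbol F (jet u x))
  posSemidef : ∀ x ∈ ball 0 1, (hessM u x).PosSemidef

namespace IsAdmissible

variable {L K : ℝ} {F : Jet n → ℝ} {u : EuclideanSpace ℝ (Fin n) → ℝ}

theorem jet_mem {x : EuclideanSpace ℝ (Fin n)} (hx : x ∈ ball 0 1) : jet u x ∈ jetDomain n := hx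

theorem contDiffOn_fderiv (h : IsAdmissible L K F u) :
    ContDiffOn ℝ 1 (fderiv ℝ F) (jetDomain n) :=
  h.contDiffOn_F.fderiv_of_isOpen isOpen_jetDomain (by norm_num)

theorem differentiableAt_fderiv (h : IsAdmissible L K F u) {x : EuclideanSpace ℝ (Fin n)}
    (hx : x ∈ ball 0 1) : DifferentiableAt ℝ (fderiv ℝ F) (jet u x) :=
  (h.contDiffOn_fderiv.differentiableOn one_ne_zero).differentiableAt
    (isOpen_jetDomain.mem_nhds (jet_mem hx))

theorem differentiableAt_F (h : IsAdmissible L K F u) {x : EuclideanSpace ℝ (Fin n)}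
    (hx : x ∈ ball 0 1) : DifferentiableAt ℝ F (jet u x) :=
  (h.contDiffOn_F.differentiableOn two_ne_zero).differentiableAt
    (isOpen_jetDomain.mem_nhds (jet_mem hx))

theorem norm_fderiv_le (h : IsAdmissible L K F u) {z : Jet n} (hz : z ∈ jetDomain n) :
    ‖fderiv ℝ F z‖ ≤ K := by
  rw [← norm_iteratedFDeriv_one]; exact h.norm_F_le z hz 1 (by norm_num)

theorem norm_fderiv_fderiv_le (h : IsAdmissible L K F u) {z : Jet n} (hz : z ∈ jetDomain n) :
    ‖fderiv ℝ (fderiv ℝ F) z‖ ≤ K := by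
  rw [← norm_iteratedFDeriv_one, norm_iteratedFDeriv_fderiv]
  exact h.norm_F_le z hz 2 le_rfl

theorem abs_dd_le (h : IsAdmissible L K F u) {x : EuclideanSpace ℝ (Fin n)}
    (hx : x ∈ ball 0 1) (k : Fin n) : |dd k u x| ≤ K := by
  have := norm_iteratedFDeriv_dd_le (m := 0) hx (h.contDiffOn_u.of_le (by norm_num)) k
  rw [norm_iteratedFDeriv_zero] at this
  exact this.trans (h.norm_u_le x hx 1 (by norm_num))

theorem abs_hessM_le (h : IsAdmissible L K F u) {x : EuclideanSpace ℝ (Fin n)}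
    (hx : x ∈ ball 0 1) (i j : Fin n) : |hessM u x i j| ≤ K := by
  have hu2 : ContDiffOn ℝ 2 u (ball 0 1) := h.contDiffOn_u.of_le (by norm_num)
  have h1 := norm_iteratedFDeriv_dd_le (m := 0) hx
    (contDiffOn_dd (m := 1) hu2 j) i
  have h2 := norm_iteratedFDeriv_dd_le (m := 1) hx hu2 j
  rw [norm_iteratedFDeriv_zero] at h1
  rw [hessM_apply]
  exact h1.trans (h2.trans (h.norm_u_le x hx 2 (by norm_num)))

theorem abs_dd_hessM_le (h : IsAdmissible L K F u) {x : EuclideanSpace ℝ (Fin n)}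
    (hx : x ∈ ball 0 1) (k i j : Fin n) : |dd k (fun y => hessM u y i j) x| ≤ K := by
  have hu2 := contDiffOn_dd (m := 2) h.contDiffOn_u j
  have hu1 := contDiffOn_dd (m := 1) hu2 i
  have h1 := norm_iteratedFDeriv_dd_le (m := 0) hx hu1 k
  have h2 := norm_iteratedFDeriv_dd_le (m := 1) hx hu2 i
  have h3 := norm_iteratedFDeriv_dd_le (m := 2) hx h.contDiffOn_u j
  rw [norm_iteratedFDeriv_zero] at h1
  simp only [hessM_apply]
  exact h1.trans (h2.trans (h3.trans (h.norm_u_le x hx 3 le_rfl)))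

theorem norm_jetDeriv_le (h : IsAdmissible L K F u) (hK : 0 ≤ K) {x : EuclideanSpace ℝ (Fin n)}
    (hx : x ∈ ball 0 1) (k : Fin n) : ‖jetDeriv u k x‖ ≤ K + 1 := by
  have hK1 : 0 ≤ K + 1 := by linarith
  simp only [jetDeriv, Prod.norm_def]
  refine max_le ?_ (max_le ?_ (max_le ?_ ?_))
  · refine (pi_norm_le_iff_of_nonneg hK1).2 fun i => (pi_norm_le_iff_of_nonneg hK1).2 fun j => ?_
    exact (h.abs_dd_hessM_le hx k i j).trans (by linarith)
  · exact (pi_norm_le_iff_of_nonneg hK1).2 fun i => (h.abs_hessM_le hx k i).trans (by linarith)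
  · exact (h.abs_dd_le hx k).trans (by linarith)
  · simp [hK]

theorem contDiffOn_fderiv_jet (h : IsAdmissible L K F u) :
    ContDiffOn ℝ 1 (fun x => fderiv ℝ F (jet u x)) (ball 0 1) :=
  h.contDiffOn_fderiv.comp (contDiffOn_jet h.contDiffOn_u) fun _ hx => jet_mem hx

theorem dd_fderiv_jet (h : IsAdmissible L K F u) {x : EuclideanSpace ℝ (Fin n)}
    (hx : x ∈ ball 0 1) (k : Fin n) (w : Jet n) :
    dd k (fun y => fderiv ℝ F (jet u y) w) x
      = fderiv ℝ (fderiv ℝ F) (jet u x) (jetDeriv u k x) w := by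
  have hd := h.differentiableAt_fderiv hx
  rw [dd_comp_jet (G := fun z => fderiv ℝ F z w) h.contDiffOn_u hx
    (hd.clm_apply (differentiableAt_const _)), fderiv_clm_apply hd (differentiableAt_const _)]
  simp

theorem contDiffOn_symbol (h : IsAdmissible L K F u) (a b : Fin n) :
    ContDiffOn ℝ 1 (fun x => symbol F (jet u x) a b) (ball 0 1) := by
  simp only [symbol, of_apply]
  exact ((h.contDiffOn_fderiv_jet.clm_apply contDiffOn_const).add
    (h.contDiffOn_fderiv_jet.clm_apply contDiffOn_const)).div_const _

theorem norm_unitEntry_le (a b : Fin n) : ‖((unitEntry a b, 0, 0, 0) : Jet n)‖ ≤ 1 := by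
  have : ‖unitEntry a b‖ ≤ 1 := by
    refine (pi_norm_le_iff_of_nonneg zero_le_one).2 fun i =>
      (pi_norm_le_iff_of_nonneg zero_le_one).2 fun j => ?_
    unfold unitEntry
    split_ifs <;> simp
  simpa [Prod.norm_def] using this

theorem dd_symbol (h : IsAdmissible L K F u) {x : EuclideanSpace ℝ (Fin n)}
    (hx : x ∈ ball 0 1) (k a b : Fin n) :
    dd k (fun y => symbol F (jet u y) a b) x =
      (fderiv ℝ (fderiv ℝ F) (jet u x) (jetDeriv u k x) (unitEntry a b, 0, 0, 0)
        + fderiv ℝ (fderiv ℝ F) (jet u x) (jetDeriv u k x) (unitEntry b a, 0, 0, 0)) / 2 := by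
  rw [← h.dd_fderiv_jet hx, ← h.dd_fderiv_jet hx]
  have hd : ∀ w, DifferentiableAt ℝ (fun y => fderiv ℝ F (jet u y) w) x := fun w =>
    differentiableAt_of_contDiffOn_ball (h.contDiffOn_fderiv_jet.clm_apply contDiffOn_const) hx
  simp only [symbol, of_apply, dd, div_eq_mul_inv]
  rw [fderiv_mul_const ((hd _).fun_add (hd _)), fderiv_fun_add (hd _) (hd _)]
  simp only [_root_.smul_apply, _root_.add_apply, smul_eq_mul]
  ring

theorem abs_dd_symbol_le (h : IsAdmissible L K F u) (hK : 0 ≤ K) {x : EuclideanSpace ℝ (Fin n)}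
    (hx : x ∈ ball 0 1) (k a b : Fin n) :
    |dd k (fun y => symbol F (jet u y) a b) x| ≤ K * (K + 1) := by
  have hb : ∀ a b, |fderiv ℝ (fderiv ℝ F) (jet u x) (jetDeriv u k x) (unitEntry a b, 0, 0, 0)|
      ≤ K * (K + 1) := by
    intro a b
    calc _ ≤ K * ‖jetDeriv u k x‖ * ‖((unitEntry a b, 0, 0, 0) : Jet n)‖ :=
          abs_bilin_le (h.norm_fderiv_fderiv_le (jet_mem hx)) _ _
      _ ≤ K * (K + 1) * 1 := by
          gcongr
          · exact h.norm_jetDeriv_le hK hx k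
          · exact norm_unitEntry_le a b
      _ = _ := mul_one _
  rw [h.dd_symbol hx, abs_le]
  have h1 := abs_le.1 (hb a b)
  have h2 := abs_le.1 (hb b a)
  constructor <;> linarith

/-- The part of the derivative of the jet not involving third derivatives of `u`. -/
noncomputable def _root_.jetLower (u : EuclideanSpace ℝ (Fin n) → ℝ) (j : Fin n)
    (x : EuclideanSpace ℝ (Fin n)) : Jet n :=
  (0, fun l => hessM u x j l, dd j u x, EuclideanSpace.single j 1)

theorem contDiffOn_jetLower (h : IsAdmissible L K F u) (j : Fin n) :
    ContDiffOn ℝ 1 (jetLower u j) (ball 0 1) := by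
  refine contDiffOn_const.prodMk (ContDiffOn.prodMk ?_ (ContDiffOn.prodMk ?_ contDiffOn_const))
  · exact contDiffOn_pi.2 fun l => contDiffOn_hessM h.contDiffOn_u j l
  · exact (contDiffOn_dd (m := 2) h.contDiffOn_u j).of_le (by norm_num)

theorem dd_fderiv_jetLower (h : IsAdmissible L K F u) {x : EuclideanSpace ℝ (Fin n)}
    (hx : x ∈ ball 0 1) (i j : Fin n) :
    dd i (fun y => fderiv ℝ F (jet u y) (jetLower u j y)) x =
      fderiv ℝ (fderiv ℝ F) (jet u x) (jetDeriv u i x) (jetLower u j x) +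
      fderiv ℝ F (jet u x) (0, fun l => dd i (fun y => hessM u y j l) x, hessM u x i j, 0) := by
  have d1 : DifferentiableAt ℝ (fun y => fderiv ℝ F (jet u y)) x :=
    (h.contDiffOn_fderiv_jet.differentiableOn one_ne_zero).differentiableAt
      (isOpen_ball.mem_nhds hx)
  have e1 : ∀ w, fderiv ℝ (fun y => fderiv ℝ F (jet u y)) x (EuclideanSpace.single i 1) w
      = fderiv ℝ (fderiv ℝ F) (jet u x) (jetDeriv u i x) w := by
    intro w
    rw [← h.dd_fderiv_jet hx, dd, fderiv_clm_apply d1 (differentiableAt_const _)]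
    simp
  have h2 : HasFDerivAt (jetLower u j) _ x :=
    (hasFDerivAt_const _ _).prodMk ((hasFDerivAt_pi.2 fun l =>
      (differentiableAt_of_contDiffOn_ball (contDiffOn_hessM h.contDiffOn_u j l) hx).hasFDerivAt).prodMk
      ((differentiableAt_of_contDiffOn_ball ((contDiffOn_dd (m := 2) h.contDiffOn_u j).of_le
        (by norm_num)) hx).hasFDerivAt.prodMk (hasFDerivAt_const _ _)))
  have e2 : fderiv ℝ (jetLower u j) x (EuclideanSpace.single i 1)
      = (0, fun l => dd i (fun y => hessM u y j l) x, hessM u x i j, 0) := by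
    rw [h2.fderiv]
    refine Prod.ext rfl (Prod.ext ?_ (Prod.ext ?_ rfl))
    · ext l; rfl
    · rw [hessM_apply]; rfl
  rw [dd, fderiv_clm_apply d1 h2.differentiableAt, _root_.add_apply,
    ContinuousLinearMap.comp_apply, ContinuousLinearMap.flip_apply, e1, e2]
  ring

theorem jetDeriv_eq (u : EuclideanSpace ℝ (Fin n) → ℝ) (k : Fin n) (x : EuclideanSpace ℝ (Fin n)) :
    jetDeriv u k x = (fun i j => dd k (fun y => hessM u y i j) x, 0, 0, 0) + jetLower u k x := by
  simp [jetDeriv, jetLower]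

theorem linearized_equation (h : IsAdmissible L K F u) {x : EuclideanSpace ℝ (Fin n)}
    (hx : x ∈ ball 0 1) (j : Fin n) :
    ∑ a, ∑ b, symbol F (jet u x) a b * dd j (fun y => hessM u y a b) x
      = -fderiv ℝ F (jet u x) (jetLower u j x) := by
  have h0 : dd j (fun y => F (jet u y)) x = 0 := by
    rw [Filter.EventuallyEq.dd_eq (g := fun _ => 0) _ j]
    · simp [dd]
    · filter_upwards [isOpen_ball.mem_nhds hx] with y hy
      exact h.equation y hy
  rw [dd_comp_jet h.contDiffOn_u hx (h.differentiableAt_F hx), jetDeriv_eq, map_add] at h0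
  have hT : (Matrix.of fun a b => dd j (fun y => hessM u y a b) x).IsSymm := by
    ext a b
    exact dd_hessM_symm h.contDiffOn_u hx j b a
  have h1 := fderiv_symm_eq_sum F (jet u x) hT
  simp only [of_apply] at h1
  rw [h1] at h0
  linarith

theorem sum_dd_symbol_mul (h : IsAdmissible L K F u) {x : EuclideanSpace ℝ (Fin n)}
    (hx : x ∈ ball 0 1) (i j : Fin n) :
    ∑ a, ∑ b, dd i (fun y => symbol F (jet u y) a b) x * dd j (fun y => hessM u y a b) x
        + dd i (fun y => fderiv ℝ F (jet u y) (jetLower u j y)) x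
      = fderiv ℝ (fderiv ℝ F) (jet u x) (jetDeriv u i x) (jetDeriv u j x)
        + fderiv ℝ F (jet u x) (0, fun l => dd i (fun y => hessM u y j l) x, hessM u x i j, 0) := by
  rw [h.dd_fderiv_jetLower hx, jetDeriv_eq u j, map_add]
  set D := fderiv ℝ (fderiv ℝ F) (jet u x) (jetDeriv u i x)
  have h1 : ∑ a, ∑ b, dd i (fun y => symbol F (jet u y) a b) x * dd j (fun y => hessM u y a b) x
      = D (fun a b => dd j (fun y => hessM u y a b) x, 0, 0, 0) := by
    rw [fderiv_matrix_eq_sum]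
    have e : ∑ a, ∑ b, D (unitEntry b a, 0, 0, 0) * dd j (fun y => hessM u y a b) x
        = ∑ a, ∑ b, D (unitEntry a b, 0, 0, 0) * dd j (fun y => hessM u y a b) x := by
      rw [Finset.sum_comm]
      exact Finset.sum_congr rfl fun a _ => Finset.sum_congr rfl fun b _ => by
        rw [dd_hessM_symm h.contDiffOn_u hx]
    have e2 : ∑ a, ∑ b, dd i (fun y => symbol F (jet u y) a b) x * dd j (fun y => hessM u y a b) x
        = (∑ a, ∑ b, D (unitEntry a b, 0, 0, 0) * dd j (fun y => hessM u y a b) x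
        + ∑ a, ∑ b, D (unitEntry b a, 0, 0, 0) * dd j (fun y => hessM u y a b) x) / 2 := by
      simp only [← Finset.sum_add_distrib, Finset.sum_div]
      exact Finset.sum_congr rfl fun a _ => Finset.sum_congr rfl fun b _ => by
        rw [h.dd_symbol hx]; ring
    rw [e2, e]; ring
  rw [h1]; ring

end IsAdmissible

end Linearized

section Resolvent

open Matrix

variable {n : ℕ}

theorem contDiffOn_det {M : EuclideanSpace ℝ (Fin n) → Matrix (Fin n) (Fin n) ℝ}
    {s : Set (EuclideanSpace ℝ (Fin n))} (hM : ∀ i j, ContDiffOn ℝ 1 (fun x => M x i j) s) :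
    ContDiffOn ℝ 1 (fun x => (M x).det) s := by
  simp only [det_apply]
  refine ContDiffOn.sum fun σ _ => ContDiffOn.const_smul _ (contDiffOn_prod fun i _ => hM _ _)

theorem contDiffOn_inv_apply {M : EuclideanSpace ℝ (Fin n) → Matrix (Fin n) (Fin n) ℝ}
    {s : Set (EuclideanSpace ℝ (Fin n))} (hM : ∀ i j, ContDiffOn ℝ 1 (fun x => M x i j) s)
    (hdet : ∀ x ∈ s, (M x).det ≠ 0) (i j : Fin n) :
    ContDiffOn ℝ 1 (fun x => ((M x)⁻¹ : Matrix _ _ ℝ) i j) s := by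
  simp only [inv_def, Ring.inverse_eq_inv', Matrix.smul_apply, smul_eq_mul, adjugate_apply]
  refine ((contDiffOn_det hM).inv hdet).mul (contDiffOn_det fun k l => ?_)
  by_cases hk : k = j
  · subst hk
    simpa only [updateRow_self] using contDiffOn_const
  · simpa only [updateRow_ne hk] using hM k l

/-- The solution of `(D²u + τ) ζ = e`. -/
noncomputable def resolv (u : EuclideanSpace ℝ (Fin n) → ℝ) (τ : ℝ) (e : Fin n → ℝ)
    (x : EuclideanSpace ℝ (Fin n)) : Fin n → ℝ :=
  (hessM u x + τ • (1 : Matrix (Fin n) (Fin n) ℝ))⁻¹ *ᵥ e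

/-- The function `e · D²u (D²u + τ)⁻¹ e`. -/
noncomputable def smoothedForm (u : EuclideanSpace ℝ (Fin n) → ℝ) (τ : ℝ) (e : Fin n → ℝ)
    (x : EuclideanSpace ℝ (Fin n)) : ℝ :=
  1 - τ * (e ⬝ᵥ resolv u τ e x)

theorem posDef_add_smul_one {A : Matrix (Fin n) (Fin n) ℝ} (hA : A.PosSemidef) {τ : ℝ}
    (hτ : 0 < τ) : (A + τ • (1 : Matrix (Fin n) (Fin n) ℝ)).PosDef :=
  PosDef.posSemidef_add hA (PosDef.one.smul hτ)

theorem mulVec_resolv {u : EuclideanSpace ℝ (Fin n) → ℝ} {x : EuclideanSpace ℝ (Fin n)}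
    (hA : (hessM u x).PosSemidef) {τ : ℝ} (hτ : 0 < τ) (e : Fin n → ℝ) :
    hessM u x *ᵥ resolv u τ e x + τ • resolv u τ e x = e := by
  have hdet := (posDef_add_smul_one hA hτ).det_pos.ne'.isUnit
  have : (hessM u x + τ • (1 : Matrix (Fin n) (Fin n) ℝ)) *ᵥ resolv u τ e x = e := by
    rw [resolv, mulVec_mulVec, mul_nonsing_inv _ hdet, one_mulVec]
  rwa [add_mulVec, smul_mulVec, one_mulVec] at this

theorem dotProduct_self_eq_resolv {u : EuclideanSpace ℝ (Fin n) → ℝ}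
    {x : EuclideanSpace ℝ (Fin n)}
    (hA : (hessM u x).PosSemidef) {τ : ℝ} (hτ : 0 < τ) (e : Fin n → ℝ) :
    e ⬝ᵥ e = (hessM u x *ᵥ resolv u τ e x) ⬝ᵥ (hessM u x *ᵥ resolv u τ e x)
      + 2 * τ * (resolv u τ e x ⬝ᵥ hessM u x *ᵥ resolv u τ e x)
      + τ ^ 2 * (resolv u τ e x ⬝ᵥ resolv u τ e x) := by
  conv_lhs => rw [← mulVec_resolv hA hτ e]
  simp only [dotProduct_add, add_dotProduct, dotProduct_smul, smul_dotProduct, smul_eq_mul]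
  rw [dotProduct_comm (hessM u x *ᵥ resolv u τ e x) (resolv u τ e x)]
  ring

theorem resolv_form_nonneg {u : EuclideanSpace ℝ (Fin n) → ℝ} {x : EuclideanSpace ℝ (Fin n)}
    (hA : (hessM u x).PosSemidef) (ξ : Fin n → ℝ) : 0 ≤ ξ ⬝ᵥ hessM u x *ᵥ ξ := by
  simpa using hA.dotProduct_mulVec_nonneg ξ

theorem smoothedForm_eq {u : EuclideanSpace ℝ (Fin n) → ℝ} {x : EuclideanSpace ℝ (Fin n)}
    (hA : (hessM u x).PosSemidef) {τ : ℝ} (hτ : 0 < τ) {e : Fin n → ℝ} (he : e ⬝ᵥ e = 1) :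
    smoothedForm u τ e x = (hessM u x *ᵥ resolv u τ e x) ⬝ᵥ (hessM u x *ᵥ resolv u τ e x)
      + τ * (resolv u τ e x ⬝ᵥ hessM u x *ᵥ resolv u τ e x) := by
  have h1 := dotProduct_self_eq_resolv hA hτ e
  have h2 : e ⬝ᵥ resolv u τ e x = resolv u τ e x ⬝ᵥ hessM u x *ᵥ resolv u τ e x
      + τ * (resolv u τ e x ⬝ᵥ resolv u τ e x) := by
    conv_lhs => rw [← mulVec_resolv hA hτ e]
    rw [add_dotProduct, smul_dotProduct, smul_eq_mul,
      dotProduct_comm (hessM u x *ᵥ resolv u τ e x)]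
    simp only [mulVec_resolv hA hτ e]
  rw [smoothedForm, h2, ← he, h1]
  ring

theorem smoothedForm_mem {u : EuclideanSpace ℝ (Fin n) → ℝ} {x : EuclideanSpace ℝ (Fin n)}
    (hA : (hessM u x).PosSemidef) {τ : ℝ} (hτ : 0 < τ) {e : Fin n → ℝ} (he : e ⬝ᵥ e = 1) :
    0 ≤ smoothedForm u τ e x ∧ smoothedForm u τ e x ≤ 1 := by
  have h1 := dotProduct_self_eq_resolv hA hτ e
  rw [smoothedForm_eq hA hτ he]
  rw [he] at h1
  have hp := resolv_form_nonneg hA (resolv u τ e x)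
  have hq : ∀ ξ : Fin n → ℝ, 0 ≤ ξ ⬝ᵥ ξ := fun ξ => by
    simpa using dotProduct_star_self_nonneg ξ
  have h2 := hq (hessM u x *ᵥ resolv u τ e x)
  have h3 := mul_nonneg (sq_nonneg τ) (hq (resolv u τ e x))
  have h4 := mul_nonneg hτ.le hp
  constructor <;> linarith

theorem contDiffOn_resolv {u : EuclideanSpace ℝ (Fin n) → ℝ}
    (hu : ContDiffOn ℝ 3 u (ball 0 1)) (hA : ∀ x ∈ ball 0 1, (hessM u x).PosSemidef)
    {τ : ℝ} (hτ : 0 < τ) (e : Fin n → ℝ) (i : Fin n) :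
    ContDiffOn ℝ 1 (fun x => resolv u τ e x i) (ball 0 1) := by
  simp only [resolv, mulVec, dotProduct]
  refine ContDiffOn.sum fun j _ => ContDiffOn.mul (contDiffOn_inv_apply (fun k l => ?_)
    (fun x hx => (posDef_add_smul_one (hA x hx) hτ).det_pos.ne') i j) contDiffOn_const
  simp only [Matrix.add_apply]
  exact (contDiffOn_hessM hu k l).add contDiffOn_const

theorem contDiffOn_smoothedForm {u : EuclideanSpace ℝ (Fin n) → ℝ}
    (hu : ContDiffOn ℝ 3 u (ball 0 1)) (hA : ∀ x ∈ ball 0 1, (hessM u x).PosSemidef)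
    {τ : ℝ} (hτ : 0 < τ) (e : Fin n → ℝ) :
    ContDiffOn ℝ 1 (smoothedForm u τ e) (ball 0 1) := by
  refine contDiffOn_const.sub (contDiffOn_const.mul ?_)
  exact ContDiffOn.sum fun j _ => contDiffOn_const.mul (contDiffOn_resolv hu hA hτ e j)

theorem dd_sum {ι : Type*} (s : Finset ι) {f : ι → EuclideanSpace ℝ (Fin n) → ℝ}
    {x : EuclideanSpace ℝ (Fin n)} (hf : ∀ i ∈ s, DifferentiableAt ℝ (f i) x) (k : Fin n) :
    dd k (fun y => ∑ i ∈ s, f i y) x = ∑ i ∈ s, dd k (f i) x := by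
  rw [dd, fderiv_fun_sum hf]
  simp [dd]

/-- The matrix of derivatives `∂_k A`. -/
noncomputable def hessDeriv (u : EuclideanSpace ℝ (Fin n) → ℝ) (k : Fin n)
    (x : EuclideanSpace ℝ (Fin n)) : Matrix (Fin n) (Fin n) ℝ :=
  of fun i j => dd k (fun y => hessM u y i j) x

theorem dd_resolv {u : EuclideanSpace ℝ (Fin n) → ℝ}
    (hu : ContDiffOn ℝ 3 u (ball 0 1)) (hA : ∀ x ∈ ball 0 1, (hessM u x).PosSemidef)
    {τ : ℝ} (hτ : 0 < τ) (e : Fin n → ℝ) {x : EuclideanSpace ℝ (Fin n)} (hx : x ∈ ball 0 1)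
    (k : Fin n) :
    (fun i => dd k (fun y => resolv u τ e y i) x)
      = -((hessM u x + τ • (1 : Matrix (Fin n) (Fin n) ℝ))⁻¹ *ᵥ
          (hessDeriv u k x *ᵥ resolv u τ e x)) := by
  have hζ : ∀ i, DifferentiableAt ℝ (fun y => resolv u τ e y i) x := fun i =>
    differentiableAt_of_contDiffOn_ball (contDiffOn_resolv hu hA hτ e i) hx
  have hAd : ∀ i j, DifferentiableAt ℝ (fun y => hessM u y i j) x := fun i j =>
    differentiableAt_of_contDiffOn_ball (contDiffOn_hessM hu i j) hx
  have h1 : ∀ i, dd k (fun y => ∑ j, hessM u y i j * resolv u τ e y j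
      + τ * resolv u τ e y i) x = 0 := by
    intro i
    rw [Filter.EventuallyEq.dd_eq (g := fun _ => e i) _ k]
    · simp [dd]
    · filter_upwards [isOpen_ball.mem_nhds hx] with y hy
      have := congrFun (mulVec_resolv (hA y hy) hτ e) i
      simpa [mulVec, dotProduct] using this
  have h2 : hessDeriv u k x *ᵥ resolv u τ e x
      + (hessM u x + τ • (1 : Matrix (Fin n) (Fin n) ℝ)) *ᵥ
        (fun i => dd k (fun y => resolv u τ e y i) x) = 0 := by
    ext i
    have h3 := h1 i
    have hd1 : DifferentiableAt ℝ (fun y => ∑ j, hessM u y i j * resolv u τ e y j) x :=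
      DifferentiableAt.fun_sum fun j _ => (hAd i j).mul (hζ j)
    have : dd k (fun y => ∑ j, hessM u y i j * resolv u τ e y j + τ * resolv u τ e y i) x
        = dd k (fun y => ∑ j, hessM u y i j * resolv u τ e y j) x
          + τ * dd k (fun y => resolv u τ e y i) x := by
      simp only [dd]
      rw [fderiv_fun_add hd1 ((hζ i).const_mul τ), fderiv_const_mul (hζ i)]
      simp
    rw [this, dd_sum (f := fun j y => hessM u y i j * resolv u τ e y j) _
      fun j _ => (hAd i j).fun_mul (hζ j)] at h3
    simp only [fun j => dd_mul (hAd i j) (hζ j) k, Finset.sum_add_distrib] at h3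
    rw [add_mulVec, smul_mulVec, one_mulVec]
    simp only [Pi.add_apply, Pi.smul_apply, mulVec, dotProduct, hessDeriv, of_apply, smul_eq_mul,
      Pi.zero_apply]
    linarith
  have hdet := (posDef_add_smul_one (hA x hx) hτ).det_pos.ne'.isUnit
  have h4 := congrArg (fun v => (hessM u x + τ • (1 : Matrix (Fin n) (Fin n) ℝ))⁻¹ *ᵥ v) h2
  simp only [mulVec_add, mulVec_mulVec, nonsing_inv_mul _ hdet, one_mulVec, mulVec_zero] at h4
  rw [mulVec_mulVec]
  exact eq_neg_of_add_eq_zero_right h4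

theorem dd_smoothedForm {u : EuclideanSpace ℝ (Fin n) → ℝ}
    (hu : ContDiffOn ℝ 3 u (ball 0 1)) (hA : ∀ x ∈ ball 0 1, (hessM u x).PosSemidef)
    {τ : ℝ} (hτ : 0 < τ) (e : Fin n → ℝ) {x : EuclideanSpace ℝ (Fin n)} (hx : x ∈ ball 0 1)
    (k : Fin n) :
    dd k (smoothedForm u τ e) x
      = τ * (resolv u τ e x ⬝ᵥ hessDeriv u k x *ᵥ resolv u τ e x) := by
  have hζ : ∀ i, DifferentiableAt ℝ (fun y => resolv u τ e y i) x := fun i =>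
    differentiableAt_of_contDiffOn_ball (contDiffOn_resolv hu hA hτ e i) hx
  have h1 : dd k (smoothedForm u τ e) x
      = -(τ * ∑ i, e i * dd k (fun y => resolv u τ e y i) x) := by
    have hs : DifferentiableAt ℝ (fun y => ∑ i, e i * resolv u τ e y i) x :=
      DifferentiableAt.fun_sum fun i _ => (hζ i).const_mul _
    have h2 := dd_sum (Finset.univ) (fun i _ => (hζ i).const_mul (e i)) k
    have h3 : ∀ i, dd k (fun y => e i * resolv u τ e y i) x
        = e i * dd k (fun y => resolv u τ e y i) x := by
      intro i
      simp only [dd]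
      rw [fderiv_const_mul (hζ i)]; simp
    simp only [h3] at h2
    rw [← h2]
    unfold smoothedForm dd
    simp only [dotProduct]
    rw [fderiv_const_sub, fderiv_const_mul hs]
    simp
  have h2 := dd_resolv hu hA hτ e hx k
  have hM : ((hessM u x + τ • (1 : Matrix (Fin n) (Fin n) ℝ))⁻¹).IsSymm :=
    isSymm_inv ((isSymm_hessM hu hx).add (isSymm_one.smul τ))
  have h3 : ∑ i, e i * dd k (fun y => resolv u τ e y i) x
      = -(resolv u τ e x ⬝ᵥ hessDeriv u k x *ᵥ resolv u τ e x) := by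
    change e ⬝ᵥ (fun i => dd k (fun y => resolv u τ e y i) x) = _
    rw [h2, dotProduct_neg, dotProduct_mulVec, ← mulVec_transpose, hM.eq]
    rfl
  rw [h1, h3]; ring

end Resolvent

section WeakInequality

open Matrix

variable {n : ℕ}

/-- The matrix `(∂_a A ζ)_i`, where `ζ` solves `(A + τ) ζ = e`. -/
noncomputable def hessTwist (u : EuclideanSpace ℝ (Fin n) → ℝ) (ζ : Fin n → ℝ)
    (x : EuclideanSpace ℝ (Fin n)) : Matrix (Fin n) (Fin n) ℝ :=
  of fun a i => (hessDeriv u a x *ᵥ ζ) i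

theorem hessDeriv_symm {u : EuclideanSpace ℝ (Fin n) → ℝ} (hu : ContDiffOn ℝ 3 u (ball 0 1))
    {x : EuclideanSpace ℝ (Fin n)} (hx : x ∈ ball 0 1) (k i j : Fin n) :
    hessDeriv u k x i j = hessDeriv u k x j i :=
  dd_hessM_symm hu hx k i j

theorem hessDeriv_comm {u : EuclideanSpace ℝ (Fin n) → ℝ} (hu : ContDiffOn ℝ 3 u (ball 0 1))
    {x : EuclideanSpace ℝ (Fin n)} (hx : x ∈ ball 0 1) (k i j : Fin n) :
    hessDeriv u k x i j = hessDeriv u i x k j :=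
  dd_hessM_comm hu hx k i j

theorem isSymm_hessTwist {u : EuclideanSpace ℝ (Fin n) → ℝ} (hu : ContDiffOn ℝ 3 u (ball 0 1))
    {x : EuclideanSpace ℝ (Fin n)} (hx : x ∈ ball 0 1) (ζ : Fin n → ℝ) :
    (hessTwist u ζ x).IsSymm := by
  ext a b
  simp only [transpose_apply, hessTwist, of_apply, mulVec, dotProduct]
  exact Finset.sum_congr rfl fun j _ => by rw [hessDeriv_comm hu hx]

theorem sum_smul_jetDeriv {u : EuclideanSpace ℝ (Fin n) → ℝ} (hu : ContDiffOn ℝ 3 u (ball 0 1))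
    {x : EuclideanSpace ℝ (Fin n)} (hx : x ∈ ball 0 1) (ζ : Fin n → ℝ) :
    ∑ k, ζ k • jetDeriv u k x = ((fun i j => hessTwist u ζ x i j, fun l => (hessM u x *ᵥ ζ) l,
      ∑ k, ζ k * dd k u x, WithLp.toLp 2 ζ) : Jet n) := by
  refine Prod.ext ?_ (Prod.ext ?_ (Prod.ext ?_ ?_))
  · ext i j
    simp only [Prod.fst_sum, Prod.smul_fst, Finset.sum_apply, Pi.smul_apply, smul_eq_mul,
      jetDeriv, hessTwist, of_apply, mulVec, dotProduct]
    refine Finset.sum_congr rfl fun k _ => ?_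
    have : hessDeriv u i x j k = hessDeriv u k x i j := by
      rw [hessDeriv_symm hu hx i j k, hessDeriv_comm hu hx i k j]
    rw [this, mul_comm]
    rfl
  · ext l
    simp only [Prod.snd_sum, Prod.fst_sum, Prod.smul_snd, Prod.smul_fst, Finset.sum_apply,
      Pi.smul_apply, smul_eq_mul, jetDeriv, mulVec, dotProduct]
    refine Finset.sum_congr rfl fun k _ => ?_
    rw [(isSymm_hessM hu hx).apply, mul_comm]
  · simp only [Prod.snd_sum, Prod.fst_sum, Prod.smul_snd, Prod.smul_fst, smul_eq_mul, jetDeriv]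
  · simp only [Prod.snd_sum, Prod.smul_snd, jetDeriv]
    ext i
    simp [Finset.sum_apply, Pi.single_apply]

theorem sum_sum_mul_bilin {E : Type*} [NormedAddCommGroup E] [NormedSpace ℝ E]
    (D : E →L[ℝ] E →L[ℝ] ℝ) (ζ : Fin n → ℝ) (w : Fin n → E) :
    ∑ i, ∑ j, ζ i * ζ j * D (w i) (w j) = D (∑ i, ζ i • w i) (∑ j, ζ j • w j) := by
  rw [map_sum D, _root_.sum_apply]
  refine Finset.sum_congr rfl fun i _ => ?_
  rw [map_sum]
  refine Finset.sum_congr rfl fun j _ => ?_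
  rw [map_smul, map_smul, _root_.smul_apply, smul_eq_mul, smul_eq_mul]
  ring

theorem sum_sum_smul_third {u : EuclideanSpace ℝ (Fin n) → ℝ} (hu : ContDiffOn ℝ 3 u (ball 0 1))
    {x : EuclideanSpace ℝ (Fin n)} (hx : x ∈ ball 0 1) (ζ : Fin n → ℝ) (G : Jet n →L[ℝ] ℝ) :
    ∑ i, ∑ j, ζ i * ζ j * G (0, fun l => dd i (fun y => hessM u y j l) x, hessM u x i j, 0)
      = G (0, fun l => ζ ⬝ᵥ hessDeriv u l x *ᵥ ζ, ζ ⬝ᵥ hessM u x *ᵥ ζ, 0) := by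
  have h : ((0, fun l => ζ ⬝ᵥ hessDeriv u l x *ᵥ ζ, ζ ⬝ᵥ hessM u x *ᵥ ζ, 0) : Jet n)
      = ∑ i, ∑ j, (ζ i * ζ j) •
        ((0, fun l => dd i (fun y => hessM u y j l) x, hessM u x i j, 0) : Jet n) := by
    refine Prod.ext ?_ (Prod.ext ?_ (Prod.ext ?_ ?_))
    · simp [Prod.fst_sum]
    · ext l
      simp only [Prod.snd_sum, Prod.fst_sum, Prod.smul_snd, Prod.smul_fst, Finset.sum_apply,
        Pi.smul_apply, smul_eq_mul, mulVec, dotProduct, Finset.mul_sum]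
      refine Finset.sum_congr rfl fun i _ => Finset.sum_congr rfl fun j _ => ?_
      rw [hessDeriv_comm hu hx, hessDeriv_symm hu hx]
      simp only [hessDeriv, of_apply]
      ring
    · simp only [Prod.snd_sum, Prod.fst_sum, Prod.smul_snd, Prod.smul_fst, smul_eq_mul, mulVec,
        dotProduct, Finset.mul_sum]
      exact Finset.sum_congr rfl fun i _ => Finset.sum_congr rfl fun j _ => by ring
    · simp [Prod.snd_sum]
  rw [h]
  simp only [map_sum, map_smul, smul_eq_mul]

/-- The constant in the differential inequality for `smoothedForm`. -/
noncomputable def weakConst (n : ℕ) (L K τmax : ℝ) : ℝ :=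
  (K * (2 + (2 * L) ^ 2 * n)) ^ 2 * (2 * L) ^ 3 / 4 * (n * (K + 1)) ^ 2
    + 2 * K * (n * (K + 1)) + K * τmax + K + n * (K * (K + 1))

set_option maxHeartbeats 1000000 in
theorem IsAdmissible.pointwise_lower_bound {L K τmax τ : ℝ} {F : Jet n → ℝ}
    {u : EuclideanSpace ℝ (Fin n) → ℝ} (h : IsAdmissible L K F u) (hL : 0 < L) (hK : 0 ≤ K)
    (hτ : 0 < τ) (hτm : τ ≤ τmax) {e : Fin n → ℝ} (he : e ⬝ᵥ e = 1)
    {x : EuclideanSpace ℝ (Fin n)} (hx : x ∈ ball 0 1) :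
    -(weakConst n L K τmax * (1 + ∑ b, |dd b (smoothedForm u τ e) x|)) ≤
      τ * (∑ i, ∑ j, resolv u τ e x i * resolv u τ e x j *
        (∑ a, ∑ b, dd i (fun y => symbol F (jet u y) a b) x * dd j (fun y => hessM u y a b) x
          + dd i (fun y => fderiv ℝ F (jet u y) (jetLower u j y)) x)
      + 2 * (symbol F (jet u x) * (hessTwist u (resolv u τ e x) x *
          (hessM u x + τ • (1 : Matrix (Fin n) (Fin n) ℝ))⁻¹ *
            hessTwist u (resolv u τ e x) x)).trace)
      - ∑ a, ∑ b, dd a (fun y => symbol F (jet u y) a b) x * dd b (smoothedForm u τ e) x := by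
  have hu := h.contDiffOn_u
  have hA := h.posSemidef x hx
  have hM : ((hessM u x + τ • (1 : Matrix (Fin n) (Fin n) ℝ))⁻¹).IsSymm :=
    isSymm_inv ((isSymm_hessM hu hx).add (isSymm_one.smul τ))
  set ζ := resolv u τ e x with hζ
  set V := hessTwist u ζ x with hV
  have hVs : V.IsSymm := isSymm_hessTwist hu hx ζ
  have hdd : ∀ b, dd b (smoothedForm u τ e) x = τ * (ζ ⬝ᵥ hessDeriv u b x *ᵥ ζ) := fun b =>
    dd_smoothedForm hu h.posSemidef hτ e hx b
  set sd := ∑ b, |dd b (smoothedForm u τ e) x| with hsd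
  have hsd0 : 0 ≤ sd := Finset.sum_nonneg fun _ _ => abs_nonneg _
  -- the bounds on `ζ`
  have hid := dotProduct_self_eq_resolv hA hτ e
  rw [he, ← hζ] at hid
  have hq : ∀ ξ : Fin n → ℝ, 0 ≤ ξ ⬝ᵥ ξ := fun ξ => by
    simpa using dotProduct_star_self_nonneg ξ
  have hform := resolv_form_nonneg hA ζ
  have hsq : ∀ (ξ : Fin n → ℝ) i, ξ i ^ 2 ≤ ξ ⬝ᵥ ξ := fun ξ i => by
    simp only [dotProduct, ← sq]
    exact Finset.single_le_sum (f := fun i => ξ i ^ 2) (fun _ _ => sq_nonneg _) (Finset.mem_univ i)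
  have p1 := hq (hessM u x *ᵥ ζ)
  have p2 := mul_nonneg (sq_nonneg τ) (hq ζ)
  have p3 := mul_nonneg hτ.le hform
  have hζi : ∀ i, τ * |ζ i| ≤ 1 := fun i => by
    have : (τ * |ζ i|) ^ 2 ≤ 1 := by
      rw [mul_pow, sq_abs]
      have := mul_le_mul_of_nonneg_left (hsq ζ i) (sq_nonneg τ)
      linarith
    exact (sq_le_one_iff₀ (by positivity)).1 this
  have hAζ : ∀ i, |(hessM u x *ᵥ ζ) i| ≤ 1 := fun i => by
    rw [← sq_le_one_iff_abs_le_one]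
    have := hsq (hessM u x *ᵥ ζ) i
    linarith
  -- the two parts of the derivative of the jet
  set D := fderiv ℝ (fderiv ℝ F) (jet u x) with hD
  set W : Jet n := (fun i j => V i j, 0, ∑ k, ζ k * dd k u x, WithLp.toLp 2 ζ) with hW
  set P : Jet n := (0, fun l => (hessM u x *ᵥ ζ) l, 0, 0) with hP
  have hWP : ∑ k, ζ k • jetDeriv u k x = W + P := by
    rw [sum_smul_jetDeriv hu hx]; simp [hW, hP, hV]
  have hP1 : ‖P‖ ≤ 1 := by
    have : ‖(fun l => (hessM u x *ᵥ ζ) l : Fin n → ℝ)‖ ≤ 1 :=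
      (pi_norm_le_iff_of_nonneg zero_le_one).2 hAζ
    simpa [hP, Prod.norm_def] using this
  have hWle : ‖W‖ ≤ ‖W + P‖ := by
    rw [hW, hP]
    simp only [Prod.norm_def, Prod.mk_add_mk, add_zero, zero_add, norm_zero]
    gcongr
    exact norm_nonneg _
  have hτW : τ * ‖W‖ ≤ n * (K + 1) := by
    calc τ * ‖W‖ ≤ τ * ∑ k, ‖ζ k • jetDeriv u k x‖ := by
          gcongr
          exact hWle.trans (hWP ▸ norm_sum_le _ _)
      _ = ∑ k, (τ * |ζ k|) * ‖jetDeriv u k x‖ := by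
          rw [Finset.mul_sum]
          exact Finset.sum_congr rfl fun k _ => by rw [norm_smul, Real.norm_eq_abs]; ring
      _ ≤ ∑ _k : Fin n, 1 * (K + 1) := by
          gcongr with k
          · exact hζi k
          · exact h.norm_jetDeriv_le hK hx k
      _ = _ := by simp; ring
  have hDn : ‖D‖ ≤ K := h.norm_fderiv_fderiv_le (IsAdmissible.jet_mem hx)
  -- the structure condition
  have key := lower_bound_posSemidef h.contDiffOn_F h.inverseConvex hL hK hτ
    (fun z hz => h.norm_fderiv_fderiv_le hz) hA hx (h.elliptic x hx) hVs
    (∑ k, ζ k * dd k u x) (WithLp.toLp 2 ζ)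
  rw [fderiv_symm_eq_trace F _ (isSymm_mul_mul hVs hM)] at key
  change _ ≤ D W W + 2 * (symbol F (jet u x) * _).trace at key
  -- the remaining terms
  have e1 : ∑ i, ∑ j, ζ i * ζ j *
        (∑ a, ∑ b, dd i (fun y => symbol F (jet u y) a b) x * dd j (fun y => hessM u y a b) x
          + dd i (fun y => fderiv ℝ F (jet u y) (jetLower u j y)) x)
      = D (W + P) (W + P) + fderiv ℝ F (jet u x)
          (0, fun l => ζ ⬝ᵥ hessDeriv u l x *ᵥ ζ, ζ ⬝ᵥ hessM u x *ᵥ ζ, 0) := by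
    simp only [h.sum_dd_symbol_mul hx, mul_add, Finset.sum_add_distrib]
    rw [sum_sum_mul_bilin, hWP, sum_sum_smul_third hu hx]
  have e2 : -(K * (sd + 1)) ≤ τ * fderiv ℝ F (jet u x)
          (0, fun l => ζ ⬝ᵥ hessDeriv u l x *ᵥ ζ, ζ ⬝ᵥ hessM u x *ᵥ ζ, 0) := by
    set Y : Jet n := (0, fun l => ζ ⬝ᵥ hessDeriv u l x *ᵥ ζ, ζ ⬝ᵥ hessM u x *ᵥ ζ, 0) with hY
    have hYn : ‖τ • Y‖ ≤ sd + 1 := by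
      have : τ • Y = (0, fun l => dd l (smoothedForm u τ e) x, τ * (ζ ⬝ᵥ hessM u x *ᵥ ζ), 0) := by
        simp [hY, hdd, Pi.smul_def]
      rw [this]
      simp only [Prod.norm_def, norm_zero]
      refine max_le (by positivity) (max_le ?_ (max_le ?_ (by positivity)))
      · refine (pi_norm_le_iff_of_nonneg (by positivity)).2 fun b => ?_
        have := Finset.single_le_sum (f := fun b => |dd b (smoothedForm u τ e) x|)
          (fun _ _ => abs_nonneg _) (Finset.mem_univ b)
        rw [Real.norm_eq_abs]
        linarith
      · rw [Real.norm_eq_abs, abs_of_nonneg p3]; linarith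
    have h1 := (fderiv ℝ F (jet u x)).le_opNorm (τ • Y)
    rw [map_smul, smul_eq_mul, Real.norm_eq_abs] at h1
    have h2 : ‖fderiv ℝ F (jet u x)‖ * ‖τ • Y‖ ≤ K * (sd + 1) := by
      gcongr
      exact h.norm_fderiv_le (IsAdmissible.jet_mem hx)
    exact (abs_le.1 (h1.trans h2)).1
  have e3 : ∑ a, ∑ b, dd a (fun y => symbol F (jet u y) a b) x * dd b (smoothedForm u τ e) x
      ≤ n * (K * (K + 1)) * sd := by
    calc _ ≤ ∑ _a : Fin n, ∑ b, (K * (K + 1)) * |dd b (smoothedForm u τ e) x| := by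
          refine Finset.sum_le_sum fun a _ => Finset.sum_le_sum fun b _ => ?_
          refine (le_abs_self _).trans ?_
          rw [abs_mul]
          gcongr
          exact h.abs_dd_symbol_le hK hx a a b
      _ = _ := by simp [← Finset.mul_sum, hsd]; ring
  rw [e1]
  have b1 := (abs_le.1 (abs_bilin_le hDn W P)).1
  have b2 := (abs_le.1 (abs_bilin_le hDn P W)).1
  have b3 := (abs_le.1 (abs_bilin_le hDn P P)).1
  have hexp : D (W + P) (W + P) = D W W + D W P + D P W + D P P := by
    simp only [map_add, _root_.add_apply]; ring
  have hW0 := norm_nonneg W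
  have hP0 := norm_nonneg P
  have c1 : τ * (K * ‖W‖ * ‖P‖) ≤ K * (n * (K + 1)) := by
    calc τ * (K * ‖W‖ * ‖P‖) = K * (τ * ‖W‖) * ‖P‖ := by ring
      _ ≤ K * (n * (K + 1)) * 1 := by gcongr
      _ = _ := mul_one _
  have c2 : τ * (K * ‖P‖ * ‖P‖) ≤ K * τmax := by
    calc τ * (K * ‖P‖ * ‖P‖) ≤ τmax * (K * 1 * 1) := by
          have := hτ.le.trans hτm
          gcongr
      _ = _ := by ring
  set C1 := (K * (2 + (2 * L) ^ 2 * n)) ^ 2 * (2 * L) ^ 3 / 4 with hC1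
  have hC10 : 0 ≤ C1 := by positivity
  have c3 : τ * (C1 * τ * ‖W‖ ^ 2) ≤ C1 * (n * (K + 1)) ^ 2 := by
    calc τ * (C1 * τ * ‖W‖ ^ 2) = C1 * (τ * ‖W‖) ^ 2 := by ring
      _ ≤ _ := by gcongr
  have m1 := mul_le_mul_of_nonneg_left key hτ.le
  have m2 := mul_le_mul_of_nonneg_left b1 hτ.le
  have m3 := mul_le_mul_of_nonneg_left b2 hτ.le
  have m4 := mul_le_mul_of_nonneg_left b3 hτ.le
  have c4 : 0 ≤ (C1 * (n * (K + 1)) ^ 2 + 2 * K * (n * (K + 1)) + K * τmax) * sd := by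
    have := hτ.le.trans hτm
    positivity
  have c5 : 0 ≤ (n : ℝ) * (K * (K + 1)) := by positivity
  rw [hexp]
  unfold weakConst
  rw [← hC1]
  have c1' : τ * (K * ‖P‖ * ‖W‖) ≤ K * (n * (K + 1)) := by rw [mul_right_comm K]; exact c1
  linarith
end WeakInequality

section WeakInequalityIntegral

open Matrix

variable {n : ℕ}

theorem hessTwist_mul_inv_mul_apply {u : EuclideanSpace ℝ (Fin n) → ℝ}
    (hu : ContDiffOn ℝ 3 u (ball 0 1)) {x : EuclideanSpace ℝ (Fin n)} (hx : x ∈ ball 0 1)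
    (ζ : Fin n → ℝ) (M : Matrix (Fin n) (Fin n) ℝ) (hM : M.IsSymm) (a b : Fin n) :
    (hessTwist u ζ x * M * hessTwist u ζ x) a b
      = (M *ᵥ (hessDeriv u a x *ᵥ ζ)) ⬝ᵥ (hessDeriv u b x *ᵥ ζ) := by
  have hV := isSymm_hessTwist hu hx ζ
  have h1 : ∀ j, hessTwist u ζ x j b = (hessDeriv u b x *ᵥ ζ) j := fun j => by
    rw [← hV.apply]; rfl
  rw [Matrix.mul_apply, dotProduct]
  refine Finset.sum_congr rfl fun j _ => ?_
  rw [h1, Matrix.mul_apply, mulVec, dotProduct]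
  congr 1
  refine Finset.sum_congr rfl fun i _ => ?_
  rw [hM.apply, mul_comm]
  rfl

theorem sum_dd_mul_resolv {u : EuclideanSpace ℝ (Fin n) → ℝ}
    (hu : ContDiffOn ℝ 3 u (ball 0 1)) (hA : ∀ x ∈ ball 0 1, (hessM u x).PosSemidef)
    {τ : ℝ} (hτ : 0 < τ) (e : Fin n → ℝ) {x : EuclideanSpace ℝ (Fin n)} (hx : x ∈ ball 0 1)
    {φ s : EuclideanSpace ℝ (Fin n) → ℝ} (hφ : DifferentiableAt ℝ φ x)
    (hs : DifferentiableAt ℝ s x) (a b : Fin n) :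
    τ * ∑ i, ∑ j, dd a (fun x => φ x * (resolv u τ e x i * resolv u τ e x j) * s x) x *
        dd b (fun y => hessM u y i j) x =
      s x * (dd a φ x * dd b (smoothedForm u τ e) x)
        + φ x * (dd a s x * dd b (smoothedForm u τ e) x)
        - 2 * τ * φ x * (s x * (hessTwist u (resolv u τ e x) x *
          (hessM u x + τ • (1 : Matrix (Fin n) (Fin n) ℝ))⁻¹ *
            hessTwist u (resolv u τ e x) x) a b) := by
  have hM : ((hessM u x + τ • (1 : Matrix (Fin n) (Fin n) ℝ))⁻¹).IsSymm :=
    isSymm_inv ((isSymm_hessM hu hx).add (isSymm_one.smul τ))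
  have hζ : ∀ i, DifferentiableAt ℝ (fun y => resolv u τ e y i) x := fun i =>
    differentiableAt_of_contDiffOn_ball (contDiffOn_resolv hu hA hτ e i) hx
  have h1 : ∀ i j, dd a (fun x => φ x * (resolv u τ e x i * resolv u τ e x j) * s x) x =
      (dd a φ x * s x + φ x * dd a s x) * (resolv u τ e x i * resolv u τ e x j)
        + φ x * s x * (dd a (fun y => resolv u τ e y i) x * resolv u τ e x j
          + resolv u τ e x i * dd a (fun y => resolv u τ e y j) x) := by
    intro i j
    rw [dd_mul (hφ.fun_mul ((hζ i).fun_mul (hζ j))) hs, dd_mul hφ ((hζ i).fun_mul (hζ j)),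
      dd_mul (hζ i) (hζ j)]
    ring
  have hda := dd_resolv hu hA hτ e hx a
  rw [hessTwist_mul_inv_mul_apply hu hx _ _ hM, dd_smoothedForm hu hA hτ e hx b]
  set ζ := resolv u τ e x
  set d : Fin n → ℝ := fun i => dd a (fun y => resolv u τ e y i) x with hd
  have h2 : ((hessM u x + τ • (1 : Matrix (Fin n) (Fin n) ℝ))⁻¹ *ᵥ (hessDeriv u a x *ᵥ ζ))
      = -d := by rw [hda, neg_neg]
  rw [h2]
  have h3 : ∑ i, ∑ j, ζ i * ζ j * hessDeriv u b x i j = ζ ⬝ᵥ hessDeriv u b x *ᵥ ζ := by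
    simp only [dotProduct, mulVec, Finset.mul_sum]
    exact Finset.sum_congr rfl fun i _ => Finset.sum_congr rfl fun j _ => by ring
  have h4 : ∑ i, ∑ j, d i * ζ j * hessDeriv u b x i j = d ⬝ᵥ hessDeriv u b x *ᵥ ζ := by
    simp only [dotProduct, mulVec, Finset.mul_sum]
    exact Finset.sum_congr rfl fun i _ => Finset.sum_congr rfl fun j _ => by ring
  have h5 : ∑ i, ∑ j, ζ i * d j * hessDeriv u b x i j = d ⬝ᵥ hessDeriv u b x *ᵥ ζ := by
    rw [← h4, Finset.sum_comm]
    exact Finset.sum_congr rfl fun i _ => Finset.sum_congr rfl fun j _ => by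
      rw [hessDeriv_symm hu hx]; ring
  have h6 : ∑ i, ∑ j, dd a (fun x => φ x * (resolv u τ e x i * resolv u τ e x j) * s x) x *
        dd b (fun y => hessM u y i j) x
      = (dd a φ x * s x + φ x * dd a s x) * ∑ i, ∑ j, ζ i * ζ j * hessDeriv u b x i j
        + φ x * s x * (∑ i, ∑ j, d i * ζ j * hessDeriv u b x i j
          + ∑ i, ∑ j, ζ i * d j * hessDeriv u b x i j) := by
    simp only [Finset.mul_sum, ← Finset.sum_add_distrib]
    refine Finset.sum_congr rfl fun i _ => Finset.sum_congr rfl fun j _ => ?_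
    rw [h1]
    change _ * hessDeriv u b x i j = _
    simp only [hd]
    ring
  rw [h6, h3, h4, h5, neg_dotProduct]
  ring

theorem IsAdmissible.weak_inequality {L K τmax τ : ℝ} {F : Jet n → ℝ}
    {u : EuclideanSpace ℝ (Fin n) → ℝ} (h : IsAdmissible L K F u) (hL : 0 < L) (hK : 0 ≤ K)
    (hτ : 0 < τ) (hτm : τ ≤ τmax) {e : Fin n → ℝ} (he : e ⬝ᵥ e = 1)
    {φ : EuclideanSpace ℝ (Fin n) → ℝ} (hφ : IsTest φ) (hφ0 : ∀ x, 0 ≤ φ x) :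
    -∫ x, φ x * (weakConst n L K τmax * (1 + ∑ b, |dd b (smoothedForm u τ e) x|)) ≤
      ∫ x, ∑ a, ∑ b, dd a φ x * (symbol F (jet u x) a b * dd b (smoothedForm u τ e) x) := by
  have hu := h.contDiffOn_u
  have hA := h.posSemidef
  have hH := contDiffOn_smoothedForm hu hA hτ e
  have hζ := contDiffOn_resolv hu hA hτ e
  have hg : ∀ j, ContDiffOn ℝ 1 (fun y => fderiv ℝ F (jet u y) (jetLower u j y)) (ball 0 1) :=
    fun j => h.contDiffOn_fderiv_jet.clm_apply (h.contDiffOn_jetLower j)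
  have hid := integral_identity hφ (S := fun a b y => symbol F (jet u y) a b)
    (A := fun i j y => hessM u y i j) (ζ := fun i y => resolv u τ e y i)
    (g := fun j y => fderiv ℝ F (jet u y) (jetLower u j y)) h.contDiffOn_symbol
    (contDiffOn_hessM hu) hζ hg (fun x hx k a b => dd_hessM_comm hu hx k a b)
    (fun x hx k a b => dd_hessM_symm hu hx k a b) (fun x hx j => h.linearized_equation hx j)
  have i1 : Integrable fun x => ∑ a, ∑ b, ∑ i, ∑ j, dd a (fun x => φ x *
      (resolv u τ e x i * resolv u τ e x j) * symbol F (jet u x) a b) x *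
        dd b (fun y => hessM u y i j) x :=
    integrable_finsetSum _ fun a _ => integrable_finsetSum _ fun b _ =>
    integrable_finsetSum _ fun i _ => integrable_finsetSum _ fun j _ =>
      ((hφ.mul ((hζ i).mul (hζ j))).mul (h.contDiffOn_symbol a b)).integrable_dd_mul
        (continuousOn_dd (contDiffOn_hessM hu i j) b) a
  have i2 : Integrable fun x => φ x * ∑ i, ∑ j, (resolv u τ e x i * resolv u τ e x j) *
        (∑ a, ∑ b, dd i (fun y => symbol F (jet u y) a b) x * dd j (fun y => hessM u y a b) x
          + dd i (fun y => fderiv ℝ F (jet u y) (jetLower u j y)) x) := by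
    refine hφ.integrable_mul (continuousOn_finsetSum _ fun i _ => continuousOn_finsetSum _
      fun j _ => ((hζ i).continuousOn.mul (hζ j).continuousOn).mul (ContinuousOn.add
        (continuousOn_finsetSum _ fun a _ => continuousOn_finsetSum _ fun b _ =>
          (continuousOn_dd (h.contDiffOn_symbol a b) i).mul
            (continuousOn_dd (contDiffOn_hessM hu a b) j)) (continuousOn_dd (hg j) i)))
  have i3 : Integrable fun x => ∑ a, ∑ b, dd a φ x *
      (symbol F (jet u x) a b * dd b (smoothedForm u τ e) x) :=
    integrable_finsetSum _ fun a _ => integrable_finsetSum _ fun b _ =>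
      hφ.integrable_dd_mul ((h.contDiffOn_symbol a b).continuousOn.mul (continuousOn_dd hH b)) a
  have i4 : Integrable fun x => φ x * (weakConst n L K τmax *
      (1 + ∑ b, |dd b (smoothedForm u τ e) x|)) :=
    hφ.integrable_mul (continuousOn_const.mul (continuousOn_const.add
      (continuousOn_finsetSum _ fun b _ => (continuousOn_dd hH b).abs)))
  rw [← integral_neg]
  have key := integral_mono i4.neg ((i2.const_mul τ).add (i3.sub (i1.const_mul τ))) fun x => ?_
  · rw [integral_add' (i2.const_mul τ) (i3.sub (i1.const_mul τ)),
      integral_sub' i3 (i1.const_mul τ), integral_const_mul, integral_const_mul] at key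
    refine (le_of_eq ?_).trans (key.trans (le_of_eq ?_))
    · rfl
    · rw [hid]; ring
  · simp only [Pi.neg_apply, Pi.add_apply, Pi.sub_apply]
    by_cases hx : x ∈ tsupport φ
    · have hxb := hφ.subset hx
      have hp := h.pointwise_lower_bound hL hK hτ hτm he hxb
      have hφd : DifferentiableAt ℝ φ x := hφ.contDiff.differentiable one_ne_zero x
      have hsum : τ * ∑ a, ∑ b, ∑ i, ∑ j, dd a (fun x => φ x *
          (resolv u τ e x i * resolv u τ e x j) * symbol F (jet u x) a b) x *
            dd b (fun y => hessM u y i j) x =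
          ∑ a, ∑ b, dd a φ x * (symbol F (jet u x) a b * dd b (smoothedForm u τ e) x)
          + φ x * ∑ a, ∑ b, dd a (fun y => symbol F (jet u y) a b) x * dd b (smoothedForm u τ e) x
          - 2 * τ * φ x * ∑ a, ∑ b, symbol F (jet u x) a b *
            (hessTwist u (resolv u τ e x) x *
              (hessM u x + τ • (1 : Matrix (Fin n) (Fin n) ℝ))⁻¹ *
                hessTwist u (resolv u τ e x) x) a b := by
        simp only [Finset.mul_sum (s := Finset.univ) (a := τ), Finset.mul_sum (a := φ x),
          Finset.mul_sum (a := 2 * τ * φ x), ← Finset.sum_add_distrib, ← Finset.sum_sub_distrib]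
        refine Finset.sum_congr rfl fun a _ => Finset.sum_congr rfl fun b _ => ?_
        rw [← mul_left_comm (symbol F (jet u x) a b) (dd a φ x), ← sum_dd_mul_resolv hu hA hτ e hxb
          hφd (differentiableAt_of_contDiffOn_ball (h.contDiffOn_symbol a b) hxb) a b]
        simp only [Finset.mul_sum]
      have hM : ((hessM u x + τ • (1 : Matrix (Fin n) (Fin n) ℝ))⁻¹).IsSymm :=
        isSymm_inv ((isSymm_hessM hu hxb).add (isSymm_one.smul τ))
      rw [trace_symm_mul _ (isSymm_mul_mul (isSymm_hessTwist hu hxb _) hM)] at hp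
      rw [hsum]
      have := mul_le_mul_of_nonneg_left hp (hφ0 x)
      linarith
    · have z1 : φ x = 0 := image_eq_zero_of_notMem_tsupport hx
      have z2 : ∀ a b i j, dd a (fun x => φ x *
          (resolv u τ e x i * resolv u τ e x j) * symbol F (jet u x) a b) x = 0 :=
        fun a b i j => dd_eq_zero_of_notMem_tsupport (fun hx' => hx
          ((tsupport_mul_subset_left.trans tsupport_mul_subset_left) hx')) a
      simp [z1, z2, fun a => dd_eq_zero_of_notMem_tsupport hx a]
end WeakInequalityIntegral

section Supersolution

open Matrix

variable {n : ℕ}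

/-- A weak supersolution `0 ≤ H ≤ 1` of `∂_a (S_ab ∂_b H) ≤ C (1 + |DH|)` with Lipschitz
coefficients. -/
structure IsSupersolution (L P C : ℝ) (S : EuclideanSpace ℝ (Fin n) → Matrix (Fin n) (Fin n) ℝ)
    (H : EuclideanSpace ℝ (Fin n) → ℝ) : Prop where
  contDiffOn_coeff : ∀ a b, ContDiffOn ℝ 1 (fun x => S x a b) (ball 0 1)
  isSymm : ∀ x ∈ ball 0 1, (S x).IsSymm
  elliptic : ∀ x ∈ ball 0 1, EllipticBound L (S x)
  abs_dd_le : ∀ x ∈ ball 0 1, ∀ k a b, |dd k (fun y => S y a b) x| ≤ P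
  contDiffOn : ContDiffOn ℝ 1 H (ball 0 1)
  nonneg : ∀ x ∈ ball 0 1, 0 ≤ H x
  le_one : ∀ x ∈ ball 0 1, H x ≤ 1
  weak : ∀ φ, IsTest φ → (∀ x, 0 ≤ φ x) →
    -∫ x, φ x * (C * (1 + ∑ b, |dd b H x|)) ≤ ∫ x, ∑ a, ∑ b, dd a φ x * (S x a b * dd b H x)

theorem IsAdmissible.isSupersolution {L K τmax τ : ℝ} {F : Jet n → ℝ}
    {u : EuclideanSpace ℝ (Fin n) → ℝ} (h : IsAdmissible L K F u) (hL : 0 < L) (hK : 0 ≤ K)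
    (hτ : 0 < τ) (hτm : τ ≤ τmax) {e : Fin n → ℝ} (he : e ⬝ᵥ e = 1) :
    IsSupersolution L (K * (K + 1)) (weakConst n L K τmax) (fun x => symbol F (jet u x))
      (smoothedForm u τ e) where
  contDiffOn_coeff := h.contDiffOn_symbol
  isSymm _ _ := isSymm_symbol _ _
  elliptic := h.elliptic
  abs_dd_le _ hx := h.abs_dd_symbol_le hK hx
  contDiffOn := contDiffOn_smoothedForm h.contDiffOn_u h.posSemidef hτ e
  nonneg x hx := (smoothedForm_mem (h.posSemidef x hx) hτ he).1
  le_one x hx := (smoothedForm_mem (h.posSemidef x hx) hτ he).2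
  weak _ hφ hφ0 := h.weak_inequality hL hK hτ hτm he hφ hφ0

/-- The integrand of the inequality satisfied by `2H - H² / 2`. -/
noncomputable def improvedIntegrand (L C : ℝ)
    (S : EuclideanSpace ℝ (Fin n) → Matrix (Fin n) (Fin n) ℝ)
    (H ψ : EuclideanSpace ℝ (Fin n) → ℝ) (x : EuclideanSpace ℝ (Fin n)) : ℝ :=
  ∑ a, ∑ b, dd a ψ x * (S x a b * ((2 - H x) * dd b H x))
    - ψ x * ((2 * L)⁻¹ * ∑ b, dd b H x ^ 2 - (2 * C + n * (2 * L * C ^ 2)))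

namespace IsSupersolution

variable {L P C : ℝ} {S : EuclideanSpace ℝ (Fin n) → Matrix (Fin n) (Fin n) ℝ}
  {H : EuclideanSpace ℝ (Fin n) → ℝ}

theorem integrable_improved (h : IsSupersolution L P C S H) {ψ : EuclideanSpace ℝ (Fin n) → ℝ}
    (hψ : IsTest ψ) : Integrable (improvedIntegrand L C S H ψ) := by
  refine Integrable.sub (integrable_finsetSum _ fun a _ => integrable_finsetSum _ fun b _ =>
    hψ.integrable_dd_mul ((h.contDiffOn_coeff a b).continuousOn.mul
      ((continuousOn_const.sub h.contDiffOn.continuousOn).mul (continuousOn_dd h.contDiffOn b))) a)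
    (hψ.integrable_mul ((continuousOn_const.mul (continuousOn_finsetSum _ fun b _ =>
      (continuousOn_dd h.contDiffOn b).pow 2)).sub continuousOn_const))

theorem improved_pointwise (h : IsSupersolution L P C S H) (hL : 0 < L) (hC : 0 ≤ C)
    {ψ : EuclideanSpace ℝ (Fin n) → ℝ} {x : EuclideanSpace ℝ (Fin n)} (hx : x ∈ ball 0 1)
    (hψ : DifferentiableAt ℝ ψ x) (hψ0 : 0 ≤ ψ x) :
    ∑ a, ∑ b, dd a (fun x => ψ x * (2 - H x)) x * (S x a b * dd b H x)
      + ψ x * (2 - H x) * (C * (1 + ∑ b, |dd b H x|)) ≤ improvedIntegrand L C S H ψ x := by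
  have hH := differentiableAt_of_contDiffOn_ball h.contDiffOn hx
  have h1 : ∀ a, dd a (fun x => ψ x * (2 - H x)) x = dd a ψ x * (2 - H x) - ψ x * dd a H x := by
    intro a
    rw [dd_mul hψ (hH.const_sub 2)]
    simp only [dd, fderiv_const_sub]
    simp; ring
  have h2 : ∑ a, ∑ b, dd a (fun x => ψ x * (2 - H x)) x * (S x a b * dd b H x)
      = ∑ a, ∑ b, dd a ψ x * (S x a b * ((2 - H x) * dd b H x))
        - ψ x * ((fun a => dd a H x) ⬝ᵥ S x *ᵥ fun b => dd b H x) := by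
    simp only [dotProduct, mulVec, Finset.mul_sum, ← Finset.sum_sub_distrib]
    refine Finset.sum_congr rfl fun a _ => Finset.sum_congr rfl fun b _ => ?_
    rw [h1]; ring
  have h3 := (h.elliptic x hx fun a => dd a H x).1
  have h4 : ((fun a => dd a H x) ⬝ᵥ fun a => dd a H x) = ∑ b, dd b H x ^ 2 := by
    simp [dotProduct, sq]
  have h5 : 2 * C * ∑ b, |dd b H x| ≤ (2 * L)⁻¹ * ∑ b, dd b H x ^ 2 + n * (2 * L * C ^ 2) := by
    have : ∀ b, 2 * C * |dd b H x| ≤ (2 * L)⁻¹ * dd b H x ^ 2 + 2 * L * C ^ 2 := by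
      intro b
      have e : (2 * L)⁻¹ * dd b H x ^ 2 + 2 * L * C ^ 2 - 2 * C * |dd b H x|
          = (2 * L)⁻¹ * (|dd b H x| - 2 * L * C) ^ 2 := by
        rw [← sq_abs (dd b H x)]
        field_simp
        ring
      have : 0 ≤ (2 * L)⁻¹ * (|dd b H x| - 2 * L * C) ^ 2 := by positivity
      linarith
    calc _ = ∑ b, 2 * C * |dd b H x| := Finset.mul_sum _ _ _
      _ ≤ ∑ b, ((2 * L)⁻¹ * dd b H x ^ 2 + 2 * L * C ^ 2) := Finset.sum_le_sum fun b _ => this b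
      _ = _ := by simp [Finset.sum_add_distrib, Finset.mul_sum]
  have h6 : (2 - H x) * (C * (1 + ∑ b, |dd b H x|)) ≤ 2 * C + 2 * C * ∑ b, |dd b H x| := by
    have := h.nonneg x hx
    have h0 : 0 ≤ ∑ b, |dd b H x| := Finset.sum_nonneg fun _ _ => abs_nonneg _
    calc _ ≤ 2 * (C * (1 + ∑ b, |dd b H x|)) := by gcongr; linarith
      _ = _ := by ring
  have h7 : L⁻¹ = (2 * L)⁻¹ + (2 * L)⁻¹ := by field_simp; norm_num
  rw [h4, h7] at h3
  rw [h2, improvedIntegrand]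
  have h8 : ψ x * ((2 * L)⁻¹ * ∑ b, dd b H x ^ 2 - (2 * C + n * (2 * L * C ^ 2)))
      ≤ ψ x * (((fun a => dd a H x) ⬝ᵥ S x *ᵥ fun b => dd b H x)
        - (2 - H x) * (C * (1 + ∑ b, |dd b H x|))) :=
    mul_le_mul_of_nonneg_left (by linarith) hψ0
  linarith

theorem integral_improved_nonneg (h : IsSupersolution L P C S H) (hL : 0 < L) (hC : 0 ≤ C)
    {ψ : EuclideanSpace ℝ (Fin n) → ℝ} (hψ : IsTest ψ) (hψ0 : ∀ x, 0 ≤ ψ x) :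
    0 ≤ ∫ x, improvedIntegrand L C S H ψ x := by
  have hφ : IsTest fun x => ψ x * (2 - H x) := hψ.mul (contDiffOn_const.sub h.contDiffOn)
  have hφ0 : ∀ x, 0 ≤ ψ x * (2 - H x) := fun x => by
    by_cases hx : x ∈ tsupport ψ
    · have := h.le_one x (hψ.subset hx)
      exact mul_nonneg (hψ0 x) (by linarith)
    · rw [image_eq_zero_of_notMem_tsupport hx, zero_mul]
  have i1 : Integrable fun x => ∑ a, ∑ b, dd a (fun x => ψ x * (2 - H x)) x *
      (S x a b * dd b H x) :=
    integrable_finsetSum _ fun a _ => integrable_finsetSum _ fun b _ =>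
      hφ.integrable_dd_mul ((h.contDiffOn_coeff a b).continuousOn.mul
        (continuousOn_dd h.contDiffOn b)) a
  have i2 : Integrable fun x => ψ x * (2 - H x) * (C * (1 + ∑ b, |dd b H x|)) :=
    hφ.integrable_mul (continuousOn_const.mul (continuousOn_const.add
      (continuousOn_finsetSum _ fun b _ => (continuousOn_dd h.contDiffOn b).abs)))
  have hw := h.weak _ hφ hφ0
  have key := integral_mono (i1.add i2) (h.integrable_improved hψ) fun x => ?_
  · rw [integral_add' i1 i2] at key
    linarith
  · simp only [Pi.add_apply]
    by_cases hx : x ∈ tsupport ψ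
    · exact h.improved_pointwise hL hC (hψ.subset hx) (hψ.contDiff.differentiable one_ne_zero x)
        (hψ0 x)
    · have z1 : ψ x = 0 := image_eq_zero_of_notMem_tsupport hx
      have z2 : ∀ a, dd a (fun x => ψ x * (2 - H x)) x = 0 := fun a =>
        dd_eq_zero_of_notMem_tsupport (fun hx' => hx (tsupport_mul_subset_left hx')) a
      simp [z1, z2, improvedIntegrand, fun a => dd_eq_zero_of_notMem_tsupport hx a]

end IsSupersolution

end Supersolution

section EllipsoidalBump

open Matrix

variable {n : ℕ}

theorem hasDerivAt_max_zero_sq (t : ℝ) :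
    HasDerivAt (fun t : ℝ => max t 0 ^ 2) (2 * max t 0) t := by
  rcases lt_trichotomy t 0 with ht | ht | ht
  · rw [max_eq_right ht.le, mul_zero]
    refine (hasDerivAt_const t (0 : ℝ)).congr_of_eventuallyEq ?_
    filter_upwards [gt_mem_nhds ht] with s hs
    rw [max_eq_right hs.le]; norm_num
  · subst ht
    rw [max_self, mul_zero, hasDerivAt_iff_isLittleO]
    simp only [max_self, sub_zero, smul_zero]
    refine Asymptotics.IsBigO.trans_isLittleO (g := fun s : ℝ => s ^ 2) ?_ ?_
    · refine Asymptotics.IsBigO.of_bound 1 (Filter.Eventually.of_forall fun s => ?_)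
      have : |max s 0| ≤ |s| := by
        rcases le_total s 0 with hs | hs <;> simp [hs]
      simp only [Real.norm_eq_abs, one_mul, ne_eq, OfNat.ofNat_ne_zero, not_false_eq_true,
        zero_pow, sub_zero, abs_pow]
      gcongr
    · simpa using Asymptotics.isLittleO_pow_pow (𝕜 := ℝ) (m := 1) (n := 2) (by norm_num)
  · rw [max_eq_left ht.le]
    have : HasDerivAt (fun t : ℝ => t ^ 2) (2 * t) t := by simpa using hasDerivAt_pow 2 t
    refine this.congr_of_eventuallyEq ?_
    filter_upwards [lt_mem_nhds ht] with s hs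
    rw [max_eq_left hs.le]

theorem contDiff_max_zero_sq : ContDiff ℝ 1 fun t : ℝ => max t 0 ^ 2 := by
  refine contDiff_one_iff_deriv.2 ⟨fun t => (hasDerivAt_max_zero_sq t).differentiableAt, ?_⟩
  have : deriv (fun t : ℝ => max t 0 ^ 2) = fun t => 2 * max t 0 :=
    funext fun t => (hasDerivAt_max_zero_sq t).deriv
  rw [this]
  fun_prop

/-- The quadratic form of `N`. -/
def ellQuad (N : Matrix (Fin n) (Fin n) ℝ) (z : EuclideanSpace ℝ (Fin n)) : ℝ :=
  ∑ i, ∑ j, N i j * (z i * z j)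

/-- A Lipschitz bump supported in the ellipsoid of `N`. -/
noncomputable def ellBump (N : Matrix (Fin n) (Fin n) ℝ) (z : EuclideanSpace ℝ (Fin n)) : ℝ :=
  max (1 - ellQuad N z) 0

/-- A potential for `-ellBump N z • N z`. -/
noncomputable def ellPotential (N : Matrix (Fin n) (Fin n) ℝ)
    (z : EuclideanSpace ℝ (Fin n)) : ℝ :=
  ellBump N z ^ 2 / 4

theorem contDiff_ellQuad (N : Matrix (Fin n) (Fin n) ℝ) : ContDiff ℝ 1 (ellQuad N) := by
  unfold ellQuad
  fun_prop

theorem ellBump_nonneg (N : Matrix (Fin n) (Fin n) ℝ) (z : EuclideanSpace ℝ (Fin n)) :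
    0 ≤ ellBump N z := le_max_right _ _

theorem continuous_ellBump (N : Matrix (Fin n) (Fin n) ℝ) : Continuous (ellBump N) := by
  have := (contDiff_ellQuad N).continuous
  unfold ellBump
  fun_prop

theorem contDiff_ellPotential (N : Matrix (Fin n) (Fin n) ℝ) : ContDiff ℝ 1 (ellPotential N) :=
  (contDiff_max_zero_sq.comp (contDiff_const.sub (contDiff_ellQuad N))).div_const 4

theorem dd_ellQuad {N : Matrix (Fin n) (Fin n) ℝ} (hN : N.IsSymm) (a : Fin n)
    (z : EuclideanSpace ℝ (Fin n)) : dd a (ellQuad N) z = 2 * ∑ j, N a j * z j := by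
  have hc : ∀ i, DifferentiableAt ℝ (fun z : EuclideanSpace ℝ (Fin n) => z i) z := fun i => by
    fun_prop
  have hdc : ∀ i, dd a (fun z : EuclideanSpace ℝ (Fin n) => z i) z = if i = a then 1 else 0 := by
    intro i
    have : (fun z : EuclideanSpace ℝ (Fin n) => z i) = EuclideanSpace.proj (𝕜 := ℝ) i := rfl
    rw [this, dd, ContinuousLinearMap.fderiv]
    simp
  have h1 : ∀ i j, dd a (fun z : EuclideanSpace ℝ (Fin n) => N i j * (z i * z j)) z
      = N i j * ((if i = a then 1 else 0) * z j + z i * (if j = a then 1 else 0)) := by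
    intro i j
    rw [dd_mul (differentiableAt_const _) ((hc i).fun_mul (hc j)), dd_mul (hc i) (hc j), hdc, hdc]
    simp [dd]
  have h3 : dd a (ellQuad N) z
      = ∑ i, ∑ j, dd a (fun z : EuclideanSpace ℝ (Fin n) => N i j * (z i * z j)) z :=
    (dd_sum Finset.univ (f := fun i (z : EuclideanSpace ℝ (Fin n)) => ∑ j, N i j * (z i * z j))
      (fun i _ => DifferentiableAt.fun_sum fun j _ =>
        (differentiableAt_const _).fun_mul ((hc i).fun_mul (hc j))) a).trans
    (Finset.sum_congr rfl fun i _ => dd_sum Finset.univ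
      (f := fun j (z : EuclideanSpace ℝ (Fin n)) => N i j * (z i * z j))
      (fun j _ => (differentiableAt_const _).fun_mul ((hc i).fun_mul (hc j))) a)
  simp_rw [h3, h1]
  simp only [mul_add, Finset.sum_add_distrib, ite_mul, one_mul, zero_mul, mul_ite, mul_one,
    mul_zero, Finset.sum_ite_eq', Finset.mem_univ, if_true]
  have h2 : ∑ i, ∑ j, (if i = a then N i j * z j else 0) = ∑ j, N a j * z j := by
    rw [Finset.sum_comm]; simp
  rw [h2, two_mul]
  congr 1
  exact Finset.sum_congr rfl fun i _ => by rw [hN.apply]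

theorem dd_ellPotential {N : Matrix (Fin n) (Fin n) ℝ} (hN : N.IsSymm) (a : Fin n)
    (z : EuclideanSpace ℝ (Fin n)) :
    dd a (ellPotential N) z = -(ellBump N z * ∑ j, N a j * z j) := by
  have hq := ((contDiff_ellQuad N).differentiable one_ne_zero z).hasFDerivAt
  have h1 := ((hasDerivAt_max_zero_sq (1 - ellQuad N z)).comp_hasFDerivAt z
    (hq.const_sub 1)).mul_const (4⁻¹ : ℝ)
  have h2 : HasFDerivAt (ellPotential N) _ z := h1.congr_of_eventuallyEq
    (Filter.Eventually.of_forall fun y => by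
      simp [ellPotential, ellBump, div_eq_mul_inv])
  rw [dd, h2.fderiv]
  have := dd_ellQuad hN a z
  rw [dd] at this
  simp [this, ellBump]
  ring

/-- Two-sided bounds for the inverse of an elliptic matrix. -/
theorem EllipticBound.inv_bounds {L : ℝ} (hL : 0 < L) {S : Matrix (Fin n) (Fin n) ℝ}
    (hS : S.IsSymm) (h : EllipticBound L S) :
    S * S⁻¹ = 1 ∧ (S⁻¹).IsSymm ∧ ∀ z : Fin n → ℝ, L⁻¹ * (z ⬝ᵥ z) ≤ z ⬝ᵥ S⁻¹ *ᵥ z ∧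
      z ⬝ᵥ S⁻¹ *ᵥ z ≤ L * (z ⬝ᵥ z) ∧ (S⁻¹ *ᵥ z) ⬝ᵥ (S⁻¹ *ᵥ z) ≤ L ^ 2 * (z ⬝ᵥ z) := by
  have hq : ∀ ξ : Fin n → ℝ, 0 ≤ ξ ⬝ᵥ ξ := fun ξ => by
    simpa using dotProduct_star_self_nonneg ξ
  have hpd : S.PosDef := by
    refine PosDef.of_dotProduct_mulVec_pos ?_ fun x hx => ?_
    · rw [IsHermitian, conjTranspose_eq_transpose_of_trivial]; exact hS
    · have h1 : 0 < x ⬝ᵥ x := by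
        simpa using dotProduct_star_self_pos_iff.2 hx
      have := (h x).1
      have h2 : 0 < L⁻¹ * (x ⬝ᵥ x) := by positivity
      simpa using h2.trans_le this
  have hdet := hpd.det_pos.ne'.isUnit
  have h1 : S * S⁻¹ = 1 := mul_nonsing_inv _ hdet
  refine ⟨h1, isSymm_inv hS, fun z => ?_⟩
  set w := S⁻¹ *ᵥ z with hw
  have hz : S *ᵥ w = z := by rw [hw, mulVec_mulVec, h1, one_mulVec]
  have a1 := h w
  rw [hz] at a1
  have a2 := (h z).2
  have a3 := (h (z - L • w)).1
  have hsw : w ⬝ᵥ S *ᵥ z = z ⬝ᵥ z := by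
    rw [dotProduct_mulVec, ← mulVec_transpose, hS.eq, hz]
  rw [mulVec_sub, mulVec_smul, hz] at a3
  simp only [sub_dotProduct, dotProduct_sub, smul_dotProduct, dotProduct_smul, smul_eq_mul,
    hsw, dotProduct_comm w z] at a3 a1
  have a4 := hq (w - L • z)
  simp only [sub_dotProduct, dotProduct_sub, smul_dotProduct, dotProduct_smul, smul_eq_mul,
    dotProduct_comm w z] at a4
  have a5 := hq (z - L • w)
  simp only [sub_dotProduct, dotProduct_sub, smul_dotProduct, dotProduct_smul, smul_eq_mul,
    dotProduct_comm w z] at a5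
  have b1 : w ⬝ᵥ w ≤ L * (z ⬝ᵥ w) := by
    have := mul_le_mul_of_nonneg_left a1.1 hL.le
    rwa [← mul_assoc, mul_inv_cancel₀ hL.ne', one_mul] at this
  have b2 : z ⬝ᵥ w ≤ L * (z ⬝ᵥ z) := by
    have : L * (z ⬝ᵥ w) ≤ L * (L * (z ⬝ᵥ z)) := by nlinarith
    exact le_of_mul_le_mul_left this hL
  have b0 : L⁻¹ * (z ⬝ᵥ z - L * z ⬝ᵥ w - (L * (z ⬝ᵥ w) - L * (L * w ⬝ᵥ w))) ≥ 0 :=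
    mul_nonneg (by positivity) (by linarith)
  refine ⟨?_, b2, ?_⟩
  · have : L * (z ⬝ᵥ z) ≤ L * (L * (z ⬝ᵥ w)) := by
      nlinarith
    rw [inv_mul_le_iff₀ hL]
    exact le_of_mul_le_mul_left this hL
  · calc w ⬝ᵥ w ≤ L * (z ⬝ᵥ w) := b1
      _ ≤ L * (L * (z ⬝ᵥ z)) := by gcongr
      _ = _ := by ring

end EllipsoidalBump

section EllipsoidalBumpBounds

open Matrix

variable {n : ℕ}

theorem fderiv_eq_sum_dd (f : EuclideanSpace ℝ (Fin n) → ℝ) (x v : EuclideanSpace ℝ (Fin n)) :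
    fderiv ℝ f x v = ∑ i, v i * dd i f x := by
  conv_lhs => rw [← (EuclideanSpace.basisFun (Fin n) ℝ).sum_repr v]
  simp [dd]

theorem abs_apply_le_norm (z : EuclideanSpace ℝ (Fin n)) (i : Fin n) : |z i| ≤ ‖z‖ := by
  simpa using PiLp.norm_apply_le z i

theorem norm_fderiv_le_of_abs_dd_le {f : EuclideanSpace ℝ (Fin n) → ℝ}
    {x : EuclideanSpace ℝ (Fin n)} {P : ℝ} (h : ∀ k, |dd k f x| ≤ P) :
    ‖fderiv ℝ f x‖ ≤ n * P := by
  rcases Nat.eq_zero_or_pos n with hn | hn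
  · subst hn
    simp [Subsingleton.elim (fderiv ℝ f x) 0]
  have hP : 0 ≤ P := (abs_nonneg _).trans (h ⟨0, hn⟩)
  refine ContinuousLinearMap.opNorm_le_bound _ (by positivity) fun v => ?_
  rw [fderiv_eq_sum_dd]
  calc ‖∑ i, v i * dd i f x‖ ≤ ∑ i, ‖v i * dd i f x‖ := norm_sum_le _ _
    _ ≤ ∑ _i : Fin n, ‖v‖ * P := by
        refine Finset.sum_le_sum fun i _ => ?_
        rw [norm_mul]
        exact mul_le_mul (abs_apply_le_norm v i) (h i) (norm_nonneg _) (norm_nonneg _)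
    _ = _ := by simp; ring

theorem abs_sub_le_of_abs_dd_le {f : EuclideanSpace ℝ (Fin n) → ℝ}
    (hf : ContDiffOn ℝ 1 f (ball 0 1)) {P : ℝ} (h : ∀ x ∈ ball 0 1, ∀ k, |dd k f x| ≤ P)
    {x y : EuclideanSpace ℝ (Fin n)} (hx : x ∈ ball 0 1) (hy : y ∈ ball 0 1) :
    |f y - f x| ≤ n * P * ‖y - x‖ :=
  (convex_ball 0 1).norm_image_sub_le_of_norm_fderiv_le (𝕜 := ℝ)
    (fun _ hz => differentiableAt_of_contDiffOn_ball hf hz)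
    (fun z hz => norm_fderiv_le_of_abs_dd_le (h z hz)) hx hy

theorem ofLp_dotProduct_self (z : EuclideanSpace ℝ (Fin n)) : z.ofLp ⬝ᵥ z.ofLp = ‖z‖ ^ 2 := by
  rw [EuclideanSpace.real_norm_sq_eq]
  simp [dotProduct, sq]

theorem ellQuad_eq (N : Matrix (Fin n) (Fin n) ℝ) (z : EuclideanSpace ℝ (Fin n)) :
    ellQuad N z = z.ofLp ⬝ᵥ N *ᵥ z.ofLp := by
  simp only [ellQuad, dotProduct, mulVec, Finset.mul_sum]
  exact Finset.sum_congr rfl fun i _ => Finset.sum_congr rfl fun j _ => by ring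

variable {L : ℝ} {N : Matrix (Fin n) (Fin n) ℝ}

theorem ellBump_le_one (hL : 0 < L) (hN : ∀ z : Fin n → ℝ, L⁻¹ * (z ⬝ᵥ z) ≤ z ⬝ᵥ N *ᵥ z)
    (z : EuclideanSpace ℝ (Fin n)) : ellBump N z ≤ 1 := by
  have := hN z.ofLp
  rw [ofLp_dotProduct_self, ← ellQuad_eq] at this
  have h2 : 0 ≤ L⁻¹ * ‖z‖ ^ 2 := by positivity
  exact max_le (by linarith) zero_le_one

theorem ellBump_eq_zero (hL : 0 < L) (hN : ∀ z : Fin n → ℝ, L⁻¹ * (z ⬝ᵥ z) ≤ z ⬝ᵥ N *ᵥ z)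
    {z : EuclideanSpace ℝ (Fin n)} (hz : L + 1 ≤ ‖z‖) : ellBump N z = 0 := by
  have h1 := hN z.ofLp
  rw [ofLp_dotProduct_self, ← ellQuad_eq] at h1
  have h2 : 1 ≤ L⁻¹ * ‖z‖ ^ 2 := by
    rw [le_inv_mul_iff₀ hL]
    nlinarith
  exact max_eq_right (by linarith)

theorem half_le_ellBump (hL : 0 < L) (hN : ∀ z : Fin n → ℝ, z ⬝ᵥ N *ᵥ z ≤ L * (z ⬝ᵥ z))
    {z : EuclideanSpace ℝ (Fin n)} (hz : ‖z‖ ≤ (L + 1)⁻¹) : 1 / 2 ≤ ellBump N z := by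
  have h1 := hN z.ofLp
  rw [ofLp_dotProduct_self, ← ellQuad_eq] at h1
  have h2 : L * ‖z‖ ^ 2 ≤ 1 / 2 := by
    calc L * ‖z‖ ^ 2 ≤ L * ((L + 1)⁻¹) ^ 2 := by gcongr
      _ = L / (L + 1) ^ 2 := by rw [inv_pow, div_eq_mul_inv]
      _ ≤ 1 / 2 := by
          rw [div_le_div_iff₀ (by positivity) (by norm_num)]
          nlinarith
  exact le_max_of_le_left (by linarith)

theorem abs_sum_mul_le (hL : 0 < L)
    (hN : ∀ z : Fin n → ℝ, (N *ᵥ z) ⬝ᵥ (N *ᵥ z) ≤ L ^ 2 * (z ⬝ᵥ z))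
    (z : EuclideanSpace ℝ (Fin n)) (a : Fin n) : |∑ j, N a j * z j| ≤ L * ‖z‖ := by
  have h1 := hN z.ofLp
  rw [ofLp_dotProduct_self z, ← mul_pow] at h1
  have h2 : (∑ j, N a j * z j) ^ 2 ≤ (N *ᵥ z.ofLp) ⬝ᵥ (N *ᵥ z.ofLp) := by
    simp only [dotProduct, ← sq]
    exact Finset.single_le_sum (f := fun i => (N *ᵥ z.ofLp) i ^ 2) (fun _ _ => sq_nonneg _)
      (Finset.mem_univ a)
  exact abs_le_of_sq_le_sq (h2.trans h1) (by positivity)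

theorem ellBump_eq_zero_of_notMem_closedBall (hL : 0 < L)
    (hN : ∀ z : Fin n → ℝ, L⁻¹ * (z ⬝ᵥ z) ≤ z ⬝ᵥ N *ᵥ z) {z : EuclideanSpace ℝ (Fin n)}
    (hz : z ∉ closedBall 0 (L + 1)) : ellBump N z = 0 :=
  ellBump_eq_zero hL hN (by rw [mem_closedBall_zero_iff, not_le] at hz; exact hz.le)

theorem tsupport_ellBump_subset (hL : 0 < L)
    (hN : ∀ z : Fin n → ℝ, L⁻¹ * (z ⬝ᵥ z) ≤ z ⬝ᵥ N *ᵥ z) :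
    tsupport (ellBump N) ⊆ closedBall 0 (L + 1) :=
  closure_minimal (fun z hz => by
    by_contra h
    exact hz (ellBump_eq_zero_of_notMem_closedBall hL hN h)) isClosed_closedBall

theorem hasCompactSupport_ellBump (hL : 0 < L)
    (hN : ∀ z : Fin n → ℝ, L⁻¹ * (z ⬝ᵥ z) ≤ z ⬝ᵥ N *ᵥ z) : HasCompactSupport (ellBump N) :=
  HasCompactSupport.intro (isCompact_closedBall 0 (L + 1)) fun _ hz =>
    ellBump_eq_zero_of_notMem_closedBall hL hN hz

theorem add_smul_mem_ball {y z : EuclideanSpace ℝ (Fin n)} {R r ρ : ℝ}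
    (hR : closedBall y (R * ρ) ⊆ ball 0 1) (hr0 : 0 ≤ r) (hr : r ≤ R)
    (hz : z ∈ closedBall 0 ρ) : y + r • z ∈ ball (0 : EuclideanSpace ℝ (Fin n)) 1 := by
  rw [mem_closedBall_zero_iff] at hz
  refine hR ?_
  rw [mem_closedBall, dist_eq_norm, add_sub_cancel_left, norm_smul, Real.norm_of_nonneg hr0]
  exact mul_le_mul hr hz (norm_nonneg _) (hr0.trans hr)

theorem continuous_ellBump_mul (hL : 0 < L)
    (hN : ∀ z : Fin n → ℝ, L⁻¹ * (z ⬝ᵥ z) ≤ z ⬝ᵥ N *ᵥ z) {g : EuclideanSpace ℝ (Fin n) → ℝ}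
    (hg : ∀ z ∈ closedBall 0 (L + 1), ContinuousAt g z) :
    Continuous fun z => ellBump N z * g z := by
  refine continuous_iff_continuousAt.2 fun z => ?_
  by_cases hz : z ∈ tsupport (ellBump N)
  · exact (continuous_ellBump N).continuousAt.mul (hg z (tsupport_ellBump_subset hL hN hz))
  · have : (fun z => ellBump N z * g z) =ᶠ[nhds z] fun _ => 0 := by
      filter_upwards [notMem_tsupport_iff_eventuallyEq.1 hz] with w hw
      rw [hw, Pi.zero_apply, zero_mul]
    exact continuousAt_const.congr this.symm

/-- The rescaled potential is a test function. -/
theorem isTest_ellPotential (hL : 0 < L)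
    (hN : ∀ z : Fin n → ℝ, L⁻¹ * (z ⬝ᵥ z) ≤ z ⬝ᵥ N *ᵥ z) {y : EuclideanSpace ℝ (Fin n)} {r : ℝ}
    (hr : 0 < r) (hR : closedBall y (r * (L + 1)) ⊆ ball 0 1) :
    IsTest fun x => ellPotential N (r⁻¹ • (x - y)) := by
  have h0 : ∀ x ∉ closedBall y (r * (L + 1)), ellPotential N (r⁻¹ • (x - y)) = 0 := by
    intro x hx
    rw [ellPotential, ellBump_eq_zero hL hN]
    · simp
    · rw [mem_closedBall, dist_eq_norm, not_le] at hx
      rw [norm_smul, norm_inv, Real.norm_of_nonneg hr.le, le_inv_mul_iff₀ hr]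
      exact hx.le
  refine ⟨?_, HasCompactSupport.intro (isCompact_closedBall _ _) h0, ?_⟩
  · exact (contDiff_ellPotential N).comp ((contDiff_id.sub contDiff_const).const_smul r⁻¹)
  · refine (closure_minimal (fun x hx => ?_) isClosed_closedBall).trans hR
    by_contra h
    exact hx (h0 x h)

theorem dd_ellPotential_comp (N : Matrix (Fin n) (Fin n) ℝ) {y : EuclideanSpace ℝ (Fin n)} {r : ℝ}
    (hr : r ≠ 0) (a : Fin n) (z : EuclideanSpace ℝ (Fin n)) :
    dd a (fun x => ellPotential N (r⁻¹ • (x - y))) (y + r • z)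
      = r⁻¹ * dd a (ellPotential N) z := by
  have hf : DifferentiableAt ℝ (ellPotential N) (r⁻¹ • (y + r • z - y)) :=
    (contDiff_ellPotential N).differentiable one_ne_zero _
  have hg : HasFDerivAt (fun x : EuclideanSpace ℝ (Fin n) => r⁻¹ • (x - y))
      (r⁻¹ • ContinuousLinearMap.id ℝ _) (y + r • z) :=
    ((hasFDerivAt_id _).sub_const y).const_smul r⁻¹
  have := HasFDerivAt.comp (g := ellPotential N) (f := fun x => r⁻¹ • (x - y)) (y + r • z)
    hf.hasFDerivAt hg
  have h2 : r⁻¹ • (y + r • z - y) = z := by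
    rw [add_sub_cancel_left, smul_smul, inv_mul_cancel₀ hr, one_smul]
  rw [h2] at this
  rw [dd, dd]
  rw [show (fun x => ellPotential N (r⁻¹ • (x - y)))
    = ellPotential N ∘ fun x => r⁻¹ • (x - y) from rfl, this.fderiv]
  simp

end EllipsoidalBumpBounds

section MeanValue

open Matrix

variable {n : ℕ}

/-- The radial derivative of `η(z) (2H - H²/2)(y + r z)`. -/
noncomputable def radialSlope (N : Matrix (Fin n) (Fin n) ℝ) (H : EuclideanSpace ℝ (Fin n) → ℝ)
    (y : EuclideanSpace ℝ (Fin n)) (r : ℝ) (z : EuclideanSpace ℝ (Fin n)) : ℝ :=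
  ellBump N z * ((2 - H (y + r • z)) * ∑ b, z b * dd b H (y + r • z))

/-- Bounds for the error terms in the mean value inequality. -/
noncomputable def gradConst (n : ℕ) (L P : ℝ) : ℝ :=
  n * (L * (L + 1)) * (n * P * (L + 1)) * 2

/-- Bounds for the error terms in the mean value inequality. -/
noncomputable def slopeConst (n : ℕ) (L P C : ℝ) : ℝ :=
  n * (2 * L * gradConst n L P ^ 2) + (2 * C + n * (2 * L * C ^ 2)) / 4

theorem slopeConst_nonneg {L P C : ℝ} (hL : 0 < L) (hC : 0 ≤ C) : 0 ≤ slopeConst n L P C := by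
  unfold slopeConst; positivity

theorem sum_coeff_mul_inv {S : Matrix (Fin n) (Fin n) ℝ} (hS : S.IsSymm) (h : S * S⁻¹ = 1)
    (z p : Fin n → ℝ) (c : ℝ) :
    ∑ a, ∑ b, (-(c * ∑ j, S⁻¹ a j * z j)) * (S a b * p b) = -(c * ∑ b, z b * p b) := by
  have h1 : ∀ b, ∑ a, S a b * (S⁻¹ *ᵥ z) a = z b := by
    intro b
    have : (S *ᵥ (S⁻¹ *ᵥ z)) b = z b := by rw [mulVec_mulVec, h, one_mulVec]
    rw [← this]
    simp only [mulVec, dotProduct]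
    exact Finset.sum_congr rfl fun a _ => by rw [hS.apply]
  rw [Finset.sum_comm, Finset.mul_sum, ← Finset.sum_neg_distrib]
  refine Finset.sum_congr rfl fun b _ => ?_
  rw [show z b * p b = (∑ a, S a b * (S⁻¹ *ᵥ z) a) * p b by rw [h1], Finset.sum_mul, Finset.mul_sum, ← Finset.sum_neg_distrib]
  refine Finset.sum_congr rfl fun a _ => ?_
  simp only [mulVec, dotProduct]
  ring

namespace IsSupersolution

variable {L P C : ℝ} {S : EuclideanSpace ℝ (Fin n) → Matrix (Fin n) (Fin n) ℝ}
  {H : EuclideanSpace ℝ (Fin n) → ℝ} {y : EuclideanSpace ℝ (Fin n)}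

theorem abs_coeff_sub_le (h : IsSupersolution L P C S H) {x y : EuclideanSpace ℝ (Fin n)}
    (hx : x ∈ ball 0 1) (hy : y ∈ ball 0 1) (a b : Fin n) :
    |S y a b - S x a b| ≤ n * P * ‖y - x‖ :=
  abs_sub_le_of_abs_dd_le (h.contDiffOn_coeff a b) (fun z hz k => h.abs_dd_le z hz k a b) hx hy

theorem error_le {η p E L : ℝ} (hL : 0 < L) :
    E * η * |p| ≤ η ^ 2 / 4 * ((2 * L)⁻¹ * p ^ 2) + 2 * L * E ^ 2 := by
  have h1 : η ^ 2 / 4 * ((2 * L)⁻¹ * p ^ 2) + 2 * L * E ^ 2 - E * η * |p|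
      = (η * |p| - 4 * L * E) ^ 2 / (8 * L) := by
    rw [← sq_abs p]
    field_simp
    ring
  have h2 : 0 ≤ (η * |p| - 4 * L * E) ^ 2 / (8 * L) := by positivity
  linarith

theorem mul_improvedIntegrand_le (h : IsSupersolution L P C S H) (hL : 0 < L) (hP : 0 ≤ P)
    (hC : 0 ≤ C) (hy : y ∈ ball 0 1) {r : ℝ} (hr : 0 < r)
    (hR : closedBall y (r * (L + 1)) ⊆ ball 0 1) (z : EuclideanSpace ℝ (Fin n)) :
    r * improvedIntegrand L C S H (fun x => ellPotential (S y)⁻¹ (r⁻¹ • (x - y))) (y + r • z)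
      ≤ -radialSlope (S y)⁻¹ H y r z
        + (closedBall 0 (L + 1)).indicator (fun _ => slopeConst n L P C * r) z := by
  obtain ⟨hinv, hNs, hN⟩ := (h.elliptic y hy).inv_bounds hL (h.isSymm y hy)
  have hψ : (fun x => ellPotential (S y)⁻¹ (r⁻¹ • (x - y))) (y + r • z)
      = ellPotential (S y)⁻¹ z := by
    simp only [add_sub_cancel_left, smul_smul, inv_mul_cancel₀ hr.ne', one_smul]
  unfold improvedIntegrand
  rw [hψ]
  simp only [dd_ellPotential_comp _ hr.ne', dd_ellPotential hNs]
  by_cases hz : z ∈ closedBall 0 (L + 1)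
  swap
  · have h0 := ellBump_eq_zero_of_notMem_closedBall hL (fun z => (hN z).1) hz
    simp [ellPotential, radialSlope, h0, hz]
  rw [Set.indicator_of_mem hz]
  have hx : y + r • z ∈ ball (0 : EuclideanSpace ℝ (Fin n)) 1 :=
    add_smul_mem_ball hR hr.le le_rfl hz
  have hzn : ‖z‖ ≤ L + 1 := by simpa using hz
  set x := y + r • z with hxdef
  set η := ellBump (S y)⁻¹ z with hη
  have hη0 : 0 ≤ η := ellBump_nonneg _ _
  have hη1 : η ≤ 1 := ellBump_le_one hL (fun z => (hN z).1) z
  set p : Fin n → ℝ := fun b => dd b H x with hp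
  have hG0 := h.nonneg x hx
  have hG1 := h.le_one x hx
  set G := 2 - H x with hG
  have hGn : 0 ≤ G := by linarith
  have hmain := sum_coeff_mul_inv (h.isSymm y hy) hinv z.ofLp (fun b => G * p b) η
  have hsplit : r * ∑ a, ∑ b, r⁻¹ * -(η * ∑ j, (S y)⁻¹ a j * z j) * (S x a b * (G * p b))
      = -(η * ∑ b, z b * (G * p b))
        + ∑ a, ∑ b, -(η * ∑ j, (S y)⁻¹ a j * z j) * ((S x a b - S y a b) * (G * p b)) := by
    rw [← hmain, ← Finset.sum_add_distrib, Finset.mul_sum]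
    refine Finset.sum_congr rfl fun a _ => ?_
    rw [← Finset.sum_add_distrib, Finset.mul_sum]
    refine Finset.sum_congr rfl fun b _ => ?_
    rw [show r * (r⁻¹ * -(η * ∑ j, (S y)⁻¹ a j * z j) * (S x a b * (G * p b)))
      = (r * r⁻¹) * (-(η * ∑ j, (S y)⁻¹ a j * z j) * (S x a b * (G * p b))) by ring,
      mul_inv_cancel₀ hr.ne']
    ring
  have herr : ∑ a, ∑ b, -(η * ∑ j, (S y)⁻¹ a j * z j) * ((S x a b - S y a b) * (G * p b))
      ≤ r * ∑ b, gradConst n L P * η * |p b| := by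
    have : ∀ a b, -(η * ∑ j, (S y)⁻¹ a j * z j) * ((S x a b - S y a b) * (G * p b))
        ≤ r * ((L * (L + 1)) * (n * P * (L + 1)) * 2 * η * |p b|) := by
      intro a b
      have e1 : |∑ j, (S y)⁻¹ a j * z j| ≤ L * (L + 1) :=
        (abs_sum_mul_le hL (fun z => (hN z).2.2) z a).trans (by gcongr)
      have e2 : |S x a b - S y a b| ≤ n * P * (r * (L + 1)) := by
        refine (h.abs_coeff_sub_le hy hx a b).trans ?_
        rw [hxdef, add_sub_cancel_left, norm_smul, Real.norm_of_nonneg hr.le]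
        gcongr
      refine (le_abs_self _).trans ?_
      rw [abs_mul, abs_neg, abs_mul, abs_mul, abs_mul, abs_of_nonneg hη0,
        abs_of_nonneg hGn]
      calc η * |∑ j, (S y)⁻¹ a j * z j| * (|S x a b - S y a b| * (G * |p b|))
          ≤ η * (L * (L + 1)) * ((n * P * (r * (L + 1))) * (2 * |p b|)) := by
            gcongr
            linarith
        _ = _ := by ring
    refine (Finset.sum_le_sum fun a _ => Finset.sum_le_sum fun b _ => this a b).trans_eq ?_
    simp only [Finset.sum_const, Finset.card_univ, Fintype.card_fin, nsmul_eq_mul, Finset.mul_sum,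
      gradConst]
    exact Finset.sum_congr rfl fun b _ => by ring
  have hsum : ∑ b, gradConst n L P * η * |p b|
      ≤ η ^ 2 / 4 * ((2 * L)⁻¹ * ∑ b, p b ^ 2) + n * (2 * L * gradConst n L P ^ 2) := by
    refine (Finset.sum_le_sum fun b _ => error_le hL).trans_eq ?_
    simp [Finset.sum_add_distrib, Finset.mul_sum]
  have hC' : η ^ 2 / 4 * (2 * C + n * (2 * L * C ^ 2)) ≤ (2 * C + n * (2 * L * C ^ 2)) / 4 := by
    have : η ^ 2 ≤ 1 := pow_le_one₀ hη0 hη1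
    have h2 : 0 ≤ 2 * C + n * (2 * L * C ^ 2) := by positivity
    nlinarith
  have hslope : radialSlope (S y)⁻¹ H y r z = η * ∑ b, z b * (G * p b) := by
    simp only [radialSlope, ← hxdef, ← hη, ← hG, hp]
    congr 1
    rw [Finset.mul_sum]
    exact Finset.sum_congr rfl fun b _ => by ring
  rw [hslope, mul_sub, hsplit]
  simp only [ellPotential, slopeConst]
  rw [← hη]
  nlinarith [mul_le_mul_of_nonneg_left hsum hr.le, mul_le_mul_of_nonneg_left hC' hr.le]

theorem integrable_comp_add_smul {g : EuclideanSpace ℝ (Fin n) → ℝ} (hg : Integrable g)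
    (y : EuclideanSpace ℝ (Fin n)) {r : ℝ} (hr : r ≠ 0) : Integrable fun z => g (y + r • z) :=
  (integrable_comp_smul_iff volume (fun z => g (y + z)) hr).2 (hg.comp_add_left y)

theorem integral_comp_add_smul_nonneg {g : EuclideanSpace ℝ (Fin n) → ℝ} (hg : 0 ≤ ∫ x, g x)
    (y : EuclideanSpace ℝ (Fin n)) (r : ℝ) : 0 ≤ ∫ z, g (y + r • z) := by
  rw [Measure.integral_comp_smul volume (fun z => g (y + z)) r, integral_add_left_eq_self]
  exact smul_nonneg (abs_nonneg _) hg

theorem continuous_radialSlope (h : IsSupersolution L P C S H) (hL : 0 < L)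
    (hy : y ∈ ball 0 1) {r : ℝ} (hr : 0 < r)
    (hR : closedBall y (r * (L + 1)) ⊆ ball 0 1) : Continuous (radialSlope (S y)⁻¹ H y r) := by
  obtain ⟨-, -, hN⟩ := (h.elliptic y hy).inv_bounds hL (h.isSymm y hy)
  refine continuous_ellBump_mul hL (fun z => (hN z).1) fun z hz => ?_
  have hx := isOpen_ball.mem_nhds (add_smul_mem_ball hR hr.le le_rfl hz)
  have hc : ContinuousAt (fun z => y + r • z) z := by fun_prop
  have h1 : ContinuousAt (fun z => H (y + r • z)) z :=
    ContinuousAt.comp (g := H) (h.contDiffOn.continuousOn.continuousAt hx) hc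
  have h2 : ∀ b, ContinuousAt (fun z => dd b H (y + r • z)) z := fun b =>
    ContinuousAt.comp (g := dd b H) ((continuousOn_dd h.contDiffOn b).continuousAt hx) hc
  refine (continuousAt_const.sub h1).mul (tendsto_finsetSum _ fun b _ => ?_)
  exact ContinuousAt.mul (by fun_prop) (h2 b)

theorem integrable_radialSlope (h : IsSupersolution L P C S H) (hL : 0 < L)
    (hy : y ∈ ball 0 1) {r : ℝ} (hr : 0 < r)
    (hR : closedBall y (r * (L + 1)) ⊆ ball 0 1) : Integrable (radialSlope (S y)⁻¹ H y r) := by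
  obtain ⟨-, -, hN⟩ := (h.elliptic y hy).inv_bounds hL (h.isSymm y hy)
  exact (h.continuous_radialSlope hL hy hr hR).integrable_of_hasCompactSupport
    (hasCompactSupport_ellBump hL fun z => (hN z).1).mul_right

theorem integral_radialSlope_le (h : IsSupersolution L P C S H) (hL : 0 < L) (hP : 0 ≤ P)
    (hC : 0 ≤ C) (hy : y ∈ ball 0 1) {r : ℝ} (hr : 0 < r)
    (hR : closedBall y (r * (L + 1)) ⊆ ball 0 1) :
    ∫ z, radialSlope (S y)⁻¹ H y r z
      ≤ volume.real (closedBall (0 : EuclideanSpace ℝ (Fin n)) (L + 1))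
        * (slopeConst n L P C * r) := by
  obtain ⟨-, -, hN⟩ := (h.elliptic y hy).inv_bounds hL (h.isSymm y hy)
  have hψ := isTest_ellPotential hL (fun z => (hN z).1) hr hR
  have h0 := integral_comp_add_smul_nonneg (h.integral_improved_nonneg hL hC hψ
    (fun x => by unfold ellPotential; positivity)) y r
  have i1 := integrable_comp_add_smul (h.integrable_improved hψ) y hr.ne'
  have i2 := h.integrable_radialSlope hL hy hr hR
  have i3 : Integrable ((closedBall (0 : EuclideanSpace ℝ (Fin n)) (L + 1)).indicator
      fun _ => slopeConst n L P C * r) :=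
    (integrable_indicator_iff measurableSet_closedBall).2
      (integrableOn_const measure_closedBall_lt_top.ne)
  have key := integral_mono (i1.const_mul r) (i2.neg.add i3)
    fun z => h.mul_improvedIntegrand_le hL hP hC hy hr hR z
  rw [integral_add' i2.neg i3, integral_const_mul, integral_neg',
    integral_indicator measurableSet_closedBall, setIntegral_const, smul_eq_mul] at key
  have := mul_nonneg hr.le h0
  linarith

end IsSupersolution

end MeanValue

section MeanValueIntegral

open Matrix

variable {n : ℕ}

/-- The weighted mean of `2H - H²/2` at scale `r`. -/
noncomputable def weightedMean (N : Matrix (Fin n) (Fin n) ℝ) (H : EuclideanSpace ℝ (Fin n) → ℝ)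
    (y : EuclideanSpace ℝ (Fin n)) (r : ℝ) : ℝ :=
  ∫ z, ellBump N z * (2 * H (y + r • z) - H (y + r • z) ^ 2 / 2)

namespace IsSupersolution

variable {L P C : ℝ} {S : EuclideanSpace ℝ (Fin n) → Matrix (Fin n) (Fin n) ℝ}
  {H : EuclideanSpace ℝ (Fin n) → ℝ} {y : EuclideanSpace ℝ (Fin n)}

theorem profile_mem (h : IsSupersolution L P C S H) {x : EuclideanSpace ℝ (Fin n)}
    (hx : x ∈ ball 0 1) : H x ≤ 2 * H x - H x ^ 2 / 2 ∧ 2 * H x - H x ^ 2 / 2 ≤ 2 * H x := by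
  have h0 := h.nonneg x hx
  have h1 := h.le_one x hx
  constructor <;> nlinarith

theorem continuous_mean_integrand (h : IsSupersolution L P C S H) (hL : 0 < L)
    (hy : y ∈ ball 0 1) {R r : ℝ} (hr0 : 0 ≤ r) (hr : r ≤ R)
    (hR : closedBall y (R * (L + 1)) ⊆ ball 0 1) :
    Continuous fun z => ellBump (S y)⁻¹ z * (2 * H (y + r • z) - H (y + r • z) ^ 2 / 2) := by
  obtain ⟨-, -, hN⟩ := (h.elliptic y hy).inv_bounds hL (h.isSymm y hy)
  refine continuous_ellBump_mul hL (fun z => (hN z).1) fun z hz => ?_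
  have hx := isOpen_ball.mem_nhds (add_smul_mem_ball hR hr0 hr hz)
  have hc : ContinuousAt (fun z => y + r • z) z := by fun_prop
  have h1 : ContinuousAt (fun z => H (y + r • z)) z :=
    ContinuousAt.comp (g := H) (h.contDiffOn.continuousOn.continuousAt hx) hc
  exact (continuousAt_const.mul h1).sub ((h1.pow 2).div_const 2)

theorem integrable_mean_integrand (h : IsSupersolution L P C S H) (hL : 0 < L)
    (hy : y ∈ ball 0 1) {R r : ℝ} (hr0 : 0 ≤ r) (hr : r ≤ R)
    (hR : closedBall y (R * (L + 1)) ⊆ ball 0 1) :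
    Integrable fun z => ellBump (S y)⁻¹ z * (2 * H (y + r • z) - H (y + r • z) ^ 2 / 2) := by
  obtain ⟨-, -, hN⟩ := (h.elliptic y hy).inv_bounds hL (h.isSymm y hy)
  exact (h.continuous_mean_integrand hL hy hr0 hr hR).integrable_of_hasCompactSupport
    (hasCompactSupport_ellBump hL fun z => (hN z).1).mul_right

theorem continuousOn_weightedMean (h : IsSupersolution L P C S H) (hL : 0 < L)
    (hy : y ∈ ball 0 1) {R : ℝ} (hR : closedBall y (R * (L + 1)) ⊆ ball 0 1) :
    ContinuousOn (weightedMean (S y)⁻¹ H y) (Set.Icc 0 R) := by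
  obtain ⟨-, -, hN⟩ := (h.elliptic y hy).inv_bounds hL (h.isSymm y hy)
  refine continuousOn_of_dominated (bound := fun z => ellBump (S y)⁻¹ z * 2)
    (fun r hr => (h.continuous_mean_integrand hL hy hr.1 hr.2 hR).aestronglyMeasurable)
    (fun r hr => ae_of_all _ fun z => ?_) ?_ (ae_of_all _ fun z => ?_)
  · by_cases hz : z ∈ closedBall 0 (L + 1)
    · have hx := add_smul_mem_ball hR hr.1 hr.2 hz
      have h0 := h.nonneg _ hx
      have h1 := h.le_one _ hx
      have h2 := h.profile_mem hx
      rw [Real.norm_of_nonneg (mul_nonneg (ellBump_nonneg _ _) (by linarith))]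
      exact mul_le_mul_of_nonneg_left (by linarith) (ellBump_nonneg _ _)
    · simp [ellBump_eq_zero_of_notMem_closedBall hL (fun z => (hN z).1) hz]
  · exact (((continuous_ellBump _).integrable_of_hasCompactSupport
      (hasCompactSupport_ellBump hL fun z => (hN z).1))).mul_const 2
  · by_cases hz : z ∈ closedBall 0 (L + 1)
    · intro r hr
      have hx := isOpen_ball.mem_nhds (add_smul_mem_ball hR hr.1 hr.2 hz)
      have hc : ContinuousAt (fun r : ℝ => y + r • z) r := by fun_prop
      have h1 : ContinuousAt (fun r : ℝ => H (y + r • z)) r :=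
        ContinuousAt.comp (g := H) (h.contDiffOn.continuousOn.continuousAt hx) hc
      exact (continuousAt_const.mul
        ((continuousAt_const.mul h1).sub ((h1.pow 2).div_const 2))).continuousWithinAt
    · simp only [ellBump_eq_zero_of_notMem_closedBall hL (fun z => (hN z).1) hz, zero_mul]
      exact continuousOn_const

theorem hasDerivAt_mean_integrand (h : IsSupersolution L P C S H)
    (N : Matrix (Fin n) (Fin n) ℝ) {r : ℝ} {z : EuclideanSpace ℝ (Fin n)}
    (hx : y + r • z ∈ ball 0 1) :
    HasDerivAt (fun r : ℝ => ellBump N z * (2 * H (y + r • z) - H (y + r • z) ^ 2 / 2))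
      (radialSlope N H y r z) r := by
  have h1 : HasDerivAt (fun r : ℝ => y + r • z) z r := by
    simpa using ((hasDerivAt_id r).smul_const z).const_add y
  have h2 : HasDerivAt (fun r : ℝ => H (y + r • z)) (∑ b, z b * dd b H (y + r • z)) r := by
    rw [← fderiv_eq_sum_dd]
    exact (differentiableAt_of_contDiffOn_ball h.contDiffOn hx).hasFDerivAt.comp_hasDerivAt r h1
  refine (((h2.const_mul 2).sub ((h2.pow 2).div_const 2)).const_mul (ellBump N z)).congr_deriv ?_
  simp only [radialSlope]
  ring

theorem hasDerivAt_weightedMean (h : IsSupersolution L P C S H) (hL : 0 < L)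
    (hy : y ∈ ball 0 1) {R r : ℝ} (hr : r ∈ Set.Ioo 0 R)
    (hR : closedBall y (R * (L + 1)) ⊆ ball 0 1) :
    HasDerivAt (weightedMean (S y)⁻¹ H y) (∫ z, radialSlope (S y)⁻¹ H y r z) r := by
  obtain ⟨-, -, hN⟩ := (h.elliptic y hy).inv_bounds hL (h.isSymm y hy)
  have hbump : ∀ z ∉ closedBall 0 (L + 1), ellBump (S y)⁻¹ z = 0 := fun z hz =>
    ellBump_eq_zero_of_notMem_closedBall hL (fun z => (hN z).1) hz
  have hRr : closedBall y (r * (L + 1)) ⊆ ball 0 1 :=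
    (closedBall_subset_closedBall (by nlinarith [hr.2])).trans hR
  obtain ⟨M, hM⟩ := (isCompact_closedBall y (R * (L + 1))).exists_bound_of_continuousOn
    ((h.contDiffOn.continuousOn_fderiv_of_isOpen isOpen_ball le_rfl).mono hR)
  refine (hasDerivAt_integral_of_dominated_loc_of_deriv_le (s := Set.Ioo 0 R)
    (bound := fun z => ellBump (S y)⁻¹ z * (2 * (M * (L + 1))))
    (isOpen_Ioo.mem_nhds hr) ?_ (h.integrable_mean_integrand hL hy hr.1.le hr.2.le hR)
    (h.continuous_radialSlope hL hy hr.1 hRr).aestronglyMeasurable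
    (ae_of_all _ fun z s hs => ?_) ?_ (ae_of_all _ fun z s hs => ?_)).2
  · filter_upwards [isOpen_Ioo.mem_nhds hr] with s hs
    exact (h.continuous_mean_integrand hL hy hs.1.le hs.2.le hR).aestronglyMeasurable
  · by_cases hz : z ∈ closedBall 0 (L + 1)
    · have hx := add_smul_mem_ball hR hs.1.le hs.2.le hz
      have hzn : ‖z‖ ≤ L + 1 := by simpa using hz
      have hx2 : y + s • z ∈ closedBall y (R * (L + 1)) := by
        rw [mem_closedBall, dist_eq_norm, add_sub_cancel_left, norm_smul,
          Real.norm_of_nonneg hs.1.le]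
        exact mul_le_mul hs.2.le hzn (norm_nonneg _) (hs.1.trans hs.2).le
      have h0 := h.nonneg _ hx
      have h1 := h.le_one _ hx
      have hM0 := (norm_nonneg _).trans (hM _ hx2)
      rw [radialSlope, norm_mul, Real.norm_of_nonneg (ellBump_nonneg _ _), norm_mul,
        Real.norm_of_nonneg (by linarith), ← fderiv_eq_sum_dd]
      refine mul_le_mul_of_nonneg_left ?_ (ellBump_nonneg _ _)
      refine mul_le_mul (by linarith) ?_ (norm_nonneg _) (by norm_num)
      exact (ContinuousLinearMap.le_opNorm _ _).trans
        (mul_le_mul (hM _ hx2) hzn (norm_nonneg _) hM0)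
    · simp [radialSlope, hbump z hz]
  · exact (((continuous_ellBump _).integrable_of_hasCompactSupport
      (hasCompactSupport_ellBump hL fun z => (hN z).1))).mul_const _
  · by_cases hz : z ∈ closedBall 0 (L + 1)
    · exact h.hasDerivAt_mean_integrand _ (add_smul_mem_ball hR hs.1.le hs.2.le hz)
    · simp only [radialSlope, hbump z hz, zero_mul]
      exact hasDerivAt_const _ _

theorem weightedMean_le (h : IsSupersolution L P C S H) (hL : 0 < L) (hP : 0 ≤ P)
    (hC : 0 ≤ C) (hy : y ∈ ball 0 1) {R : ℝ} (hR0 : 0 ≤ R)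
    (hR : closedBall y (R * (L + 1)) ⊆ ball 0 1) :
    weightedMean (S y)⁻¹ H y R
      ≤ volume.real (closedBall (0 : EuclideanSpace ℝ (Fin n)) (L + 1))
        * (2 * H y + slopeConst n L P C * R ^ 2 / 2) := by
  obtain ⟨-, -, hN⟩ := (h.elliptic y hy).inv_bounds hL (h.isSymm y hy)
  set V := volume.real (closedBall (0 : EuclideanSpace ℝ (Fin n)) (L + 1)) with hV
  set c := V * slopeConst n L P C with hc
  have hq : ∀ r : ℝ, HasDerivAt (fun r : ℝ => c * r ^ 2 / 2) (c * r) r := fun r => by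
    refine (((hasDerivAt_pow 2 r).const_mul c).div_const 2).congr_deriv ?_
    simp; ring
  have hmono : AntitoneOn (fun r => weightedMean (S y)⁻¹ H y r - c * r ^ 2 / 2) (Set.Icc 0 R) := by
    refine antitoneOn_of_deriv_nonpos (convex_Icc 0 R)
      ((h.continuousOn_weightedMean hL hy hR).sub (by fun_prop)) ?_ ?_
    · rw [interior_Icc]
      exact fun r hr => ((h.hasDerivAt_weightedMean hL hy hr hR).sub
        (hq r)).differentiableAt.differentiableWithinAt
    · rw [interior_Icc]
      intro r hr
      rw [((h.hasDerivAt_weightedMean hL hy hr hR).fun_sub (hq r)).deriv]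
      have := h.integral_radialSlope_le hL hP hC hy hr.1
        ((closedBall_subset_closedBall (by nlinarith [hr.2])).trans hR)
      rw [hc]
      linarith
  have h1 := hmono ⟨le_rfl, hR0⟩ ⟨hR0, le_rfl⟩ hR0
  have h2 : weightedMean (S y)⁻¹ H y 0 ≤ V * (2 * H y) := by
    simp only [weightedMean, zero_smul, add_zero]
    have hp := h.profile_mem hy
    have h0 := h.nonneg y hy
    have i3 : Integrable ((closedBall (0 : EuclideanSpace ℝ (Fin n)) (L + 1)).indicator
        fun _ => 2 * H y) :=
      (integrable_indicator_iff measurableSet_closedBall).2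
        (integrableOn_const measure_closedBall_lt_top.ne)
    have := integral_mono (((continuous_ellBump _).integrable_of_hasCompactSupport
      (hasCompactSupport_ellBump hL fun z => (hN z).1)).mul_const
        (2 * H y - H y ^ 2 / 2)) i3 fun z => ?_
    · rwa [integral_indicator measurableSet_closedBall, setIntegral_const, smul_eq_mul] at this
    · by_cases hz : z ∈ closedBall 0 (L + 1)
      · rw [Set.indicator_of_mem hz]
        have := ellBump_le_one hL (fun z => (hN z).1) z
        have := ellBump_nonneg (S y)⁻¹ z
        simp only
        nlinarith
      · simp [Set.indicator_of_notMem hz,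
          ellBump_eq_zero_of_notMem_closedBall hL (fun z => (hN z).1) hz]
  simp only at h1
  nlinarith

/-- The weak mean value inequality for supersolutions. -/
theorem integral_ball_le (h : IsSupersolution L P C S H) (hL : 0 < L) (hP : 0 ≤ P)
    (hC : 0 ≤ C) (hy : y ∈ ball 0 1) {R : ℝ} (hR0 : 0 ≤ R)
    (hR : closedBall y (R * (L + 1)) ⊆ ball 0 1) :
    ∫ z in ball 0 (L + 1)⁻¹, H (y + R • z)
      ≤ 2 * (volume.real (closedBall (0 : EuclideanSpace ℝ (Fin n)) (L + 1))
        * (2 * H y + slopeConst n L P C * R ^ 2 / 2)) := by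
  obtain ⟨-, -, hN⟩ := (h.elliptic y hy).inv_bounds hL (h.isSymm y hy)
  have key := h.weightedMean_le hL hP hC hy hR0 hR
  have hi := h.integrable_mean_integrand hL hy hR0 le_rfl hR
  have hsub : ball (0 : EuclideanSpace ℝ (Fin n)) (L + 1)⁻¹ ⊆ closedBall 0 (L + 1) := by
    refine ball_subset_closedBall.trans (closedBall_subset_closedBall ?_)
    exact (inv_le_one_of_one_le₀ (by linarith)).trans (by linarith)
  have hle : ∫ z in ball 0 (L + 1)⁻¹, H (y + R • z) ≤ 2 * weightedMean (S y)⁻¹ H y R := by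
    rw [weightedMean, ← integral_const_mul, ← integral_indicator measurableSet_ball]
    refine integral_mono_of_nonneg (ae_of_all _ fun z => ?_) (hi.const_mul 2)
      (ae_of_all _ fun z => ?_)
    · refine Set.indicator_nonneg (fun z hz => ?_) z
      exact h.nonneg _ (add_smul_mem_ball hR hR0 le_rfl (hsub hz))
    · have hη0 := ellBump_nonneg (S y)⁻¹ z
      by_cases hz : z ∈ closedBall 0 (L + 1)
      · have hx := add_smul_mem_ball hR hR0 le_rfl hz
        have h0 := h.nonneg _ hx
        have hp := h.profile_mem hx
        by_cases hz2 : z ∈ ball 0 (L + 1)⁻¹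
        · rw [Set.indicator_of_mem hz2]
          have := half_le_ellBump hL (fun z => (hN z).2.1) (z := z) (by
            simpa using (mem_ball_zero_iff.1 hz2).le)
          nlinarith
        · rw [Set.indicator_of_notMem hz2]
          have := mul_nonneg hη0 (h0.trans hp.1)
          linarith
      · rw [Set.indicator_of_notMem fun hz2 => hz (hsub hz2)]
        simp [ellBump_eq_zero_of_notMem_closedBall hL (fun z => (hN z).1) hz]
  linarith

end IsSupersolution

end MeanValueIntegral

section DensityOfSupersolutions

open Matrix

variable {n : ℕ}

theorem setIntegral_ball_comp_add_smul (f : EuclideanSpace ℝ (Fin n) → ℝ)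
    (y : EuclideanSpace ℝ (Fin n)) {R : ℝ} (hR : 0 < R) (ρ : ℝ) :
    ∫ z in ball 0 ρ, f (y + R • z) = (R ^ n)⁻¹ * ∫ x in ball y (R * ρ), f x := by
  have h1 : ∀ z, (ball 0 ρ).indicator (fun z => f (y + R • z)) z
      = (ball y (R * ρ)).indicator f (y + R • z) := by
    intro z
    have : z ∈ ball 0 ρ ↔ y + R • z ∈ ball y (R * ρ) := by
      rw [mem_ball_zero_iff, mem_ball, dist_eq_norm, add_sub_cancel_left, norm_smul,
        Real.norm_of_nonneg hR.le]
      exact (mul_lt_mul_iff_right₀ hR).symm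
    by_cases hz : z ∈ ball 0 ρ
    · rw [Set.indicator_of_mem hz, Set.indicator_of_mem (this.1 hz)]
    · rw [Set.indicator_of_notMem hz, Set.indicator_of_notMem fun h => hz (this.2 h)]
  rw [← integral_indicator measurableSet_ball, ← integral_indicator measurableSet_ball]
  simp_rw [h1]
  rw [Measure.integral_comp_smul volume (fun z => (ball y (R * ρ)).indicator f (y + z)) R,
    integral_add_left_eq_self, finrank_euclideanSpace_fin, smul_eq_mul,
    abs_of_nonneg (by positivity)]

theorem volume_real_ball_pos (y : EuclideanSpace ℝ (Fin n)) {r : ℝ} (hr : 0 < r) :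
    0 < volume.real (ball y r) :=
  ENNReal.toReal_pos (measure_ball_pos volume y hr).ne' measure_ball_lt_top.ne

/-- The constant in the weak mean value inequality. -/
noncomputable def meanConst (n : ℕ) (L P C : ℝ) : ℝ :=
  2 * (volume.real (closedBall (0 : EuclideanSpace ℝ (Fin n)) (L + 1))
    * (2 + slopeConst n L P C * (L + 1) ^ 2)) /
      volume.real (ball (0 : EuclideanSpace ℝ (Fin n)) (L + 1)⁻¹)

theorem meanConst_nonneg {L P C : ℝ} (hL : 0 < L) (hC : 0 ≤ C) : 0 ≤ meanConst n L P C := by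
  have := slopeConst_nonneg (n := n) (P := P) hL hC
  unfold meanConst
  positivity

/-- A supersolution that is small at a point is small on most of the surrounding ball. -/
theorem IsSupersolution.mul_volume_le {L P C : ℝ}
    {S : EuclideanSpace ℝ (Fin n) → Matrix (Fin n) (Fin n) ℝ} {H : EuclideanSpace ℝ (Fin n) → ℝ}
    (h : IsSupersolution L P C S H) (hL : 0 < L) (hP : 0 ≤ P) (hC : 0 ≤ C)
    {y : EuclideanSpace ℝ (Fin n)} {r κ : ℝ} (hr : 0 < r)
    (hy : closedBall y (r * (L + 1) ^ 2) ⊆ ball 0 1) :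
    κ * volume.real (ball y r ∩ {x | κ ≤ H x})
      ≤ meanConst n L P C * (H y + r ^ 2) * volume.real (ball y r) := by
  have hL1 : 0 < L + 1 := by linarith
  have hR : 0 < r * (L + 1) := by positivity
  have hyB : y ∈ ball (0 : EuclideanSpace ℝ (Fin n)) 1 :=
    hy (mem_closedBall_self (by positivity))
  have key := h.integral_ball_le hL hP hC hyB hR.le (by
    rwa [mul_assoc, ← sq])
  have hρ : r * (L + 1) * (L + 1)⁻¹ = r := by field_simp
  rw [setIntegral_ball_comp_add_smul H y hR, hρ] at key
  have hvol := setIntegral_ball_comp_add_smul (fun _ => (1 : ℝ)) y hR (L + 1)⁻¹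
  rw [hρ, setIntegral_const, setIntegral_const, smul_eq_mul, smul_eq_mul, mul_one, mul_one] at hvol
  have hV0 := volume_real_ball_pos (0 : EuclideanSpace ℝ (Fin n)) (inv_pos.2 hL1)
  have hsub : ball y r ⊆ ball 0 1 := by
    refine ball_subset_closedBall.trans ((closedBall_subset_closedBall ?_).trans hy)
    nlinarith
  have hint : IntegrableOn H (ball y r) := by
    refine ((h.contDiffOn.continuousOn.mono ?_).integrableOn_compact
      (isCompact_closedBall y r)).mono_set ball_subset_closedBall
    refine (closedBall_subset_closedBall ?_).trans hy
    nlinarith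
  have hmarkov := mul_meas_ge_le_integral_of_nonneg
    ((ae_restrict_iff' measurableSet_ball).2
      (ae_of_all volume fun x (hx : x ∈ ball y r) => h.nonneg x (hsub hx))) hint κ
  rw [measureReal_restrict_apply' measurableSet_ball, Set.inter_comm] at hmarkov
  refine hmarkov.trans ?_
  have hRn : 0 < (r * (L + 1)) ^ n := by positivity
  rw [inv_mul_le_iff₀ hRn] at key
  have hb : volume.real (ball y r)
      = (r * (L + 1)) ^ n * volume.real (ball (0 : EuclideanSpace ℝ (Fin n)) (L + 1)⁻¹) := by
    rw [hvol, ← mul_assoc, mul_inv_cancel₀ hRn.ne', one_mul]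
  refine key.trans ?_
  rw [hb, meanConst]
  have hs := slopeConst_nonneg (n := n) (P := P) hL hC
  have h0 := h.nonneg y hyB
  rw [show ∀ A V X Q : ℝ, A / V * X * (Q * V) = Q * (A * X) * (V / V) by intros; ring,
    div_self hV0.ne', mul_one]
  refine mul_le_mul_of_nonneg_left ?_ hRn.le
  rw [mul_assoc 2, mul_assoc (volume.real _)]
  refine mul_le_mul_of_nonneg_left (mul_le_mul_of_nonneg_left ?_ measureReal_nonneg) zero_le_two
  have e1 : 0 ≤ slopeConst n L P C * (L + 1) ^ 2 * H y := by positivity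
  have e2 : 0 ≤ slopeConst n L P C * (L + 1) ^ 2 * r ^ 2 := by positivity
  nlinarith [sq_nonneg r]

end DensityOfSupersolutions

section SortedEigenvalues

open Matrix

variable {n : ℕ}

theorem eq_of_prod_X_sub_C_eq {d l : Fin n → ℝ} (hd : Monotone d) (hl : Monotone l)
    (h : ∏ i, (Polynomial.X - Polynomial.C (d i)) = ∏ i, (Polynomial.X - Polynomial.C (l i))) :
    d = l := by
  have key : ∀ f : Fin n → ℝ, (∏ i, (Polynomial.X - Polynomial.C (f i))).roots
      = Finset.univ.val.map f := by
    intro f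
    rw [← Polynomial.roots_multiset_prod_X_sub_C (Finset.univ.val.map f), Multiset.map_map]
    rfl
  have h2 := congrArg Polynomial.roots h
  rw [key, key, Fin.univ_val_map, Fin.univ_val_map, Multiset.coe_eq_coe] at h2
  exact List.ofFn_injective (h2.eq_of_pairwise' hd.sortedLE_ofFn.pairwise
    hl.sortedLE_ofFn.pairwise)

theorem prod_X_sub_C_comp_perm (d : Fin n → ℝ) (σ : Equiv.Perm (Fin n)) :
    ∏ i, (Polynomial.X - Polynomial.C (d (σ i))) = ∏ i, (Polynomial.X - Polynomial.C (d i)) :=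
  Equiv.prod_comp σ fun i => Polynomial.X - Polynomial.C (d i)

theorem exists_sorted_diagonalization {A : Matrix (Fin n) (Fin n) ℝ} (hA : A.IsSymm)
    {l : Fin n → ℝ} (hl : Monotone l)
    (h : A.charpoly = ∏ i, (Polynomial.X - Polynomial.C (l i))) :
    ∃ U : Matrix (Fin n) (Fin n) ℝ, Uᵀ * U = 1 ∧ U * Uᵀ = 1 ∧ A = U * diagonal l * Uᵀ := by
  obtain ⟨U, d, h1, h2, h3⟩ := exists_orthogonal_diagonalization hA
  have hc : A.charpoly = ∏ i, (Polynomial.X - Polynomial.C (d i)) := by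
    rw [h3, charpoly_mul_comm, ← mul_assoc, h1, one_mul, charpoly_diagonal]
  have hs : d ∘ Tuple.sort d = l := by
    refine eq_of_prod_X_sub_C_eq (Tuple.monotone_sort d) hl ?_
    rw [← h, hc]
    exact prod_X_sub_C_comp_perm d _
  set σ := Tuple.sort d
  refine ⟨U.submatrix id σ, ?_, ?_, ?_⟩
  · rw [transpose_submatrix, ← submatrix_mul _ _ σ id σ Function.bijective_id, h1,
      submatrix_one_equiv]
  · rw [transpose_submatrix, ← submatrix_mul _ _ id σ id σ.bijective, h2, submatrix_id_id]
  · rw [← hs, ← submatrix_diagonal_equiv d σ, transpose_submatrix,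
      ← submatrix_mul _ _ id σ σ σ.bijective, ← submatrix_mul _ _ id σ id σ.bijective, ← h3,
      submatrix_id_id]

/-- Rearrangement: weights in `[0, 1]` of fixed total mass are cheapest on the lowest values. -/
theorem sum_Iic_le_sum_mul {μ p : Fin n → ℝ} (hμ : Monotone μ) (hp0 : ∀ j, 0 ≤ p j)
    (hp1 : ∀ j, p j ≤ 1) (ℓ : Fin n) (hp : ∑ j, p j = (Finset.Iic ℓ).card) :
    ∑ j ∈ Finset.Iic ℓ, μ j ≤ ∑ j, μ j * p j := by
  have h1 : ∀ j, 0 ≤ (μ j - μ ℓ) * (p j - if j ∈ Finset.Iic ℓ then 1 else 0) := by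
    intro j
    by_cases hj : j ∈ Finset.Iic ℓ
    · rw [if_pos hj]
      exact mul_nonneg_of_nonpos_of_nonpos
        (sub_nonpos.2 (hμ (Finset.mem_Iic.1 hj))) (sub_nonpos.2 (hp1 j))
    · rw [if_neg hj, sub_zero]
      rw [Finset.mem_Iic, not_le] at hj
      exact mul_nonneg (sub_nonneg.2 (hμ hj.le)) (hp0 j)
  have h2 := Finset.sum_nonneg fun j (_ : j ∈ Finset.univ) => h1 j
  have h3 : ∑ j, (if j ∈ Finset.Iic ℓ then (1 : ℝ) else 0) = (Finset.Iic ℓ).card := by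
    rw [Finset.sum_ite_mem]
    simp
  have h4 : ∑ j, μ j * (if j ∈ Finset.Iic ℓ then (1 : ℝ) else 0) = ∑ j ∈ Finset.Iic ℓ, μ j := by
    simp only [mul_ite, mul_one, mul_zero]
    rw [Finset.sum_ite_mem, Finset.univ_inter]
  simp only [sub_mul, mul_sub, Finset.sum_sub_distrib, ← Finset.mul_sum] at h2
  rw [h3, h4, hp] at h2
  linarith

theorem dotProduct_conj_diagonal (U : Matrix (Fin n) (Fin n) ℝ) (μ e : Fin n → ℝ) :
    e ⬝ᵥ (U * diagonal μ * Uᵀ) *ᵥ e = ∑ j, μ j * (Uᵀ *ᵥ e) j ^ 2 := by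
  rw [← mulVec_mulVec, ← mulVec_mulVec, dotProduct_mulVec, ← mulVec_transpose]
  simp only [dotProduct, mulVec_diagonal]
  exact Finset.sum_congr rfl fun j _ => by ring

theorem sum_Iic_le_sum_quadratic {U V : Matrix (Fin n) (Fin n) ℝ} (hU : Uᵀ * U = 1)
    (hU2 : U * Uᵀ = 1) (hV : Vᵀ * V = 1) (hV2 : V * Vᵀ = 1) {μ : Fin n → ℝ} (hμ : Monotone μ)
    (ℓ : Fin n) : ∑ j ∈ Finset.Iic ℓ, μ j
      ≤ ∑ i ∈ Finset.Iic ℓ, (fun a => V a i) ⬝ᵥ (U * diagonal μ * Uᵀ) *ᵥ (fun a => V a i) := by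
  set W := Uᵀ * V with hW
  have hcol : ∀ i j, (Uᵀ *ᵥ fun a => V a i) j = W j i := fun i j => rfl
  have hW1 : Wᵀ * W = 1 := by
    rw [hW, transpose_mul, transpose_transpose, mul_assoc, ← mul_assoc U, hU2, one_mul, hV]
  have hW2 : W * Wᵀ = 1 := by
    rw [hW, transpose_mul, transpose_transpose, mul_assoc, ← mul_assoc V, hV2, one_mul, hU]
  have hrow : ∀ j, ∑ i, W j i ^ 2 = 1 := fun j => by
    have := congrFun (congrFun hW2 j) j
    simpa [mul_apply, sq] using this
  have hcolsum : ∀ i, ∑ j, W j i ^ 2 = 1 := fun i => by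
    have := congrFun (congrFun hW1 i) i
    simpa [mul_apply, sq] using this
  refine (sum_Iic_le_sum_mul hμ (p := fun j => ∑ i ∈ Finset.Iic ℓ, W j i ^ 2)
    (fun j => Finset.sum_nonneg fun _ _ => sq_nonneg _)
    (fun j => ?_) ℓ ?_).trans_eq ?_
  · rw [← hrow j]
    exact Finset.sum_le_univ_sum_of_nonneg fun _ => sq_nonneg _
  · rw [Finset.sum_comm]
    simp [hcolsum]
  · simp only [dotProduct_conj_diagonal, hcol, Finset.mul_sum]
    rw [Finset.sum_comm]

theorem inv_conj_diagonal_add {U : Matrix (Fin n) (Fin n) ℝ} (hU : Uᵀ * U = 1)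
    (hU2 : U * Uᵀ = 1) {l : Fin n → ℝ} {τ : ℝ} (hl : ∀ i, l i + τ ≠ 0) :
    (U * diagonal l * Uᵀ + τ • (1 : Matrix (Fin n) (Fin n) ℝ))⁻¹
      = U * diagonal (fun i => (l i + τ)⁻¹) * Uᵀ := by
  have h1 : U * diagonal l * Uᵀ + τ • (1 : Matrix (Fin n) (Fin n) ℝ)
      = U * diagonal (fun i => l i + τ) * Uᵀ := by
    rw [← diagonal_add l fun _ => τ, mul_add, add_mul,
      show diagonal (fun _ : Fin n => τ) = τ • 1 from (smul_one_eq_diagonal τ).symm]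
    rw [Matrix.mul_smul, mul_one, smul_mul_assoc, hU2]
  rw [h1]
  refine inv_eq_right_inv ?_
  calc U * diagonal (fun i => l i + τ) * Uᵀ * (U * diagonal (fun i => (l i + τ)⁻¹) * Uᵀ)
      = U * diagonal (fun i => l i + τ) * (Uᵀ * U) * diagonal (fun i => (l i + τ)⁻¹) * Uᵀ := by
        simp only [mul_assoc]
    _ = U * (diagonal (fun i => l i + τ) * diagonal (fun i => (l i + τ)⁻¹)) * Uᵀ := by
        rw [hU, mul_one, mul_assoc U]
    _ = 1 := by
        rw [diagonal_mul_diagonal]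
        simp only [mul_inv_cancel₀ (hl _)]
        rw [diagonal_one, mul_one, hU2]

theorem smoothedForm_eq_quadratic {u : EuclideanSpace ℝ (Fin n) → ℝ}
    {x : EuclideanSpace ℝ (Fin n)} {U : Matrix (Fin n) (Fin n) ℝ} (hU : Uᵀ * U = 1)
    (hU2 : U * Uᵀ = 1) {l : Fin n → ℝ} (hl : ∀ i, 0 ≤ l i) (h : hessM u x = U * diagonal l * Uᵀ)
    {τ : ℝ} (hτ : 0 < τ) {e : Fin n → ℝ} (he : e ⬝ᵥ e = 1) :
    smoothedForm u τ e x = e ⬝ᵥ (U * diagonal (fun i => l i / (l i + τ)) * Uᵀ) *ᵥ e := by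
  have hne : ∀ i, l i + τ ≠ 0 := fun i => by have := hl i; positivity
  have h1 : e ⬝ᵥ e = ∑ j, (Uᵀ *ᵥ e) j ^ 2 := by
    have := dotProduct_conj_diagonal U (fun _ => 1) e
    rw [diagonal_one, mul_one, hU2, one_mulVec] at this
    simpa using this
  rw [smoothedForm, resolv, h, inv_conj_diagonal_add hU hU2 hne, dotProduct_conj_diagonal,
    dotProduct_conj_diagonal, ← he, h1, Finset.mul_sum, ← Finset.sum_sub_distrib]
  refine Finset.sum_congr rfl fun j _ => ?_
  have := hne j
  field_simp
  ring

theorem conj_diagonal_col {U : Matrix (Fin n) (Fin n) ℝ} (hU : Uᵀ * U = 1) (μ : Fin n → ℝ)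
    (i : Fin n) : (fun a => U a i) ⬝ᵥ (U * diagonal μ * Uᵀ) *ᵥ (fun a => U a i) = μ i := by
  have : ∀ j, (Uᵀ *ᵥ fun a => U a i) j = (1 : Matrix (Fin n) (Fin n) ℝ) j i := fun j => by
    rw [← hU]; rfl
  rw [dotProduct_conj_diagonal]
  simp [this, one_apply]

theorem col_dotProduct_col {U : Matrix (Fin n) (Fin n) ℝ} (hU : Uᵀ * U = 1) (i : Fin n) :
    (fun a => U a i) ⬝ᵥ (fun a => U a i) = 1 := by
  have := congrFun (congrFun hU i) i
  simpa [mul_apply, dotProduct] using this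

end SortedEigenvalues

section EigenvalueDensity

open Matrix

variable {n : ℕ}

/-- `lam` lists the nonnegative eigenvalues of the Hessian of `u` in increasing order. -/
structure IsSpectrum (u : EuclideanSpace ℝ (Fin n) → ℝ)
    (lam : EuclideanSpace ℝ (Fin n) → Fin n → ℝ) : Prop where
  monotone : ∀ x ∈ ball 0 1, Monotone (lam x)
  nonneg : ∀ x ∈ ball 0 1, ∀ i, 0 ≤ lam x i
  charpoly : ∀ x ∈ ball 0 1,
    (hessM u x).charpoly = ∏ i, (Polynomial.X - Polynomial.C (lam x i))

theorem quadratic_le_sum_abs (M : Matrix (Fin n) (Fin n) ℝ) {e : Fin n → ℝ} (he : e ⬝ᵥ e = 1) :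
    e ⬝ᵥ M *ᵥ e ≤ ∑ a, ∑ b, |M a b| := by
  have h1 : ∀ a, |e a| ≤ 1 := fun a => by
    refine abs_le_one_iff_mul_self_le_one.2 ?_
    rw [← he]
    exact Finset.single_le_sum (f := fun i => e i * e i) (fun _ _ => mul_self_nonneg _)
      (Finset.mem_univ a)
  simp only [dotProduct, mulVec, Finset.mul_sum]
  refine Finset.sum_le_sum fun a _ => Finset.sum_le_sum fun b _ => (le_abs_self _).trans ?_
  rw [abs_mul, abs_mul]
  calc |e a| * (|M a b| * |e b|) ≤ 1 * (|M a b| * 1) := by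
        gcongr
        · exact h1 a
        · exact h1 b
    _ = |M a b| := by ring

namespace IsSpectrum

variable {u : EuclideanSpace ℝ (Fin n) → ℝ} {lam : EuclideanSpace ℝ (Fin n) → Fin n → ℝ}

theorem exists_diagonalization (hs : IsSpectrum u lam) (hu : ContDiffOn ℝ 3 u (ball 0 1))
    {x : EuclideanSpace ℝ (Fin n)} (hx : x ∈ ball 0 1) :
    ∃ U : Matrix (Fin n) (Fin n) ℝ, Uᵀ * U = 1 ∧ U * Uᵀ = 1 ∧
      hessM u x = U * diagonal (lam x) * Uᵀ :=
  exists_sorted_diagonalization (isSymm_hessM hu hx) (hs.monotone x hx) (hs.charpoly x hx)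

theorem posSemidef (hs : IsSpectrum u lam) (hu : ContDiffOn ℝ 3 u (ball 0 1))
    {x : EuclideanSpace ℝ (Fin n)} (hx : x ∈ ball 0 1) : (hessM u x).PosSemidef := by
  obtain ⟨U, -, -, h⟩ := hs.exists_diagonalization hu hx
  rw [h, ← conjTranspose_eq_transpose_of_trivial]
  exact (posSemidef_diagonal_iff.2 (hs.nonneg x hx)).mul_mul_conjTranspose_same U

theorem sum_Iic_sub_le (hs : IsSpectrum u lam) (hu : ContDiffOn ℝ 3 u (ball 0 1))
    {x y : EuclideanSpace ℝ (Fin n)} (hx : x ∈ ball 0 1) (hy : y ∈ ball 0 1) (ℓ : Fin n) :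
    ∑ j ∈ Finset.Iic ℓ, lam x j - ∑ j ∈ Finset.Iic ℓ, lam y j
      ≤ (Finset.Iic ℓ).card * ∑ a, ∑ b, |hessM u x a b - hessM u y a b| := by
  obtain ⟨U, hU, hU2, h1⟩ := hs.exists_diagonalization hu hx
  obtain ⟨V, hV, hV2, h2⟩ := hs.exists_diagonalization hu hy
  have key := sum_Iic_le_sum_quadratic hU hU2 hV hV2 (hs.monotone x hx) ℓ
  rw [← h1] at key
  have h3 : ∀ i, lam y i = (fun a => V a i) ⬝ᵥ hessM u y *ᵥ (fun a => V a i) := fun i => by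
    rw [h2, conj_diagonal_col hV]
  rw [Finset.sum_congr rfl fun j (_ : j ∈ Finset.Iic ℓ) => h3 j]
  refine (sub_le_sub_right key _).trans ?_
  rw [← Finset.sum_sub_distrib, ← nsmul_eq_mul, ← Finset.sum_const]
  refine Finset.sum_le_sum fun i _ => ?_
  rw [← dotProduct_sub, ← sub_mulVec]
  exact quadratic_le_sum_abs _ (col_dotProduct_col hV i)

theorem continuousOn_sum_Iic (hs : IsSpectrum u lam) (hu : ContDiffOn ℝ 3 u (ball 0 1))
    (ℓ : Fin n) : ContinuousOn (fun x => ∑ j ∈ Finset.Iic ℓ, lam x j) (ball 0 1) := by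
  intro y hy
  have h0 : ContinuousWithinAt (fun x => ((Finset.Iic ℓ).card : ℝ) *
      ∑ a, ∑ b, |hessM u x a b - hessM u y a b|) (ball 0 1) y :=
    continuousWithinAt_const.mul (tendsto_finsetSum _ fun a _ => tendsto_finsetSum _ fun b _ =>
      (((contDiffOn_hessM hu a b).continuousOn y hy).sub continuousWithinAt_const).abs)
  unfold ContinuousWithinAt at h0 ⊢
  simp only [sub_self, abs_zero, Finset.sum_const_zero, mul_zero] at h0
  rw [tendsto_iff_norm_sub_tendsto_zero]
  refine squeeze_zero' (Filter.Eventually.of_forall fun _ => norm_nonneg _) ?_ h0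
  filter_upwards [self_mem_nhdsWithin] with x hx
  refine abs_sub_le_iff.2 ⟨hs.sum_Iic_sub_le hu hx hy ℓ, ?_⟩
  refine (hs.sum_Iic_sub_le hu hy hx ℓ).trans_eq ?_
  simp only [abs_sub_comm]

theorem continuousOn_eigenvalue (hs : IsSpectrum u lam) (hu : ContDiffOn ℝ 3 u (ball 0 1))
    (ℓ : Fin n) : ContinuousOn (fun x => lam x ℓ) (ball 0 1) := by
  have h1 : ∀ x, lam x ℓ = ∑ j ∈ Finset.Iic ℓ, lam x j - ∑ j ∈ Finset.Iio ℓ, lam x j := fun x => by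
    rw [← Finset.Iio_insert, Finset.sum_insert (by simp)]
    ring
  simp_rw [h1]
  refine (hs.continuousOn_sum_Iic hu ℓ).sub ?_
  obtain ⟨k, hk⟩ := ℓ
  rcases k with _ | k
  · have : Finset.Iio (⟨0, hk⟩ : Fin n) = ∅ := by
      ext j; simp [Fin.lt_def]
    simp only [this, Finset.sum_empty]
    exact continuousOn_const
  · have : Finset.Iio (⟨k + 1, hk⟩ : Fin n) = Finset.Iic ⟨k, by omega⟩ := by
      ext j; simp [Fin.lt_def, Fin.le_def]
    rw [this]
    exact hs.continuousOn_sum_Iic hu _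

theorem eigenvalue_div_le (hs : IsSpectrum u lam) (hu : ContDiffOn ℝ 3 u (ball 0 1))
    {x : EuclideanSpace ℝ (Fin n)} (hx : x ∈ ball 0 1) {V : Matrix (Fin n) (Fin n) ℝ}
    (hV : Vᵀ * V = 1) (hV2 : V * Vᵀ = 1) {τ : ℝ} (hτ : 0 < τ) (ℓ : Fin n) :
    lam x ℓ / (lam x ℓ + τ)
      ≤ ∑ i ∈ Finset.Iic ℓ, smoothedForm u τ (fun a => V a i) x := by
  obtain ⟨U, hU, hU2, h1⟩ := hs.exists_diagonalization hu hx
  have hl := hs.nonneg x hx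
  have hmono : Monotone fun i => lam x i / (lam x i + τ) := fun i j hij => by
    have h2 := hs.monotone x hx hij
    have h3 := hl i
    have h4 := hl j
    simp only
    rw [div_le_div_iff₀ (by positivity) (by positivity)]
    nlinarith
  simp_rw [fun i => smoothedForm_eq_quadratic hU hU2 hl h1 hτ (col_dotProduct_col hV i)]
  refine le_trans ?_ (sum_Iic_le_sum_quadratic hU hU2 hV hV2 hmono ℓ)
  exact Finset.single_le_sum (f := fun i => lam x i / (lam x i + τ))
    (fun i _ => div_nonneg (hl i) (by have := hl i; positivity)) (Finset.mem_Iic.2 le_rfl)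

end IsSpectrum

theorem weakConst_nonneg {L K τmax : ℝ} (hL : 0 < L) (hK : 0 ≤ K) (hτ : 0 ≤ τmax) :
    0 ≤ weakConst n L K τmax := by
  unfold weakConst
  positivity

/-- If the eigenvalue `lam · ℓ` is much smaller than `τ` at a point, then it is below `τ` on most
of the surrounding balls. -/
theorem IsAdmissible.volume_eigenvalue_le {L K τmax τ : ℝ} {F : Jet n → ℝ}
    {u : EuclideanSpace ℝ (Fin n) → ℝ} {lam : EuclideanSpace ℝ (Fin n) → Fin n → ℝ}
    (h : IsAdmissible L K F u) (hs : IsSpectrum u lam) (hL : 0 < L) (hK : 0 ≤ K) (hτ : 0 < τ)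
    (hτm : τ ≤ τmax) (ℓ : Fin n) {y : EuclideanSpace ℝ (Fin n)} {r : ℝ} (hr : 0 < r)
    (hy : closedBall y (r * (L + 1) ^ 2) ⊆ ball 0 1) :
    volume.real (ball y r ∩ {x | τ ≤ lam x ℓ})
      ≤ 2 * n ^ 2 * meanConst n L (K * (K + 1)) (weakConst n L K τmax)
        * (lam y ℓ / τ + r ^ 2) * volume.real (ball y r) := by
  have hn : 0 < n := ℓ.pos
  have hyB : y ∈ ball (0 : EuclideanSpace ℝ (Fin n)) 1 :=
    hy (mem_closedBall_self (by positivity))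
  have hsub : ball y r ⊆ ball 0 1 := by
    refine ball_subset_closedBall.trans ((closedBall_subset_closedBall ?_).trans hy)
    exact le_mul_of_one_le_right hr.le (one_le_pow₀ (by linarith))
  have hC : 0 ≤ weakConst n L K τmax := weakConst_nonneg hL hK (hτ.le.trans hτm)
  set M := meanConst n L (K * (K + 1)) (weakConst n L K τmax) with hM
  have hM0 : 0 ≤ M := meanConst_nonneg hL hC
  obtain ⟨V, hV, hV2, hy2⟩ := hs.exists_diagonalization h.contDiffOn_u hyB
  have hly := hs.nonneg y hyB
  have hsmall : ∀ i ∈ Finset.Iic ℓ,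
      volume.real (ball y r ∩ {x | (2 * n : ℝ)⁻¹ ≤ smoothedForm u τ (fun a => V a i) x})
        ≤ 2 * n * (M * (lam y ℓ / τ + r ^ 2) * volume.real (ball y r)) := by
    intro i hi
    have he := col_dotProduct_col hV i
    have h1 := (h.isSupersolution hL hK hτ hτm he).mul_volume_le hL (by positivity) hC
      (κ := (2 * n : ℝ)⁻¹) hr hy
    rw [smoothedForm_eq_quadratic hV hV2 hly hy2 hτ he, conj_diagonal_col hV,
      inv_mul_le_iff₀ (by positivity)] at h1
    refine h1.trans ?_
    have h2 : lam y i / (lam y i + τ) ≤ lam y ℓ / τ := by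
      have := hly i
      exact div_le_div₀ (hly ℓ) (hs.monotone y hyB (Finset.mem_Iic.1 hi)) hτ (by linarith)
    gcongr
  have hcover : ball y r ∩ {x | τ ≤ lam x ℓ} ⊆ ⋃ i ∈ Finset.Iic ℓ,
      ball y r ∩ {x | (2 * n : ℝ)⁻¹ ≤ smoothedForm u τ (fun a => V a i) x} := by
    intro x hx
    by_contra hcon
    have hlt : ∀ i ∈ Finset.Iic ℓ, smoothedForm u τ (fun a => V a i) x < (2 * n : ℝ)⁻¹ := by
      intro i hi
      by_contra h3
      exact hcon (Set.mem_biUnion hi ⟨hx.1, not_lt.1 h3⟩)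
    have h4 := hs.eigenvalue_div_le h.contDiffOn_u (hsub hx.1) hV hV2 hτ ℓ
    have h5 : ∑ i ∈ Finset.Iic ℓ, smoothedForm u τ (fun a => V a i) x
        < ∑ _i ∈ Finset.Iic ℓ, (2 * n : ℝ)⁻¹ :=
      Finset.sum_lt_sum_of_nonempty ⟨ℓ, Finset.mem_Iic.2 le_rfl⟩ hlt
    have h6 : ∑ _i ∈ Finset.Iic ℓ, (2 * n : ℝ)⁻¹ ≤ 1 / 2 := by
      rw [Finset.sum_const, nsmul_eq_mul]
      have : ((Finset.Iic ℓ).card : ℝ) ≤ n := by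
        exact_mod_cast (Finset.card_le_univ _).trans_eq (Fintype.card_fin n)
      calc ((Finset.Iic ℓ).card : ℝ) * (2 * n : ℝ)⁻¹ ≤ n * (2 * n : ℝ)⁻¹ := by gcongr
        _ = 1 / 2 := by
          have : (n : ℝ) ≠ 0 := by positivity
          field_simp
    have h7 : (1 : ℝ) / 2 ≤ lam x ℓ / (lam x ℓ + τ) := by
      have h8 := hs.nonneg x (hsub hx.1) ℓ
      have h9 : τ ≤ lam x ℓ := hx.2
      rw [div_le_div_iff₀ (by norm_num) (by positivity)]
      linarith
    linarith
  have hfin : volume (⋃ i ∈ Finset.Iic ℓ,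
      ball y r ∩ {x | (2 * n : ℝ)⁻¹ ≤ smoothedForm u τ (fun a => V a i) x}) ≠ ⊤ := by
    exact ((measure_mono (Set.iUnion₂_subset fun i _ => Set.inter_subset_left)).trans_lt
      (measure_ball_lt_top (x := y) (r := r))).ne
  refine (measureReal_mono hcover hfin).trans ((measureReal_biUnion_finset_le _ _).trans
    ((Finset.sum_le_sum hsmall).trans ?_))
  rw [Finset.sum_const, nsmul_eq_mul]
  have hcard : ((Finset.Iic ℓ).card : ℝ) ≤ n := by
    exact_mod_cast (Finset.card_le_univ _).trans_eq (Fintype.card_fin n)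
  have h0 : 0 ≤ lam y ℓ / τ := div_nonneg (hly ℓ) hτ.le
  calc ((Finset.Iic ℓ).card : ℝ) * (2 * n * (M * (lam y ℓ / τ + r ^ 2) * volume.real (ball y r)))
      ≤ n * (2 * n * (M * (lam y ℓ / τ + r ^ 2) * volume.real (ball y r))) := by gcongr
    _ = _ := by ring

end EigenvalueDensity

section DensityDecay

variable {n : ℕ}

theorem volume_real_ball (y : EuclideanSpace ℝ (Fin n)) {r : ℝ} (hr : 0 < r) :
    volume.real (ball y r) = r ^ n * volume.real (ball (0 : EuclideanSpace ℝ (Fin n)) 1) := by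
  rw [Measure.real, Measure.addHaar_ball_of_pos _ _ hr, ENNReal.toReal_mul,
    ENNReal.toReal_ofReal (by positivity), finrank_euclideanSpace_fin, Measure.real]

/-- The superlevel sets of `f` have small density in the small balls around the points of the
ball of radius `1/2` at which `f` is comparatively small. -/
structure HasDensityDecay (δ r₁ : ℝ) (f : EuclideanSpace ℝ (Fin n) → ℝ) : Prop where
  continuousOn : ContinuousOn f (ball 0 1)
  nonneg : ∀ x ∈ ball 0 1, 0 ≤ f x
  density : ∀ y ∈ closedBall (0 : EuclideanSpace ℝ (Fin n)) (1 / 2), ∀ r, 0 < r → r ≤ r₁ →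
    ∀ t, 0 < t → f y ≤ δ * t →
    volume.real (ball y r ∩ {x | t ≤ f x}) ≤ 1 / 2 * (1 / 16) ^ n * volume.real (ball y r)

/-- The part of the superlevel set of `f` in the closed ball of radius `1/2`. -/
def superlevel (f : EuclideanSpace ℝ (Fin n) → ℝ) (t : ℝ) : Set (EuclideanSpace ℝ (Fin n)) :=
  closedBall 0 (1 / 2) ∩ {x | t < f x}

theorem superlevel_subset (f : EuclideanSpace ℝ (Fin n) → ℝ) (t : ℝ) :
    superlevel f t ⊆ closedBall 0 (1 / 2) := Set.inter_subset_left

theorem volume_superlevel_ne_top (f : EuclideanSpace ℝ (Fin n) → ℝ) (t : ℝ) :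
    volume (superlevel f t) ≠ ⊤ :=
  measure_ne_top_of_subset (superlevel_subset f t) measure_closedBall_lt_top.ne

theorem volume_real_ball_inter_closedBall {z : EuclideanSpace ℝ (Fin n)}
    (hz : z ∈ closedBall (0 : EuclideanSpace ℝ (Fin n)) (1 / 2)) {r : ℝ} (hr : 0 < r)
    (hr1 : r ≤ 1) :
    (1 / 2) ^ n * volume.real (ball z r) ≤ volume.real (ball z r ∩ closedBall 0 (1 / 2)) := by
  have hz' : ‖z‖ ≤ 1 / 2 := by simpa using hz
  have hsub : ball ((1 - r) • z) (r / 2) ⊆ ball z r ∩ closedBall 0 (1 / 2) := by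
    intro w hw
    rw [mem_ball, dist_eq_norm] at hw
    constructor
    · rw [mem_ball, dist_eq_norm]
      have h1 : w - z = (w - (1 - r) • z) - r • z := by module
      have h2 : ‖r • z‖ ≤ r * (1 / 2) := by
        rw [norm_smul, Real.norm_of_nonneg hr.le]
        exact mul_le_mul_of_nonneg_left hz' hr.le
      rw [h1]
      linarith [norm_sub_le (w - (1 - r) • z) (r • z)]
    · rw [mem_closedBall_zero_iff]
      have h1 : w = (w - (1 - r) • z) + (1 - r) • z := by module
      have h2 : ‖(1 - r) • z‖ ≤ (1 - r) * (1 / 2) := by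
        rw [norm_smul, Real.norm_of_nonneg (by linarith)]
        exact mul_le_mul_of_nonneg_left hz' (by linarith)
      rw [h1]
      linarith [norm_add_le (w - (1 - r) • z) ((1 - r) • z)]
  refine le_trans (le_of_eq ?_) (measureReal_mono hsub
    (measure_ne_top_of_subset Set.inter_subset_left measure_ball_lt_top.ne))
  rw [volume_real_ball _ hr, volume_real_ball _ (half_pos hr), ← mul_assoc, ← mul_pow]
  congr 2
  ring

namespace HasDensityDecay

variable {δ r₁ : ℝ} {f : EuclideanSpace ℝ (Fin n) → ℝ}

theorem measurableSet_superlevel (h : HasDensityDecay δ r₁ f) (t : ℝ) :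
    MeasurableSet (superlevel f t) := by
  have h1 : IsOpen (ball 0 1 ∩ f ⁻¹' Set.Ioi t) :=
    h.continuousOn.isOpen_inter_preimage isOpen_ball isOpen_Ioi
  have h2 : superlevel f t = closedBall 0 (1 / 2) ∩ (ball 0 1 ∩ f ⁻¹' Set.Ioi t) := by
    ext x
    simp only [superlevel, Set.mem_inter_iff, Set.mem_ofPred_eq, Set.mem_preimage, Set.mem_Ioi]
    refine ⟨fun hx => ⟨hx.1, closedBall_subset_ball (by norm_num) hx.1, hx.2⟩,
      fun hx => ⟨hx.1, hx.2.2⟩⟩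
  rw [h2]
  exact measurableSet_closedBall.inter h1.measurableSet

/-- A chain of small balls propagates smallness of `f` from one point to the whole ball. -/
theorem exists_small_near (h : HasDensityDecay δ r₁ f) (hδ : 0 < δ) (hr₁ : 0 < r₁)
    (hr₁' : r₁ ≤ 1) {y : EuclideanSpace ℝ (Fin n)} (hy : y ∈ closedBall 0 (1 / 2)) {m : ℝ}
    (hm : 0 < m) (hym : f y ≤ m) (i : ℕ) :
    ∀ z ∈ closedBall (0 : EuclideanSpace ℝ (Fin n)) (1 / 2), dist z y ≤ i * (r₁ / 4) →
      ∃ w ∈ closedBall (0 : EuclideanSpace ℝ (Fin n)) (1 / 2),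
        dist w z < r₁ / 8 ∧ f w ≤ m * δ⁻¹ ^ i := by
  induction i with
  | zero =>
    intro z hz hzy
    have : z = y := by simpa using hzy
    exact ⟨y, hy, by rw [this, dist_self]; positivity, by simpa using hym⟩
  | succ i ih =>
    intro z hz hzy
    have hi : (0 : ℝ) < (i : ℝ) + 1 := by positivity
    set c : ℝ := i / (i + 1) with hc
    have hc0 : 0 ≤ c := by positivity
    have hc1 : 1 - c = 1 / (i + 1) := by rw [hc]; field_simp; ring
    have hc1' : 0 ≤ 1 - c := by rw [hc1]; positivity
    rw [dist_eq_norm] at hzy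
    push_cast at hzy
    have hz'D : (1 - c) • y + c • z ∈ closedBall (0 : EuclideanSpace ℝ (Fin n)) (1 / 2) :=
      convex_closedBall _ _ hy hz hc1' hc0 (by ring)
    have hz'y : dist ((1 - c) • y + c • z) y ≤ i * (r₁ / 4) := by
      rw [dist_eq_norm, show (1 - c) • y + c • z - y = c • (z - y) by module, norm_smul,
        Real.norm_of_nonneg hc0]
      calc c * ‖z - y‖ ≤ c * ((i + 1) * (r₁ / 4)) := mul_le_mul_of_nonneg_left hzy hc0
        _ = i * (r₁ / 4) := by rw [hc]; field_simp
    have hz'z : dist z ((1 - c) • y + c • z) ≤ r₁ / 4 := by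
      rw [dist_eq_norm, show z - ((1 - c) • y + c • z) = (1 - c) • (z - y) by module, norm_smul,
        Real.norm_of_nonneg hc1']
      calc (1 - c) * ‖z - y‖ ≤ (1 - c) * ((i + 1) * (r₁ / 4)) :=
            mul_le_mul_of_nonneg_left hzy hc1'
        _ = r₁ / 4 := by rw [hc1]; field_simp
    obtain ⟨w, hw, hwz, hfw⟩ := ih _ hz'D hz'y
    by_contra! hcon
    have hd := h.density w hw r₁ hr₁ le_rfl (m * δ⁻¹ ^ (i + 1)) (by positivity)
      (hfw.trans_eq (by rw [pow_succ]; field_simp))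
    have hsub : ball z (r₁ / 8) ∩ closedBall 0 (1 / 2)
        ⊆ ball w r₁ ∩ {x | m * δ⁻¹ ^ (i + 1) ≤ f x} := by
      rintro x ⟨hx, hxD⟩
      refine ⟨?_, (hcon x hxD hx).le⟩
      rw [mem_ball] at hx ⊢
      have h1 := dist_triangle4 x z ((1 - c) • y + c • z) w
      rw [dist_comm w] at hwz
      linarith
    have hmono := measureReal_mono hsub
      (measure_ne_top_of_subset Set.inter_subset_left measure_ball_lt_top.ne) (μ := volume)
    have hlow := volume_real_ball_inter_closedBall hz (r := r₁ / 8) (by positivity) (by linarith)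
    have hpos := volume_real_ball_pos w hr₁
    rw [volume_real_ball _ (show 0 < r₁ / 8 by positivity), ← mul_assoc, ← mul_pow,
      show 1 / 2 * (r₁ / 8) = 1 / 16 * r₁ by ring, mul_pow, mul_assoc,
      ← volume_real_ball w hr₁] at hlow
    have : 0 < (1 / 16 : ℝ) ^ n * volume.real (ball w r₁) := by positivity
    nlinarith

theorem volume_ball_inter_superlevel_le (h : HasDensityDecay δ r₁ f) (hδ : 0 < δ) (hr₁ : 0 < r₁)
    (hr₁' : r₁ ≤ 1) {y : EuclideanSpace ℝ (Fin n)} (hy : y ∈ closedBall 0 (1 / 2)) {m : ℝ}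
    (hm : 0 < m) (hym : f y ≤ m) {N : ℕ} (hN : 1 ≤ N * (r₁ / 4))
    {z : EuclideanSpace ℝ (Fin n)} (hz : z ∈ closedBall 0 (1 / 2)) {t : ℝ}
    (ht : m * δ⁻¹ ^ (N + 1) ≤ t) :
    volume.real (ball z (r₁ / 2) ∩ superlevel f t)
      ≤ 1 / 2 * (1 / 2) ^ n * volume.real (ball z (r₁ / 2)) := by
  have hzy : dist z y ≤ N * (r₁ / 4) := by
    refine le_trans ?_ hN
    have h1 := dist_triangle_right z y 0
    rw [mem_closedBall] at hy hz
    linarith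
  obtain ⟨w, hw, hwz, hfw⟩ := h.exists_small_near hδ hr₁ hr₁' hy hm hym N z hz hzy
  have hd := h.density w hw r₁ hr₁ le_rfl (m * δ⁻¹ ^ (N + 1)) (by positivity)
    (hfw.trans_eq (by rw [pow_succ]; field_simp))
  have hsub : ball z (r₁ / 2) ∩ superlevel f t
      ⊆ ball w r₁ ∩ {x | m * δ⁻¹ ^ (N + 1) ≤ f x} := by
    rintro x ⟨hx, hxD⟩
    refine ⟨?_, ht.trans hxD.2.le⟩
    rw [mem_ball] at hx ⊢
    have h1 := dist_triangle x z w
    rw [dist_comm w] at hwz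
    linarith
  refine (measureReal_mono hsub
    (measure_ne_top_of_subset Set.inter_subset_left measure_ball_lt_top.ne)).trans
    (hd.trans ?_)
  rw [volume_real_ball _ hr₁, volume_real_ball _ (half_pos hr₁)]
  have h1 : (1 / 16 * r₁) ^ n ≤ (1 / 2 * (r₁ / 2)) ^ n :=
    pow_le_pow_left₀ (by positivity) (by linarith) n
  rw [mul_pow (1 / 16 : ℝ), mul_pow (1 / 2 : ℝ)] at h1
  nlinarith [mul_le_mul_of_nonneg_right h1
    (measureReal_nonneg (μ := volume) (s := ball (0 : EuclideanSpace ℝ (Fin n)) 1))]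

end HasDensityDecay

end DensityDecay

section LevelDecay

variable {n : ℕ}

namespace HasDensityDecay

variable {δ r₁ : ℝ} {f : EuclideanSpace ℝ (Fin n) → ℝ}

theorem exists_ball_inter_superlevel_eq (h : HasDensityDecay δ r₁ f) {t : ℝ}
    {z : EuclideanSpace ℝ (Fin n)} (hz : z ∈ superlevel f t) :
    ∃ r₀, 0 < r₀ ∧ ∀ r ≤ r₀, ball z r ∩ closedBall 0 (1 / 2) ⊆ ball z r ∩ superlevel f t := by
  have hz1 : z ∈ ball (0 : EuclideanSpace ℝ (Fin n)) 1 :=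
    closedBall_subset_ball (by norm_num) hz.1
  have h1 : IsOpen (ball 0 1 ∩ f ⁻¹' Set.Ioi t) :=
    h.continuousOn.isOpen_inter_preimage isOpen_ball isOpen_Ioi
  obtain ⟨r₀, hr₀, hsub⟩ := Metric.isOpen_iff.1 h1 z ⟨hz1, hz.2⟩
  refine ⟨r₀, hr₀, fun r hr x hx => ⟨hx.1, hx.2, ?_⟩⟩
  exact (hsub (ball_subset_ball hr hx.1)).2

/-- Each point of a superlevel set is the center of a ball in which a fixed proportion of the
points belongs to the next larger superlevel set but not to the given one. -/
theorem exists_radius_le_volume_diff (h : HasDensityDecay δ r₁ f) (hr₁ : 0 < r₁)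
    (hr₁' : r₁ ≤ 1) {t : ℝ} (ht : 0 < t)
    (hsmall : ∀ z ∈ closedBall (0 : EuclideanSpace ℝ (Fin n)) (1 / 2),
      volume.real (ball z (r₁ / 2) ∩ superlevel f t)
        ≤ 1 / 2 * (1 / 2) ^ n * volume.real (ball z (r₁ / 2)))
    {z : EuclideanSpace ℝ (Fin n)} (hz : z ∈ superlevel f t) :
    ∃ r, 0 < r ∧ r ≤ 1 ∧ 1 / 2 * (1 / 2) ^ n * volume.real (ball z r)
      ≤ volume.real (ball z r ∩ (superlevel f (δ * t) \ superlevel f t)) := by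
  classical
  have hex : ∃ j : ℕ, 1 / 2 * (1 / 2) ^ n * volume.real (ball z (r₁ / 2 * (1 / 2) ^ j))
      < volume.real (ball z (r₁ / 2 * (1 / 2) ^ j) ∩ superlevel f t) := by
    obtain ⟨r₀, hr₀, hsub⟩ := h.exists_ball_inter_superlevel_eq hz
    obtain ⟨j, hj⟩ := exists_pow_lt_of_lt_one hr₀ (show (1 / 2 : ℝ) < 1 by norm_num)
    have hj1 : (1 / 2 : ℝ) ^ j ≤ 1 := pow_le_one₀ (by norm_num) (by norm_num)
    have hj0 : (0 : ℝ) < (1 / 2) ^ j := by positivity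
    have hr : 0 < r₁ / 2 * (1 / 2) ^ j := by positivity
    refine ⟨j, ?_⟩
    have h1 := volume_real_ball_inter_closedBall hz.1 hr (by nlinarith)
    have h2 := measureReal_mono (hsub (r₁ / 2 * (1 / 2) ^ j) (by nlinarith))
      (measure_ne_top_of_subset Set.inter_subset_left measure_ball_lt_top.ne) (μ := volume)
    have h3 := volume_real_ball_pos z hr
    have h4 : 0 < (1 / 2 : ℝ) ^ n * volume.real (ball z (r₁ / 2 * (1 / 2) ^ j)) := by positivity
    linarith
  obtain ⟨i, hi⟩ : ∃ i, Nat.find hex = i + 1 := by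
    refine Nat.exists_eq_succ_of_ne_zero fun h0 => ?_
    have h1 := Nat.find_spec hex
    rw [h0] at h1
    simp only [pow_zero, mul_one] at h1
    exact absurd (hsmall z hz.1) (not_le.2 h1)
  have hbig := Nat.find_spec hex
  have hle := not_lt.1 (Nat.find_min hex (show i < Nat.find hex by omega))
  rw [hi] at hbig
  set r : ℝ := r₁ / 2 * (1 / 2) ^ i with hr
  have hi1 : (1 / 2 : ℝ) ^ i ≤ 1 := pow_le_one₀ (by norm_num) (by norm_num)
  have hr0 : 0 < r := by positivity
  have hr2 : 2 * r ≤ r₁ := by nlinarith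
  rw [show r₁ / 2 * (1 / 2) ^ (i + 1) = r / 2 by rw [hr, pow_succ]; ring] at hbig
  have hlevel : ball z r ∩ closedBall 0 (1 / 2) ⊆ superlevel f (δ * t) := by
    rintro w ⟨hwz, hw⟩
    refine ⟨hw, ?_⟩
    by_contra hcon
    have hd := h.density w hw (2 * r) (by positivity) hr2 t ht (not_lt.1 hcon)
    have hsub : ball z (r / 2) ∩ superlevel f t ⊆ ball w (2 * r) ∩ {x | t ≤ f x} := by
      rintro x ⟨hx, hxS⟩
      have hxt : t < f x := hxS.2
      refine ⟨?_, hxt.le⟩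
      rw [mem_ball] at hx hwz ⊢
      have h1 := dist_triangle x z w
      rw [dist_comm w] at hwz
      linarith
    have h1 := hbig.trans_le ((measureReal_mono hsub
      (measure_ne_top_of_subset Set.inter_subset_left measure_ball_lt_top.ne)).trans hd)
    rw [volume_real_ball _ (half_pos hr0), volume_real_ball _ (show 0 < 2 * r by positivity)] at h1
    have h2 : (1 / 16 * (2 * r)) ^ n ≤ (1 / 2 * (r / 2)) ^ n :=
      pow_le_pow_left₀ (by positivity) (by linarith) n
    rw [mul_pow (1 / 16 : ℝ), mul_pow (1 / 2 : ℝ)] at h2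
    nlinarith [mul_le_mul_of_nonneg_right h2
      (measureReal_nonneg (μ := volume) (s := ball (0 : EuclideanSpace ℝ (Fin n)) 1))]
  refine ⟨r, hr0, by linarith, ?_⟩
  have hlow := volume_real_ball_inter_closedBall hz.1 hr0 (by linarith)
  have hsub : ball z r ∩ closedBall 0 (1 / 2) ⊆ (ball z r ∩ superlevel f t)
      ∪ (ball z r ∩ (superlevel f (δ * t) \ superlevel f t)) := by
    rintro w ⟨hwz, hw⟩
    by_cases hwt : w ∈ superlevel f t
    · exact Or.inl ⟨hwz, hwt⟩
    · exact Or.inr ⟨hwz, hlevel ⟨hwz, hw⟩, hwt⟩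
  have hfin : volume ((ball z r ∩ superlevel f t)
      ∪ (ball z r ∩ (superlevel f (δ * t) \ superlevel f t))) ≠ ⊤ :=
    measure_ne_top_of_subset (Set.union_subset Set.inter_subset_left Set.inter_subset_left)
      (measure_ball_lt_top (x := z) (r := r)).ne
  have h1 := (measureReal_mono hsub hfin).trans (measureReal_union_le _ _)
  linarith

/-- The measure of the superlevel sets decays by a fixed factor from one level to the next. -/
theorem volume_superlevel_le_diff (h : HasDensityDecay δ r₁ f) (hr₁ : 0 < r₁)
    (hr₁' : r₁ ≤ 1) {t : ℝ} (ht : 0 < t)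
    (hsmall : ∀ z ∈ closedBall (0 : EuclideanSpace ℝ (Fin n)) (1 / 2),
      volume.real (ball z (r₁ / 2) ∩ superlevel f t)
        ≤ 1 / 2 * (1 / 2) ^ n * volume.real (ball z (r₁ / 2))) :
    volume.real (superlevel f t)
      ≤ 2 * 10 ^ n * volume.real (superlevel f (δ * t) \ superlevel f t) := by
  have hrad : ∀ z : EuclideanSpace ℝ (Fin n), ∃ r, z ∈ superlevel f t →
      0 < r ∧ r ≤ 1 ∧ 1 / 2 * (1 / 2) ^ n * volume.real (ball z r)
        ≤ volume.real (ball z r ∩ (superlevel f (δ * t) \ superlevel f t)) := by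
    intro z
    by_cases hz : z ∈ superlevel f t
    · obtain ⟨r, hr⟩ := h.exists_radius_le_volume_diff hr₁ hr₁' ht hsmall hz
      exact ⟨r, fun _ => hr⟩
    · exact ⟨0, fun hz' => absurd hz' hz⟩
  choose r hr using hrad
  set G := superlevel f (δ * t) \ superlevel f t with hG
  have hGm : MeasurableSet G :=
    (h.measurableSet_superlevel _).diff (h.measurableSet_superlevel _)
  have hGfin : volume G ≠ ⊤ :=
    measure_ne_top_of_subset Set.sdiff_subset (volume_superlevel_ne_top f _)
  obtain ⟨T, hTS, hdisj, hcov⟩ := Vitali.exists_disjoint_subfamily_covering_enlargement_closedBall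
    (superlevel f t) id r 1 (fun z hz => (hr z hz).2.1) 5 (by norm_num)
  have hTc : T.Countable := hdisj.countable_of_nonempty_interior fun z hz =>
    ⟨z, ball_subset_interior_closedBall (mem_ball_self (hr z (hTS hz)).1)⟩
  have hsub : superlevel f t ⊆ ⋃ z ∈ T, closedBall z (5 * r z) := by
    intro x hx
    obtain ⟨z, hz, hxz⟩ := hcov x hx
    exact Set.mem_biUnion hz (hxz (mem_closedBall_self (hr x hx).1.le))
  have hball : ∀ z ∈ T, volume (closedBall z (5 * r z))
      ≤ ENNReal.ofReal (2 * 10 ^ n) * volume (ball z (r z) ∩ G) := by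
    intro z hz
    obtain ⟨hr0, -, hrG⟩ := hr z (hTS hz)
    have hfin : volume (ball z (r z) ∩ G) ≠ ⊤ :=
      measure_ne_top_of_subset Set.inter_subset_left measure_ball_lt_top.ne
    rw [← ENNReal.ofReal_toReal hfin, ← ENNReal.ofReal_mul (by positivity),
      ← ENNReal.ofReal_toReal (measure_closedBall_lt_top (x := z) (r := 5 * r z)).ne]
    refine ENNReal.ofReal_le_ofReal ?_
    change volume.real _ ≤ _ * volume.real _
    rw [Measure.addHaar_real_closedBall _ _ (by positivity), finrank_euclideanSpace_fin]
    rw [volume_real_ball _ hr0] at hrG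
    calc (5 * r z) ^ n * volume.real (ball (0 : EuclideanSpace ℝ (Fin n)) 1)
        = 2 * 10 ^ n * (1 / 2 * (1 / 2) ^ n *
          (r z ^ n * volume.real (ball (0 : EuclideanSpace ℝ (Fin n)) 1))) := by
          rw [show (10 : ℝ) = 5 * 2 by norm_num, mul_pow, mul_pow, one_div, inv_pow]
          field_simp
      _ ≤ _ := mul_le_mul_of_nonneg_left hrG (by positivity)
  have hdisj' : T.PairwiseDisjoint fun z => ball z (r z) ∩ G := fun a ha b hb hab =>
    (hdisj ha hb hab).mono (Set.inter_subset_left.trans ball_subset_closedBall)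
      (Set.inter_subset_left.trans ball_subset_closedBall)
  have hmain : volume (superlevel f t) ≤ ENNReal.ofReal (2 * 10 ^ n) * volume G := by
    have := hTc.to_subtype
    calc volume (superlevel f t) ≤ volume (⋃ z ∈ T, closedBall z (5 * r z)) := measure_mono hsub
      _ ≤ ∑' z : T, volume (closedBall (z : EuclideanSpace ℝ (Fin n)) (5 * r z)) :=
          measure_biUnion_le _ hTc _
      _ ≤ ∑' z : T, ENNReal.ofReal (2 * 10 ^ n)
            * volume (ball (z : EuclideanSpace ℝ (Fin n)) (r z) ∩ G) :=
          ENNReal.tsum_le_tsum fun z => hball z z.2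
      _ = ENNReal.ofReal (2 * 10 ^ n) * volume (⋃ z ∈ T, ball z (r z) ∩ G) := by
          rw [ENNReal.tsum_mul_left,
            measure_biUnion hTc hdisj' fun z _ => measurableSet_ball.inter hGm]
      _ ≤ _ := by
          gcongr
          exact Set.iUnion₂_subset fun z _ => Set.inter_subset_right
  have := ENNReal.toReal_mono (ENNReal.mul_ne_top ENNReal.ofReal_ne_top hGfin) hmain
  rwa [ENNReal.toReal_mul, ENNReal.toReal_ofReal (by positivity)] at this

end HasDensityDecay

end LevelDecay

section WeakHarnack

variable {n : ℕ}

namespace HasDensityDecay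

variable {δ r₁ : ℝ} {f : EuclideanSpace ℝ (Fin n) → ℝ}

theorem volume_superlevel_le_mul (h : HasDensityDecay δ r₁ f) (hδ1 : δ < 1)
    (hr₁ : 0 < r₁) (hr₁' : r₁ ≤ 1) {t : ℝ} (ht : 0 < t)
    (hsmall : ∀ z ∈ closedBall (0 : EuclideanSpace ℝ (Fin n)) (1 / 2),
      volume.real (ball z (r₁ / 2) ∩ superlevel f t)
        ≤ 1 / 2 * (1 / 2) ^ n * volume.real (ball z (r₁ / 2))) :
    volume.real (superlevel f t)
      ≤ 2 * 10 ^ n / (1 + 2 * 10 ^ n) * volume.real (superlevel f (δ * t)) := by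
  have h1 := h.volume_superlevel_le_diff hr₁ hr₁' ht hsmall
  have hsub : superlevel f t ⊆ superlevel f (δ * t) := fun x hx =>
    ⟨hx.1, lt_of_le_of_lt (mul_le_of_le_one_left ht.le hδ1.le) hx.2⟩
  have h2 := measureReal_sdiff_add_inter (μ := volume) (s := superlevel f (δ * t))
    (h.measurableSet_superlevel t) (volume_superlevel_ne_top f _)
  rw [Set.inter_eq_right.2 hsub] at h2
  have hpos : (0 : ℝ) < 10 ^ n := by positivity
  rw [div_mul_eq_mul_div, le_div_iff₀ (by positivity)]
  nlinarith

theorem volume_superlevel_le_pow (h : HasDensityDecay δ r₁ f) (hδ : 0 < δ) (hδ1 : δ < 1)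
    (hr₁ : 0 < r₁) (hr₁' : r₁ ≤ 1) {y : EuclideanSpace ℝ (Fin n)}
    (hy : y ∈ closedBall 0 (1 / 2)) {m : ℝ} (hm : 0 < m) (hym : f y ≤ m) {N : ℕ}
    (hN : 1 ≤ N * (r₁ / 4)) (k : ℕ) :
    volume.real (superlevel f (m * δ⁻¹ ^ (N + 1) * δ⁻¹ ^ k))
      ≤ (2 * 10 ^ n / (1 + 2 * 10 ^ n)) ^ k
        * volume.real (closedBall (0 : EuclideanSpace ℝ (Fin n)) (1 / 2)) := by
  induction k with
  | zero =>
    simpa using measureReal_mono (superlevel_subset f (m * δ⁻¹ ^ (N + 1)))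
      measure_closedBall_lt_top.ne (μ := volume)
  | succ k ih =>
    have hinv : 1 ≤ δ⁻¹ := (one_le_inv₀ hδ).2 hδ1.le
    have hb : 0 < m * δ⁻¹ ^ (N + 1) := by positivity
    have h1 := h.volume_superlevel_le_mul hδ1 hr₁ hr₁'
      (t := m * δ⁻¹ ^ (N + 1) * δ⁻¹ ^ (k + 1)) (by positivity) fun z hz =>
      h.volume_ball_inter_superlevel_le hδ hr₁ hr₁' hy hm hym hN hz
        (le_mul_of_one_le_right hb.le (one_le_pow₀ hinv))
    rw [show δ * (m * δ⁻¹ ^ (N + 1) * δ⁻¹ ^ (k + 1)) = m * δ⁻¹ ^ (N + 1) * δ⁻¹ ^ k by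
      rw [pow_succ _ k]; field_simp] at h1
    refine h1.trans ((mul_le_mul_of_nonneg_left ih (by positivity)).trans_eq ?_)
    ring

end HasDensityDecay

/-- Dyadic decomposition of a power of `v` along the levels `b * M ^ k`. -/
theorem rpow_le_sum_levels {b M q v : ℝ} (hb : 0 < b) (hM : 0 < M) (hq : 0 < q) (hv : 0 ≤ v)
    (J : ℕ) (hJ : v ≤ b * M ^ J) :
    v ^ q ≤ b ^ q + ∑ k ∈ Finset.range J,
      b ^ q * (M ^ q) ^ (k + 1) * (if b * M ^ k < v then 1 else 0) := by
  induction J with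
  | zero => simpa using Real.rpow_le_rpow hv (by simpa using hJ) hq.le
  | succ J ih =>
    rw [Finset.sum_range_succ, ← add_assoc]
    by_cases hJ' : v ≤ b * M ^ J
    · refine (ih hJ').trans (le_add_of_nonneg_right ?_)
      split_ifs <;> positivity
    · rw [if_pos (not_le.1 hJ'), mul_one]
      have h1 := Real.rpow_le_rpow hv hJ hq.le
      rw [Real.mul_rpow hb.le (by positivity), ← Real.rpow_natCast M, ← Real.rpow_mul hM.le,
        mul_comm _ q, Real.rpow_mul hM.le, Real.rpow_natCast] at h1
      refine h1.trans (le_add_of_nonneg_left (add_nonneg (by positivity)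
        (Finset.sum_nonneg fun k _ => ?_)))
      split_ifs <;> positivity

namespace HasDensityDecay

variable {δ r₁ : ℝ} {f : EuclideanSpace ℝ (Fin n) → ℝ}

theorem integral_rpow_le (h : HasDensityDecay δ r₁ f) (hδ : 0 < δ) (hδ1 : δ < 1) (hr₁ : 0 < r₁)
    (hr₁' : r₁ ≤ 1) {y : EuclideanSpace ℝ (Fin n)} (hy : y ∈ closedBall 0 (1 / 2)) {m : ℝ}
    (hm : 0 < m) (hym : f y ≤ m) {N : ℕ} (hN : 1 ≤ N * (r₁ / 4)) {q : ℝ} (hq : 0 < q)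
    (hθ : δ⁻¹ ^ q * (2 * 10 ^ n / (1 + 2 * 10 ^ n)) < 1) :
    ∫ x in ball (0 : EuclideanSpace ℝ (Fin n)) (1 / 2), f x ^ q
      ≤ (m * δ⁻¹ ^ (N + 1)) ^ q
        * (volume.real (closedBall (0 : EuclideanSpace ℝ (Fin n)) (1 / 2))
        * (1 + δ⁻¹ ^ q * (1 - δ⁻¹ ^ q * (2 * 10 ^ n / (1 + 2 * 10 ^ n)))⁻¹)) := by
  have hsubD : closedBall (0 : EuclideanSpace ℝ (Fin n)) (1 / 2) ⊆ ball 0 1 :=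
    closedBall_subset_ball (by norm_num)
  have hcont : ContinuousOn f (closedBall 0 (1 / 2)) := h.continuousOn.mono hsubD
  have hinv : 1 < δ⁻¹ := (one_lt_inv₀ hδ).2 hδ1
  set b : ℝ := m * δ⁻¹ ^ (N + 1) with hb
  have hb0 : 0 < b := by positivity
  set D := closedBall (0 : EuclideanSpace ℝ (Fin n)) (1 / 2) with hD
  set θ : ℝ := 2 * 10 ^ n / (1 + 2 * 10 ^ n) with hθdef
  have hθ0 : 0 ≤ θ := by positivity
  set a : ℝ := δ⁻¹ ^ q with ha
  have ha0 : 0 < a := by positivity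
  obtain ⟨J, hJ⟩ : ∃ J : ℕ, ∀ x ∈ D, f x ≤ b * δ⁻¹ ^ J := by
    obtain ⟨C, hC⟩ := (isCompact_closedBall (0 : EuclideanSpace ℝ (Fin n)) (1 / 2)
      ).exists_bound_of_continuousOn hcont
    obtain ⟨J, hJ⟩ := pow_unbounded_of_one_lt (C / b) hinv
    refine ⟨J, fun x hx => ?_⟩
    rw [div_lt_iff₀ hb0] at hJ
    linarith [le_abs_self (f x), hC x hx, Real.norm_eq_abs (f x)]
  have hqc : ContinuousOn (fun x => f x ^ q) D := hcont.rpow_const fun x hx => Or.inr hq.le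
  have hqi : IntegrableOn (fun x => f x ^ q) D := hqc.integrableOn_compact (isCompact_closedBall _ _)
  have hterm : ∀ k : ℕ, IntegrableOn
      (fun x => b ^ q * a ^ (k + 1) * (superlevel f (b * δ⁻¹ ^ k)).indicator 1 x) D := fun k =>
    (((integrable_indicator_iff (h.measurableSet_superlevel _)).2
      (integrableOn_const (volume_superlevel_ne_top f _))).const_mul _).integrableOn
  have hconst : IntegrableOn (fun _ : EuclideanSpace ℝ (Fin n) => b ^ q) D :=
    integrableOn_const measure_closedBall_lt_top.ne
  have hsum : IntegrableOn (fun x => ∑ k ∈ Finset.range J,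
      b ^ q * a ^ (k + 1) * (superlevel f (b * δ⁻¹ ^ k)).indicator 1 x) D :=
    integrable_finsetSum _ fun k _ => hterm k
  calc ∫ x in ball (0 : EuclideanSpace ℝ (Fin n)) (1 / 2), f x ^ q
      ≤ ∫ x in D, f x ^ q := by
        refine setIntegral_mono_set hqi ?_ ball_subset_closedBall.eventuallyLE
        filter_upwards [ae_restrict_mem measurableSet_closedBall] with x hx
        exact Real.rpow_nonneg (h.nonneg x (hsubD hx)) q
    _ ≤ ∫ x in D, (b ^ q + ∑ k ∈ Finset.range J,
          b ^ q * a ^ (k + 1) * (superlevel f (b * δ⁻¹ ^ k)).indicator 1 x) := by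
        refine setIntegral_mono_on hqi (hconst.add hsum) measurableSet_closedBall fun x hx => ?_
        refine (rpow_le_sum_levels hb0 (zero_lt_one.trans hinv) hq (h.nonneg x (hsubD hx)) J
          (hJ x hx)).trans_eq ?_
        congr 1
        refine Finset.sum_congr rfl fun k _ => ?_
        congr 1
        by_cases hk : b * δ⁻¹ ^ k < f x
        · rw [if_pos hk, Set.indicator_of_mem (show x ∈ superlevel f (b * δ⁻¹ ^ k) from ⟨hx, hk⟩),
            Pi.one_apply]
        · rw [if_neg hk, Set.indicator_of_notMem fun hx' => hk hx'.2]
    _ = b ^ q * volume.real D + ∑ k ∈ Finset.range J,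
          b ^ q * a ^ (k + 1) * volume.real (superlevel f (b * δ⁻¹ ^ k)) := by
        rw [integral_add hconst hsum, integral_finsetSum _ fun k _ => hterm k, setIntegral_const,
          smul_eq_mul, mul_comm]
        congr 1
        refine Finset.sum_congr rfl fun k _ => ?_
        rw [integral_const_mul, integral_indicator_one (h.measurableSet_superlevel _),
          measureReal_restrict_apply (h.measurableSet_superlevel _),
          Set.inter_eq_left.2 (superlevel_subset f _)]
    _ ≤ b ^ q * volume.real D + ∑ k ∈ Finset.range J,
          b ^ q * a ^ (k + 1) * (θ ^ k * volume.real D) := by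
        gcongr with k _
        exact h.volume_superlevel_le_pow hδ hδ1 hr₁ hr₁' hy hm hym hN k
    _ = b ^ q * (volume.real D * (1 + a * ∑ k ∈ Finset.range J, (a * θ) ^ k)) := by
        rw [mul_add, mul_add, mul_one, Finset.mul_sum, Finset.mul_sum, Finset.mul_sum]
        congr 1
        refine Finset.sum_congr rfl fun k _ => ?_
        rw [mul_pow]
        ring
    _ ≤ _ := by
        have hgeom := hasSum_geometric_of_lt_one (by positivity) hθ
        gcongr
        exact sum_le_hasSum _ (fun k _ => by positivity) hgeom

end HasDensityDecay

/-- The weak Harnack inequality for functions with decaying densities. -/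
theorem exists_weak_harnack_of_hasDensityDecay (n : ℕ) {δ r₁ : ℝ} (hδ : 0 < δ) (hδ1 : δ < 1)
    (hr₁ : 0 < r₁) (hr₁' : r₁ ≤ 1) :
    ∃ C₀ q : ℝ, 0 < C₀ ∧ 0 < q ∧ ∀ f : EuclideanSpace ℝ (Fin n) → ℝ, HasDensityDecay δ r₁ f →
      ∀ y ∈ closedBall (0 : EuclideanSpace ℝ (Fin n)) (1 / 2),
        (∫ x in ball (0 : EuclideanSpace ℝ (Fin n)) (1 / 2), f x ^ q) ^ (1 / q) ≤ C₀ * f y := by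
  obtain ⟨N, hN⟩ := exists_nat_ge (4 / r₁)
  have hN' : 1 ≤ N * (r₁ / 4) := by
    rw [div_le_iff₀ hr₁] at hN
    linarith
  set θ : ℝ := 2 * 10 ^ n / (1 + 2 * 10 ^ n) with hθ
  have hθ0 : 0 < θ := by positivity
  have hθ1 : θ < 1 := by rw [hθ, div_lt_one (by positivity)]; linarith
  have hinv : 1 < δ⁻¹ := (one_lt_inv₀ hδ).2 hδ1
  have hθinv : 1 < θ⁻¹ := (one_lt_inv₀ hθ0).2 hθ1
  set q : ℝ := Real.logb δ⁻¹ ((1 + θ⁻¹) / 2) with hqdef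
  have hq : 0 < q := Real.logb_pos hinv (by linarith)
  have ha : δ⁻¹ ^ q = (1 + θ⁻¹) / 2 :=
    Real.rpow_logb (by positivity) hinv.ne' (by positivity)
  have haθ : δ⁻¹ ^ q * θ < 1 := by
    rw [ha, div_mul_eq_mul_div, add_mul, inv_mul_cancel₀ hθ0.ne']
    linarith
  set V : ℝ := volume.real (closedBall (0 : EuclideanSpace ℝ (Fin n)) (1 / 2))
    * (1 + δ⁻¹ ^ q * (1 - δ⁻¹ ^ q * θ)⁻¹) with hV
  have hV0 : 0 < V := by
    have h1 : 0 < volume.real (closedBall (0 : EuclideanSpace ℝ (Fin n)) (1 / 2)) := by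
      refine (volume_real_ball_pos 0 (show (0 : ℝ) < 1 / 2 by norm_num)).trans_le
        (measureReal_mono ball_subset_closedBall measure_closedBall_lt_top.ne)
    have h2 : 0 < (1 - δ⁻¹ ^ q * θ)⁻¹ := inv_pos.2 (by linarith)
    positivity
  refine ⟨δ⁻¹ ^ (N + 1) * V ^ (1 / q), q, by positivity, hq, fun f h y hy => ?_⟩
  have hfy : 0 ≤ f y := h.nonneg y (closedBall_subset_ball (by norm_num) hy)
  have hint : 0 ≤ ∫ x in ball (0 : EuclideanSpace ℝ (Fin n)) (1 / 2), f x ^ q :=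
    setIntegral_nonneg measurableSet_ball fun x hx =>
      Real.rpow_nonneg (h.nonneg x (ball_subset_ball (by norm_num) hx)) q
  have key : ∀ m, 0 < m → f y ≤ m →
      (∫ x in ball (0 : EuclideanSpace ℝ (Fin n)) (1 / 2), f x ^ q) ^ (1 / q)
        ≤ δ⁻¹ ^ (N + 1) * V ^ (1 / q) * m := by
    intro m hm hym
    have h1 := h.integral_rpow_le hδ hδ1 hr₁ hr₁' hy hm hym hN' hq haθ
    refine (Real.rpow_le_rpow hint h1 (by positivity)).trans_eq ?_
    rw [Real.mul_rpow (by positivity) hV0.le, ← Real.rpow_mul (by positivity),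
      mul_one_div_cancel hq.ne', Real.rpow_one]
    ring
  set C := δ⁻¹ ^ (N + 1) * V ^ (1 / q) with hC
  have hC0 : 0 < C := by positivity
  refine le_of_forall_pos_le_add fun η hη => ?_
  refine (key (f y + η / C) (by positivity) (by linarith [div_pos hη hC0])).trans_eq ?_
  field_simp

end WeakHarnack

section Assembly

open Matrix

variable {n : ℕ}

theorem Fmat_eq_fderiv {F : Jet n → ℝ} {u : EuclideanSpace ℝ (Fin n) → ℝ}
    {x : EuclideanSpace ℝ (Fin n)} (hF : DifferentiableAt ℝ F (jet u x)) (i j : Fin n) :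
    Fmat F u x i j = fderiv ℝ F (jet u x) (unitEntry i j, 0, 0, 0) := by
  have h1 : HasFDerivAt (fun A : Fin n → Fin n → ℝ => ((A, fun l => pd u x l, u x, x) : Jet n))
      ((ContinuousLinearMap.id ℝ (Fin n → Fin n → ℝ)).prod 0) (fun a b => hessM u x a b) :=
    (hasFDerivAt_id _).prodMk (hasFDerivAt_const _ _)
  have h2 := HasFDerivAt.comp (fun a b => hessM u x a b) (g := F) hF.hasFDerivAt h1
  have h3 : Fmat F u x i j
      = fderiv ℝ (F ∘ fun A => ((A, fun l => pd u x l, u x, x) : Jet n))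
        (fun a b => hessM u x a b) (unitEntry i j) := rfl
  rw [h3, h2.fderiv]
  rfl

theorem sum_Fmat_eq_quadratic {F : Jet n → ℝ} {u : EuclideanSpace ℝ (Fin n) → ℝ}
    {x : EuclideanSpace ℝ (Fin n)} (hF : DifferentiableAt ℝ F (jet u x)) (ξ : Fin n → ℝ) :
    ∑ i, ∑ j, Fmat F u x i j * ξ i * ξ j = ξ ⬝ᵥ symbol F (jet u x) *ᵥ ξ := by
  have hY : (of fun i j => ξ i * ξ j).IsSymm := by
    ext i j
    simp [mul_comm]
  have h1 := fderiv_symm_eq_sum F (jet u x) hY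
  have h2 := fderiv_matrix_eq_sum (fderiv ℝ F (jet u x)) fun i j => ξ i * ξ j
  calc ∑ i, ∑ j, Fmat F u x i j * ξ i * ξ j
      = ∑ i, ∑ j, fderiv ℝ F (jet u x) (unitEntry i j, 0, 0, 0) * (ξ i * ξ j) := by
        simp only [Fmat_eq_fderiv hF, mul_assoc]
    _ = ∑ i, ∑ j, symbol F (jet u x) i j * (ξ i * ξ j) := h2.symm.trans h1
    _ = _ := by
        simp only [dotProduct, mulVec, Finset.mul_sum]
        exact Finset.sum_congr rfl fun i _ => Finset.sum_congr rfl fun j _ => by ring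

theorem ellipticBound_symbol {L : ℝ} {F : Jet n → ℝ} {u : EuclideanSpace ℝ (Fin n) → ℝ}
    {x : EuclideanSpace ℝ (Fin n)} (hF : DifferentiableAt ℝ F (jet u x))
    (h : ∀ ξ : Fin n → ℝ, L⁻¹ * ∑ i, ξ i ^ 2 ≤ ∑ i, ∑ j, Fmat F u x i j * ξ i * ξ j ∧
      ∑ i, ∑ j, Fmat F u x i j * ξ i * ξ j ≤ L * ∑ i, ξ i ^ 2) :
    EllipticBound L (symbol F (jet u x)) := by
  intro ξ
  have h1 := h ξ
  rw [sum_Fmat_eq_quadratic hF] at h1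
  simpa only [dotProduct, pow_two] using h1

theorem IsAdmissible.eigenvalue_le {L K : ℝ} {F : Jet n → ℝ} {u : EuclideanSpace ℝ (Fin n) → ℝ}
    {lam : EuclideanSpace ℝ (Fin n) → Fin n → ℝ} (h : IsAdmissible L K F u)
    (hs : IsSpectrum u lam) {x : EuclideanSpace ℝ (Fin n)} (hx : x ∈ ball 0 1) (ℓ : Fin n) :
    lam x ℓ ≤ n ^ 2 * K := by
  obtain ⟨U, hU, -, h1⟩ := hs.exists_diagonalization h.contDiffOn_u hx
  have h2 := quadratic_le_sum_abs (hessM u x) (col_dotProduct_col hU ℓ)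
  rw [h1, conj_diagonal_col hU, ← h1] at h2
  refine h2.trans ((Finset.sum_le_sum fun a _ => Finset.sum_le_sum fun b _ =>
    h.abs_hessM_le hx a b).trans_eq ?_)
  simp
  ring

/-- The eigenvalues of the Hessian have decaying densities, with uniform parameters. -/
theorem exists_hasDensityDecay_eigenvalue (n : ℕ) {L K : ℝ} (hL : 0 < L) (hK : 0 ≤ K) :
    ∃ δ r₁ : ℝ, 0 < δ ∧ δ < 1 ∧ 0 < r₁ ∧ r₁ ≤ 1 ∧
      ∀ (F : Jet n → ℝ) (u : EuclideanSpace ℝ (Fin n) → ℝ)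
        (lam : EuclideanSpace ℝ (Fin n) → Fin n → ℝ), IsAdmissible L K F u → IsSpectrum u lam →
        ∀ ℓ, HasDensityDecay δ r₁ fun x => lam x ℓ := by
  set T : ℝ := n ^ 2 * K + 1 with hT
  have hT0 : 0 ≤ T := by positivity
  set A : ℝ := 2 * n ^ 2 * meanConst n L (K * (K + 1)) (weakConst n L K T) with hA
  have hA0 : 0 ≤ A := by
    have := meanConst_nonneg (n := n) (P := K * (K + 1)) hL
      (weakConst_nonneg (n := n) hL hK hT0)
    positivity
  set ε : ℝ := 1 / 2 * (1 / 16) ^ n with hε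
  have hε0 : 0 < ε := by positivity
  have hε1 : ε < 1 := by
    have : (1 / 16 : ℝ) ^ n ≤ 1 := pow_le_one₀ (by norm_num) (by norm_num)
    linarith
  set δ : ℝ := ε / (2 * (A + 1)) with hδ
  have hδ0 : 0 < δ := by positivity
  have hδ1 : δ < 1 := by
    rw [hδ, div_lt_one (by positivity)]
    linarith
  have hAδ : A * δ ≤ ε / 2 := by
    rw [hδ, mul_div_assoc', div_le_div_iff₀ (by positivity) two_pos]
    nlinarith
  have hL1 : 0 < 4 * (L + 1) ^ 2 := by positivity
  refine ⟨δ, min δ (4 * (L + 1) ^ 2)⁻¹, hδ0, hδ1, lt_min hδ0 (inv_pos.2 hL1),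
    (min_le_left _ _).trans hδ1.le, fun F u lam h hs ℓ =>
    ⟨hs.continuousOn_eigenvalue h.contDiffOn_u ℓ, fun x hx => hs.nonneg x hx ℓ,
      fun y hy r hr hr₁ t ht hyt => ?_⟩⟩
  have hrδ : r ≤ δ := hr₁.trans (min_le_left _ _)
  have hrL : r * (4 * (L + 1) ^ 2) ≤ 1 := by
    have := hr₁.trans (min_le_right _ _)
    rwa [← one_div, le_div_iff₀ hL1] at this
  have hsub : closedBall y (r * (L + 1) ^ 2) ⊆ ball 0 1 := by
    refine closedBall_subset_ball' ?_
    rw [mem_closedBall] at hy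
    linarith
  have hsub' : ball y r ⊆ ball 0 1 := by
    refine Set.Subset.trans (fun x hx => ?_) hsub
    have : 1 ≤ (L + 1) ^ 2 := one_le_pow₀ (by linarith)
    rw [mem_ball] at hx
    rw [mem_closedBall]
    nlinarith
  rcases le_or_gt t T with htT | htT
  · refine (h.volume_eigenvalue_le hs hL hK ht htT ℓ hr hsub).trans
      (mul_le_mul_of_nonneg_right ?_ measureReal_nonneg)
    have h1 : lam y ℓ / t ≤ δ := (div_le_iff₀ ht).2 hyt
    have h2 : r ^ 2 ≤ δ := by nlinarith
    calc A * (lam y ℓ / t + r ^ 2) ≤ A * (δ + δ) :=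
          mul_le_mul_of_nonneg_left (add_le_add h1 h2) hA0
      _ ≤ ε := by linarith
  · have hempty : ball y r ∩ {x | t ≤ lam x ℓ} = ∅ := by
      refine Set.eq_empty_of_forall_notMem fun x hx => ?_
      have h1 := h.eigenvalue_le hs (hsub' hx.1) ℓ
      have h2 : t ≤ lam x ℓ := hx.2
      linarith
    rw [hempty, measureReal_empty]
    positivity

end Assembly

/-- Theorem 1.1 of the paper: weak Harnack inequality for the eigenvalues.
Let `B` be the open unit ball of `ℝⁿ` and let `F(A,p,u,x)` be `C²` (with `C²` norm at
most `K`) on `Symₙ(ℝ) × ℝⁿ × ℝ × B` satisfying the Bian–Guan structure condition: for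
each fixed `p`, the map `(A,u,x) ↦ F(A⁻¹,p,u,x)` is locally convex on
`Sym⁺ₙ(ℝ) × ℝ × B`.  Let `u ∈ C³(B)` (with `C³` norm at most `K`) be a convex solution
of `F(D²u,Du,u,x) = 0` on `B`, uniformly elliptic with constant `Λ`, and let
`0 ≤ lam x 0 ≤ ⋯ ≤ lam x (n-1)` be the increasing eigenvalues of `D²u(x)` (encoded by
the factorization of the characteristic polynomial).  Then there are constants
`C₀, q > 0` depending only on `n`, `Λ` and `K` such that for each `ℓ`,
`‖λ_ℓ‖_{L^q(B_{1/2})} ≤ C₀ inf_{B_{1/2}} λ_ℓ` (the infimum bound being expressed by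
quantifying over all `y ∈ B_{1/2}`). -/
theorem weak_harnack_for_eigenvalues (n : ℕ) (Λ K : ℝ) (hΛ : 0 < Λ) (hK : 0 ≤ K) :
    ∃ C₀ q : ℝ, 0 < C₀ ∧ 0 < q ∧
      ∀ (F : (Fin n → Fin n → ℝ) × (Fin n → ℝ) × ℝ × EuclideanSpace ℝ (Fin n) → ℝ)
        (u : EuclideanSpace ℝ (Fin n) → ℝ)
        (lam : EuclideanSpace ℝ (Fin n) → Fin n → ℝ),
        -- F is C² on Symₙ(ℝ) × ℝⁿ × ℝ × B, with C² norm at most K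
        ContDiffOn ℝ 2 F {z | z.2.2.2 ∈ ball (0 : EuclideanSpace ℝ (Fin n)) 1} →
        (∀ z : (Fin n → Fin n → ℝ) × (Fin n → ℝ) × ℝ × EuclideanSpace ℝ (Fin n),
          z.2.2.2 ∈ ball (0 : EuclideanSpace ℝ (Fin n)) 1 →
          ∀ i ≤ 2, ‖iteratedFDeriv ℝ i F z‖ ≤ K) →
        -- structure condition: (A,u,x) ↦ F(A⁻¹,p,u,x) is locally convex on Sym⁺ₙ×ℝ×B
        (∀ p : Fin n → ℝ,
          ∀ z ∈ {w : (Fin n → Fin n → ℝ) × ℝ × EuclideanSpace ℝ (Fin n) |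
              (Matrix.of w.1).PosDef ∧ w.2.2 ∈ ball (0 : EuclideanSpace ℝ (Fin n)) 1},
            ∃ t, IsOpen t ∧ z ∈ t ∧
              ConvexOn ℝ
                ({w : (Fin n → Fin n → ℝ) × ℝ × EuclideanSpace ℝ (Fin n) |
                    (Matrix.of w.1).PosDef ∧
                      w.2.2 ∈ ball (0 : EuclideanSpace ℝ (Fin n)) 1} ∩ t)
                (fun w => F (fun i j => (Matrix.of w.1)⁻¹ i j, p, w.2.1, w.2.2))) →
        -- u is C³ and convex on B, with C³ norm at most K
        ContDiffOn ℝ 3 u (ball 0 1) →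
        ConvexOn ℝ (ball 0 1) u →
        (∀ x ∈ ball (0 : EuclideanSpace ℝ (Fin n)) 1,
          ∀ i ≤ 3, ‖iteratedFDeriv ℝ i u x‖ ≤ K) →
        -- u solves F(D²u, Du, u, x) = 0 on B
        (∀ x ∈ ball (0 : EuclideanSpace ℝ (Fin n)) 1,
          F (fun i j => hessM u x i j, fun l => pd u x l, u x, x) = 0) →
        -- uniform ellipticity
        (∀ x ∈ ball (0 : EuclideanSpace ℝ (Fin n)) 1, ∀ ξ : Fin n → ℝ,
          Λ⁻¹ * ∑ i, ξ i ^ 2 ≤ ∑ i, ∑ j, Fmat F u x i j * ξ i * ξ j ∧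
          ∑ i, ∑ j, Fmat F u x i j * ξ i * ξ j ≤ Λ * ∑ i, ξ i ^ 2) →
        -- lam lists the (nonnegative) eigenvalues of D²u in increasing order
        (∀ x ∈ ball (0 : EuclideanSpace ℝ (Fin n)) 1,
          Monotone (lam x) ∧ (∀ i, 0 ≤ lam x i) ∧
          (hessM u x).charpoly = ∏ i, (Polynomial.X - Polynomial.C (lam x i))) →
        -- conclusion: the weak Harnack inequality for each eigenvalue
        ∀ ℓ : Fin n, ∀ y ∈ ball (0 : EuclideanSpace ℝ (Fin n)) (1 / 2),
          (∫ x in ball (0 : EuclideanSpace ℝ (Fin n)) (1 / 2), lam x ℓ ^ q) ^ (1 / q)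
            ≤ C₀ * lam y ℓ := by
  obtain ⟨δ, r₁, hδ, hδ1, hr₁, hr₁', hdecay⟩ := exists_hasDensityDecay_eigenvalue n hΛ hK
  obtain ⟨C₀, q, hC₀, hq, hmain⟩ := exists_weak_harnack_of_hasDensityDecay n hδ hδ1 hr₁ hr₁'
  refine ⟨C₀, q, hC₀, hq, fun F u lam hF hFK hconv hu _ huK heq hell hlam ℓ y hy => ?_⟩
  have hs : IsSpectrum u lam :=
    ⟨fun x hx => (hlam x hx).1, fun x hx => (hlam x hx).2.1, fun x hx => (hlam x hx).2.2⟩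
  have hadm : IsAdmissible Λ K F u :=
    { contDiffOn_F := hF
      norm_F_le := hFK
      inverseConvex := hconv
      contDiffOn_u := hu
      norm_u_le := huK
      equation := heq
      elliptic := fun x hx => ellipticBound_symbol
        ((hF.differentiableOn two_ne_zero).differentiableAt (isOpen_jetDomain.mem_nhds hx))
        (hell x hx)
      posSemidef := fun x hx => hs.posSemidef hu hx }
  exact hmain _ (hdecay F u lam hadm hs ℓ) y (ball_subset_closedBall hy)
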